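/- Let n ≥ 1 and let G be a closed subgroup of O(n) acting transitively on the unit sphere S^{n−1}. Let μ be a continuous translation-invariant valuation on ℝⁿ with μ(gK) = μ(K) for all g ∈ G. Let 𝒦₁ denote the set of nonempty compact convex subsets of the closed unit ball of ℝⁿ, equipped with the Hausdorff metric. Then for every invertible real n×n matrix A the function K ↦ μ(A⁻¹(K)) is a bounded continuous function on 𝒦₁, and the map A ↦ (K ↦ μ(A⁻¹(K))), from the open set of invertible matrices in the space of real n×n matrices to the Banach space of bounded continuous real-valued functions on 𝒦₁ with the supremum norm, is infinitely differentiable. (Every G-invariant valuation is smooth: Val^G ⊆ Val^∞.) -/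

import Mathlib

open MeasureTheory Pointwise
open scoped NNReal ENNReal

noncomputable section

/-- Euclidean `n`-space `ℝⁿ`. -/
abbrev Eucl (n : ℕ) : Type := EuclideanSpace ℝ (Fin n)

section Generic

variable {V : Type*} [NormedAddCommGroup V] [NormedSpace ℝ V]

/-- `μ` is a valuation: whenever the union of two convex bodies `K`, `L` is again a convex
body `M` (with intersection the convex body `I`), one has `μ M + μ I = μ K + μ L`. -/
def IsValuation (μ : ConvexBody V → ℝ) : Prop :=
  ∀ K L M I : ConvexBody V,
    (M : Set V) = (K : Set V) ∪ (L : Set V) → (I : Set V) = (K : Set V) ∩ (L : Set V) →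
      μ M + μ I = μ K + μ L

/-- The translate `K + x` of a convex body. -/
def ConvexBody.translate (K : ConvexBody V) (x : V) : ConvexBody V :=
  ⟨(K : Set V) + {x}, K.convex.add (convex_singleton x),
    K.isCompact.add isCompact_singleton, K.nonempty.add (Set.singleton_nonempty x)⟩

/-- Translation invariance of a valuation. -/
def TransInv (μ : ConvexBody V → ℝ) : Prop :=
  ∀ (K : ConvexBody V) (x : V), μ (K.translate x) = μ K

/-- The dilate `t • K` of a convex body. -/
def ConvexBody.dilate (t : ℝ) (K : ConvexBody V) : ConvexBody V :=
  ⟨t • (K : Set V), K.convex.smul t, K.isCompact.smul t, K.nonempty.smul_set⟩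

/-- Homogeneity of degree `k` of a valuation: `μ (t • K) = t ^ k * μ K` for `t > 0`. -/
def Homog (k : ℕ) (μ : ConvexBody V → ℝ) : Prop :=
  ∀ (K : ConvexBody V) (t : ℝ), 0 < t → μ (ConvexBody.dilate t K) = t ^ k * μ K

/-- The reflection `-K` of a convex body. -/
def ConvexBody.reflect (K : ConvexBody V) : ConvexBody V :=
  ⟨-(K : Set V), K.convex.neg, K.isCompact.neg, K.nonempty.neg⟩

/-- Even valuations: `μ (-K) = μ K`. -/
def EvenVal (μ : ConvexBody V → ℝ) : Prop := ∀ K : ConvexBody V, μ K.reflect = μ K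

/-- Odd valuations: `μ (-K) = -μ K`. -/
def OddVal (μ : ConvexBody V → ℝ) : Prop := ∀ K : ConvexBody V, μ K.reflect = -μ K

end Generic

/-- The image of a convex body under the linear map of `ℝⁿ` given by a real `n × n` matrix. -/
def matBody {n : ℕ} (A : Matrix (Fin n) (Fin n) ℝ) (K : ConvexBody (Eucl n)) :
    ConvexBody (Eucl n) :=
  ⟨Matrix.toEuclideanLin A '' (K : Set (Eucl n)),
    K.convex.linear_image (Matrix.toEuclideanLin A),
    K.isCompact.image (Matrix.toEuclideanLin A).continuous_of_finiteDimensional,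
    K.nonempty.image _⟩

/-- `G` is a closed subgroup of the orthogonal group `O(n)` (a set of orthogonal matrices
containing the identity, closed under multiplication and inverse, and topologically
closed). -/
def IsClosedSubgroupO {n : ℕ} (G : Set (Matrix (Fin n) (Fin n) ℝ)) : Prop :=
  (∀ A ∈ G, A ∈ Matrix.orthogonalGroup (Fin n) ℝ) ∧ (1 : Matrix (Fin n) (Fin n) ℝ) ∈ G ∧
    (∀ A ∈ G, ∀ B ∈ G, A * B ∈ G) ∧ (∀ A ∈ G, A⁻¹ ∈ G) ∧ IsClosed G

/-- `G` acts transitively on the unit sphere of `ℝⁿ`. -/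
def ActsTransitively {n : ℕ} (G : Set (Matrix (Fin n) (Fin n) ℝ)) : Prop :=
  ∀ u v : Eucl n, ‖u‖ = 1 → ‖v‖ = 1 → ∃ A ∈ G, Matrix.toEuclideanLin A u = v

/-- Invariance of a valuation under the subgroup `G`. -/
def GInv {n : ℕ} (G : Set (Matrix (Fin n) (Fin n) ℝ)) (μ : ConvexBody (Eucl n) → ℝ) : Prop :=
  ∀ A ∈ G, ∀ K : ConvexBody (Eucl n), μ (matBody A K) = μ K

/-- The space of real `n × n` matrices, as a normed function space. -/
abbrev MatN (n : ℕ) : Type := Fin n → Fin n → ℝ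

/-- The convex bodies contained in the closed unit ball of `ℝⁿ`, with the Hausdorff
metric. -/
abbrev UnitBodies (n : ℕ) : Type :=
  {K : ConvexBody (Eucl n) // (K : Set (Eucl n)) ⊆ Metric.closedBall (0 : Eucl n) 1}

section PolynomialFunctions

open Polynomial Filter Topology

/-- The `i`-th Lagrange basis polynomial for the nodes `0, 1, …, d`. -/
def lagr (d i : ℕ) : ℝ[X] := Lagrange.basis (Finset.range (d + 1)) (fun j : ℕ => (j : ℝ)) i

lemma cast_injOn (s : Set ℕ) : Set.InjOn (fun j : ℕ => (j : ℝ)) s :=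
  fun _ _ _ _ h => Nat.cast_injective h

lemma natDegree_lagr_le {d i : ℕ} (hi : i ∈ Finset.range (d + 1)) : (lagr d i).natDegree ≤ d := by
  rw [lagr, Lagrange.natDegree_basis (cast_injOn _) hi]; simp

lemma eval_eq_sum_lagr {d : ℕ} {p : ℝ[X]} (hp : p.natDegree ≤ d) (t : ℝ) :
    p.eval t = ∑ i ∈ Finset.range (d + 1), p.eval (i : ℝ) * (lagr d i).eval t := by
  have hdeg : p.degree < (Finset.range (d + 1)).card := by
    rw [Finset.card_range]
    exact lt_of_le_of_lt degree_le_natDegree (by exact_mod_cast Nat.lt_succ_of_le hp)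
  have h := Lagrange.eq_interpolate (cast_injOn _) hdeg
  conv_lhs => rw [h]
  simp [Lagrange.interpolate_apply, eval_finsetSum, lagr]

/-- `f` agrees on `s` with a real polynomial of degree at most `d`. -/
def PolyOn (d : ℕ) (f : ℝ → ℝ) (s : Set ℝ) : Prop :=
  ∃ p : ℝ[X], p.natDegree ≤ d ∧ ∀ t ∈ s, f t = p.eval t

namespace PolyOn

variable {d : ℕ} {f g : ℝ → ℝ} {s : Set ℝ}

lemma congr (hf : PolyOn d f s) (h : ∀ t ∈ s, g t = f t) : PolyOn d g s := by
  obtain ⟨p, hp, hpf⟩ := hf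
  exact ⟨p, hp, fun t ht => (h t ht).trans (hpf t ht)⟩

lemma const (d : ℕ) (c : ℝ) (s : Set ℝ) : PolyOn d (fun _ => c) s := ⟨C c, by simp, by simp⟩

lemma add (hf : PolyOn d f s) (hg : PolyOn d g s) : PolyOn d (fun t => f t + g t) s := by
  obtain ⟨p, hp, hpf⟩ := hf
  obtain ⟨q, hq, hqg⟩ := hg
  exact ⟨p + q, natDegree_add_le_of_degree_le hp hq, fun t ht => by simp [hpf t ht, hqg t ht]⟩

lemma sub (hf : PolyOn d f s) (hg : PolyOn d g s) : PolyOn d (fun t => f t - g t) s := by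
  obtain ⟨p, hp, hpf⟩ := hf
  obtain ⟨q, hq, hqg⟩ := hg
  exact ⟨p - q, (natDegree_sub_le_of_le hp hq).trans (by simp), fun t ht => by simp [hpf t ht, hqg t ht]⟩

lemma const_mul (c : ℝ) (hf : PolyOn d f s) : PolyOn d (fun t => c * f t) s := by
  obtain ⟨p, hp, hpf⟩ := hf
  exact ⟨C c * p, (natDegree_C_mul_le _ _).trans hp, fun t ht => by simp [hpf t ht]⟩

lemma sum {ι : Type*} (I : Finset ι) {F : ι → ℝ → ℝ} (h : ∀ i ∈ I, PolyOn d (F i) s) :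
    PolyOn d (fun t => ∑ i ∈ I, F i t) s := by
  classical
  induction I using Finset.induction_on with
  | empty => simpa using const d 0 s
  | insert a I ha ih =>
    simp only [Finset.sum_insert ha]
    exact (h a (by simp)).add (ih fun i hi => h i (by simp [hi]))

lemma mul {e : ℕ} (hf : PolyOn d f s) (hg : PolyOn e g s) : PolyOn (d + e) (fun t => f t * g t) s := by
  obtain ⟨p, hp, hpf⟩ := hf
  obtain ⟨q, hq, hqg⟩ := hg
  exact ⟨p * q, natDegree_mul_le_of_le hp hq, fun t ht => by simp [hpf t ht, hqg t ht]⟩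

lemma comp_affine {u : Set ℝ} (hf : PolyOn d f s) (a b : ℝ) (h : ∀ t ∈ u, a * t + b ∈ s) :
    PolyOn d (fun t => f (a * t + b)) u := by
  obtain ⟨p, hp, hpf⟩ := hf
  refine ⟨p.comp (C a * X + C b), ?_, fun t ht => by simp [hpf _ (h t ht)]⟩
  refine natDegree_comp_le.trans ?_
  calc p.natDegree * (C a * X + C b).natDegree ≤ p.natDegree * 1 :=
        Nat.mul_le_mul_left _ natDegree_linear_le
    _ ≤ d := by simpa using hp

lemma lagr {d i : ℕ} (hi : i ∈ Finset.range (d + 1)) (s : Set ℝ) :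
    PolyOn d (fun t => (lagr d i).eval t) s :=
  ⟨_, natDegree_lagr_le hi, fun _ _ => rfl⟩

lemma eq_sum_lagr (hf : PolyOn d f s) (hs : ∀ i ∈ Finset.range (d + 1), (i : ℝ) ∈ s) {t : ℝ}
    (ht : t ∈ s) :
    f t = ∑ i ∈ Finset.range (d + 1), f i * (_root_.lagr d i).eval t := by
  obtain ⟨p, hp, hpf⟩ := hf
  rw [hpf t ht, eval_eq_sum_lagr hp]
  exact Finset.sum_congr rfl fun i hi => by rw [hpf _ (hs i hi)]

lemma of_eq_sum_lagr
    (h : ∀ t ∈ s, f t = ∑ i ∈ Finset.range (d + 1), f i * (_root_.lagr d i).eval t) :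
    PolyOn d f s :=
  (sum _ fun _ hi => (lagr hi s).const_mul _).congr h

lemma of_tendsto {F : ℕ → ℝ → ℝ} (hF : ∀ j, PolyOn d (F j) (Set.Ici 0))
    (h : ∀ t ∈ Set.Ici (0 : ℝ), Tendsto (fun j => F j t) atTop (𝓝 (f t))) :
    PolyOn d f (Set.Ici 0) := by
  have hn : ∀ i ∈ Finset.range (d + 1), (i : ℝ) ∈ Set.Ici (0 : ℝ) := fun i _ => by simp
  refine of_eq_sum_lagr fun t ht => tendsto_nhds_unique (h t ht) ?_
  simp_rw [fun j => (hF j).eq_sum_lagr hn ht]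
  exact tendsto_finsetSum _ fun i hi => (h _ (hn i hi)).mul_const _

end PolyOn

lemma natDegree_le_of_growth {p : ℝ[X]} {d : ℕ} {c : ℝ}
    (h : ∀ t : ℝ, 0 ≤ t → |p.eval t| ≤ c * (1 + t) ^ d) : p.natDegree ≤ d := by
  by_contra! hlt
  set q : ℝ[X] := C c * (1 + X) ^ d
  have hq : q.natDegree ≤ d := by
    refine (natDegree_C_mul_le _ _).trans (natDegree_pow_le.trans ?_)
    have : (1 + X : ℝ[X]).natDegree ≤ 1 := by
      rw [add_comm]; exact (natDegree_X_add_C (1 : ℝ)).le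
    nlinarith
  have ho := isLittleO_atTop_of_degree_lt (P := q) (Q := p)
    (degree_lt_degree (hq.trans_lt hlt))
  have hne : p ≠ 0 := by rintro rfl; simp at hlt
  have h1 := ho.def (c := 1 / 2) (by norm_num)
  obtain ⟨t, ht1, ht2, ht3⟩ := (h1.and ((eventually_atTop_not_isRoot p hne).and
    (eventually_ge_atTop 0))).exists
  have h2 := h t ht3
  have h3 : q.eval t = c * (1 + t) ^ d := by simp [q]
  rw [h3, Real.norm_eq_abs, Real.norm_eq_abs] at ht1
  have h4 : 0 < |p.eval t| := abs_pos.2 ht2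
  linarith [le_abs_self (c * (1 + t) ^ d)]

lemma exists_antiderivative (p : ℝ[X]) : ∃ q : ℝ[X], derivative q = p := by
  induction p using Polynomial.induction_on' with
  | add p q hp hq =>
    obtain ⟨p', rfl⟩ := hp
    obtain ⟨q', rfl⟩ := hq
    exact ⟨p' + q', by simp⟩
  | monomial n a =>
    refine ⟨monomial (n + 1) (a / (n + 1)), ?_⟩
    rw [derivative_monomial]
    have : (n : ℝ) + 1 ≠ 0 := by positivity
    simp; field_simp

/-- A continuous function all of whose differences are polynomials of bounded degree is a
polynomial. -/
lemma exists_polynomial_of_sub {f : ℝ → ℝ} (hf : Continuous f) {d : ℕ}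
    (h : ∀ t, 0 ≤ t → PolyOn d (fun s => f (s + t) - f s) (Set.Ici 0)) :
    ∃ p : ℝ[X], ∀ s, 0 ≤ s → f s = p.eval s := by
  obtain ⟨r, -, hr⟩ := h 1 zero_le_one
  obtain ⟨r', hr'⟩ := exists_antiderivative r
  set c : ℕ → ℝ := fun i => ∫ t in (0 : ℝ)..1, (f (i + t) - f i)
  set A : ℝ → ℝ := fun s => ∫ t in s..(s + 1), f t
  have hint : ∀ a b, IntervalIntegrable f volume a b := fun a b => hf.intervalIntegrable a b
  have hA : ∀ s, HasDerivAt A (f (s + 1) - f s) s := by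
    intro s
    have h0 : ∀ s, A s = (∫ t in (0 : ℝ)..(s + 1), f t) - ∫ t in (0 : ℝ)..s, f t := fun s => by
      rw [intervalIntegral.integral_interval_sub_left (hint _ _) (hint _ _)]
    rw [funext h0]
    have h1 : ∀ s, HasDerivAt (fun s => ∫ t in (0 : ℝ)..s, f t) (f s) s := fun s =>
      intervalIntegral.integral_hasDerivAt_right (hint _ _)
        (hf.stronglyMeasurableAtFilter _ _) hf.continuousAt
    exact ((h1 (s + 1)).comp_add_const s 1).sub (h1 s)
  have hAr : ∀ s, 0 ≤ s → A s = r'.eval s + (A 0 - r'.eval 0) := by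
    intro s hs
    have hd : ∀ x ∈ Set.Icc 0 s, HasDerivAt (fun x => A x - r'.eval x) 0 x := by
      intro x hx
      have := (hA x).sub (r'.hasDerivAt x)
      have e : f (x + 1) - f x = r.eval x := hr x hx.1
      rw [hr', e, sub_self] at this
      exact this
    have := constant_of_has_deriv_right_zero
      (fun x hx => (hd x hx).continuousAt.continuousWithinAt)
      (fun x hx => (hd x ⟨hx.1, hx.2.le⟩).hasDerivWithinAt) s ⟨hs, le_rfl⟩
    linarith
  have hmain : ∀ s, 0 ≤ s →
      A s - f s = ∑ i ∈ Finset.range (d + 1), c i * (lagr d i).eval s := by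
    intro s hs
    have h1 : A s - f s = ∫ t in (0 : ℝ)..1, (f (s + t) - f s) := by
      rw [intervalIntegral.integral_sub (f := fun t => f (s + t))
        (Continuous.intervalIntegrable (by fun_prop) _ _) (by simp),
        intervalIntegral.integral_comp_add_left (fun t => f t) s]
      simp [A]
    have h2 : ∫ t in (0 : ℝ)..1, (f (s + t) - f s) = ∫ t in (0 : ℝ)..1,
        ∑ i ∈ Finset.range (d + 1), (f (i + t) - f i) * (lagr d i).eval s := by
      refine intervalIntegral.integral_congr fun t ht => ?_
      rw [Set.uIcc_of_le zero_le_one] at ht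
      exact (h t ht.1).eq_sum_lagr (fun i _ => by simp) hs
    rw [h1, h2, intervalIntegral.integral_finsetSum]
    · simp only [intervalIntegral.integral_mul_const, c]
    · intro i _
      exact Continuous.intervalIntegrable (by fun_prop) _ _
  refine ⟨r' + C (A 0 - r'.eval 0) - ∑ i ∈ Finset.range (d + 1), C (c i) * lagr d i, fun s hs => ?_⟩
  have h1 := hmain s hs
  rw [hAr s hs] at h1
  simp only [eval_sub, eval_add, eval_C, eval_finsetSum, eval_mul]
  linarith

end PolynomialFunctions

section SupportFunctions

open Filter Topology
open scoped RealInnerProductSpace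

variable {E : Type*} [NormedAddCommGroup E] [InnerProductSpace ℝ E]

/-- The Wulff shape of a function on the unit sphere. -/
def wulff (φ : E → ℝ) : Set E := {x | ∀ u : E, ‖u‖ = 1 → ⟪x, u⟫ ≤ φ u}

/-- `φ` restricted to the unit sphere is the support function of its Wulff shape. -/
def Supp (φ : E → ℝ) : Prop := ∀ u : E, ‖u‖ = 1 → ∃ v ∈ wulff φ, ⟪v, u⟫ = φ u

lemma wulff_congr {φ ψ : E → ℝ} (h : ∀ u : E, ‖u‖ = 1 → φ u = ψ u) : wulff φ = wulff ψ := by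
  ext x
  exact forall_congr' fun u => forall_congr' fun hu => by rw [h u hu]

lemma wulff_mono {φ ψ : E → ℝ} (h : ∀ u : E, ‖u‖ = 1 → φ u ≤ ψ u) : wulff φ ⊆ wulff ψ :=
  fun _ hx u hu => (hx u hu).trans (h u hu)

lemma convex_wulff (φ : E → ℝ) : Convex ℝ (wulff φ) := by
  intro x hx y hy a b ha hb hab u hu
  rw [inner_add_left, inner_smul_left, inner_smul_left]
  simp only [conj_trivial]
  have h1 := mul_le_mul_of_nonneg_left (hx u hu) ha
  have h2 := mul_le_mul_of_nonneg_left (hy u hu) hb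
  calc _ ≤ a * φ u + b * φ u := add_le_add h1 h2
    _ = φ u := by rw [← add_mul, hab, one_mul]

lemma isClosed_wulff (φ : E → ℝ) : IsClosed (wulff φ) := by
  have : wulff φ = ⋂ u : E, ⋂ _ : ‖u‖ = 1, {x | ⟪x, u⟫ ≤ φ u} := by
    ext x; simp [wulff]
  rw [this]
  exact isClosed_iInter fun u => isClosed_iInter fun _ =>
    isClosed_le (by fun_prop) continuous_const

lemma norm_le_of_mem_wulff {φ : E → ℝ} {R : ℝ} (hR : 0 ≤ R) (h : ∀ u : E, ‖u‖ = 1 → φ u ≤ R)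
    {x : E} (hx : x ∈ wulff φ) : ‖x‖ ≤ R := by
  rcases eq_or_ne x 0 with rfl | hx0
  · simpa using hR
  have hn : ‖x‖ ≠ 0 := norm_ne_zero_iff.2 hx0
  have hu : ‖(‖x‖⁻¹ • x : E)‖ = 1 := norm_smul_inv_norm hx0
  have h1 := (hx _ hu).trans (h _ hu)
  rw [inner_smul_right, real_inner_self_eq_norm_sq] at h1
  field_simp at h1
  exact h1

lemma exists_bound_wulff [FiniteDimensional ℝ E] (φ : E → ℝ) : ∃ R, 0 ≤ R ∧ ∀ x ∈ wulff φ, ‖x‖ ≤ R := by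
  set b := stdOrthonormalBasis ℝ E
  refine ⟨∑ i, max 0 (max (φ (b i)) (φ (-b i))), Finset.sum_nonneg fun i _ => le_max_left _ _,
    fun x hx => ?_⟩
  calc ‖x‖ = ‖∑ i, ⟪b i, x⟫ • b i‖ := by rw [b.sum_repr']
    _ ≤ ∑ i, ‖⟪b i, x⟫ • b i‖ := norm_sum_le _ _
    _ ≤ _ := Finset.sum_le_sum fun i _ => by
      rw [norm_smul, b.norm_eq_one, mul_one, Real.norm_eq_abs, real_inner_comm]
      have h1 := hx (b i) (b.norm_eq_one i)
      have h2 := hx (-b i) (by rw [norm_neg, b.norm_eq_one i])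
      rw [inner_neg_right] at h2
      refine le_max_of_le_right (abs_le'.2 ⟨le_max_of_le_left h1, le_max_of_le_right h2⟩)

lemma isCompact_wulff [FiniteDimensional ℝ E] (φ : E → ℝ) : IsCompact (wulff φ) := by
  obtain ⟨R, -, hR⟩ := exists_bound_wulff φ
  exact (isCompact_closedBall (0 : E) R).of_isClosed_subset (isClosed_wulff φ)
    fun x hx => by simpa using hR x hx

namespace Supp

variable {φ ψ : E → ℝ}

lemma congr (hφ : Supp φ) (h : ∀ u : E, ‖u‖ = 1 → ψ u = φ u) : Supp ψ := by
  intro u hu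
  rw [wulff_congr h, h u hu]
  exact hφ u hu

lemma add (hφ : Supp φ) (hψ : Supp ψ) : Supp (fun u => φ u + ψ u) := by
  intro u hu
  obtain ⟨v, hv, h1⟩ := hφ u hu
  obtain ⟨w, hw, h2⟩ := hψ u hu
  refine ⟨v + w, fun x hx => ?_, by rw [inner_add_left, h1, h2]⟩
  rw [inner_add_left]
  exact add_le_add (hv x hx) (hw x hx)

lemma const_mul (hφ : Supp φ) {c : ℝ} (hc : 0 ≤ c) : Supp (fun u => c * φ u) := by
  intro u hu
  obtain ⟨v, hv, h1⟩ := hφ u hu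
  refine ⟨c • v, fun x hx => ?_, by simp [inner_smul_left, h1]⟩
  simpa [inner_smul_left] using mul_le_mul_of_nonneg_left (hv x hx) hc

lemma max (hφ : Supp φ) (hψ : Supp ψ) : Supp (fun u => max (φ u) (ψ u)) := by
  intro u hu
  rcases le_total (φ u) (ψ u) with h | h
  · obtain ⟨v, hv, h1⟩ := hψ u hu
    exact ⟨v, wulff_mono (fun _ _ => le_max_right _ _) hv, h1.trans (max_eq_right h).symm⟩
  · obtain ⟨v, hv, h1⟩ := hφ u hu
    exact ⟨v, wulff_mono (fun _ _ => le_max_left _ _) hv, h1.trans (max_eq_left h).symm⟩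

lemma lin (a : E) : Supp (fun u => ⟪a, u⟫) := fun _ _ => ⟨a, fun _ _ => le_rfl, rfl⟩

lemma const {c : ℝ} (hc : 0 ≤ c) : Supp (fun _ : E => c) := by
  intro u hu
  refine ⟨c • u, fun x hx => ?_, by simp [inner_smul_left, hu]⟩
  rw [inner_smul_left]
  have := real_inner_le_norm u x
  rw [hu, hx] at this
  simpa using mul_le_mul_of_nonneg_left this hc

lemma add_const (hφ : Supp φ) {c : ℝ} (hc : 0 ≤ c) : Supp (fun u => φ u + c) :=
  hφ.add (const hc)

lemma nonempty [Nontrivial E] (hφ : Supp φ) : (wulff φ).Nonempty := by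
  obtain ⟨u, hu⟩ := exists_norm_eq E (zero_le_one (α := ℝ))
  obtain ⟨v, hv, -⟩ := hφ u hu
  exact ⟨v, hv⟩

variable [FiniteDimensional ℝ E] [Nontrivial E]

/-- The convex body with support function `φ`. -/
def body (hφ : Supp φ) : ConvexBody E :=
  ⟨wulff φ, convex_wulff φ, isCompact_wulff φ, hφ.nonempty⟩

@[simp] lemma coe_body (hφ : Supp φ) : (hφ.body : Set E) = wulff φ := rfl

end Supp

lemma exists_separating [FiniteDimensional ℝ E] {K : Set E} (hK : Convex ℝ K) (hc : IsClosed K)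
    (hne : K.Nonempty) {x : E} (hx : x ∉ K) :
    ∃ y ∈ K, ∃ u : E, ‖u‖ = 1 ∧ x - y = ‖x - y‖ • u ∧ ∀ z ∈ K, ⟪z, u⟫ ≤ ⟪y, u⟫ := by
  obtain ⟨y, hy, hmin⟩ := exists_norm_eq_iInf_of_complete_convex hne hc.isComplete hK x
  have h := (norm_eq_iInf_iff_real_inner_le_zero hK hy).1 hmin
  have hxy : x - y ≠ 0 := fun h0 => hx (by rwa [sub_eq_zero.1 h0])
  have hn : 0 < ‖x - y‖ := norm_pos_iff.2 hxy
  refine ⟨y, hy, ‖x - y‖⁻¹ • (x - y), norm_smul_inv_norm hxy, ?_, fun z hz => ?_⟩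
  · rw [smul_smul, mul_inv_cancel₀ hn.ne', one_smul]
  · have h1 := h z hz
    rw [inner_smul_right, inner_smul_right]
    refine mul_le_mul_of_nonneg_left ?_ (by positivity)
    rw [real_inner_comm, inner_sub_left] at h1
    linarith

/-- The support function of a set. -/
def suppFun (K : Set E) (u : E) : ℝ := sSup ((fun x => ⟪x, u⟫) '' K)

lemma inner_le_suppFun {K : Set E} (hK : IsCompact K) {x : E} (hx : x ∈ K) (u : E) :
    ⟪x, u⟫ ≤ suppFun K u :=
  le_csSup (hK.image (by fun_prop)).bddAbove ⟨x, hx, rfl⟩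

lemma exists_eq_suppFun {K : Set E} (hK : IsCompact K) (hne : K.Nonempty) (u : E) :
    ∃ x ∈ K, ⟪x, u⟫ = suppFun K u :=
  (hK.image (f := fun x => ⟪x, u⟫) (by fun_prop)).sSup_mem (hne.image _)

lemma suppFun_le {K : Set E} {u : E} {c : ℝ} (hne : K.Nonempty)
    (h : ∀ x ∈ K, ⟪x, u⟫ ≤ c) : suppFun K u ≤ c :=
  csSup_le (hne.image _) (by rintro _ ⟨x, hx, rfl⟩; exact h x hx)

lemma supp_suppFun {K : Set E} (hK : IsCompact K) (hne : K.Nonempty) : Supp (suppFun K) := by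
  intro u _
  obtain ⟨x, hx, h⟩ := exists_eq_suppFun hK hne u
  exact ⟨x, fun w _ => inner_le_suppFun hK hx w, h⟩

lemma wulff_suppFun [FiniteDimensional ℝ E] {K : Set E} (hc : Convex ℝ K) (hK : IsCompact K)
    (hne : K.Nonempty) : wulff (suppFun K) = K := by
  refine subset_antisymm (fun x hx => ?_) fun x hx u _ => inner_le_suppFun hK hx u
  by_contra hxK
  obtain ⟨y, hy, u, hu, hxy, h⟩ := exists_separating hc hK.isClosed hne hxK
  have h1 := (hx u hu).trans (suppFun_le hne h)
  have h2 : ⟪x - y, u⟫ = ‖x - y‖ := by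
    conv_lhs => rw [hxy, inner_smul_left, real_inner_self_eq_norm_sq, hu]
    simp
  rw [inner_sub_left] at h2
  have h3 : ‖x - y‖ = 0 := le_antisymm (by linarith) (norm_nonneg _)
  exact hxK (by rwa [sub_eq_zero.1 (norm_eq_zero.1 h3)])

lemma Supp.subadditive {φ : E → ℝ} (hφ : Supp φ) (x y : E) :
    ‖x + y‖ * φ (‖x + y‖⁻¹ • (x + y)) ≤
      ‖x‖ * φ (‖x‖⁻¹ • x) + ‖y‖ * φ (‖y‖⁻¹ • y) := by
  have key : ∀ v ∈ wulff φ, ∀ x : E, ⟪v, x⟫ ≤ ‖x‖ * φ (‖x‖⁻¹ • x) := by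
    intro v hv x
    rcases eq_or_ne x 0 with rfl | hx
    · simp
    have hn : 0 < ‖x‖ := norm_pos_iff.2 hx
    have h1 := mul_le_mul_of_nonneg_left (hv _ (norm_smul_inv_norm (𝕜 := ℝ) hx)) hn.le
    simp only [RCLike.ofReal_real_eq_id, id_eq, inner_smul_right] at h1
    rwa [← mul_assoc, mul_inv_cancel₀ hn.ne', one_mul] at h1
  rcases eq_or_ne (x + y) 0 with h | h
  · rw [h, norm_zero, zero_mul]
    have hy : y = -x := (neg_eq_of_add_eq_zero_right h).symm
    rcases eq_or_ne x 0 with rfl | hx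
    · simp [hy]
    obtain ⟨v, hv, -⟩ := hφ _ (norm_smul_inv_norm (𝕜 := ℝ) hx)
    have h1 := key v hv x
    have h2 := key v hv y
    have h3 : ⟪v, x⟫ + ⟪v, y⟫ = 0 := by rw [← inner_add_right, h, inner_zero_right]
    linarith
  · have hn : 0 < ‖x + y‖ := norm_pos_iff.2 h
    obtain ⟨v, hv, h1⟩ := hφ _ (norm_smul_inv_norm (𝕜 := ℝ) h)
    simp only [RCLike.ofReal_real_eq_id, id_eq] at h1
    rw [← h1, inner_smul_right, ← mul_assoc, mul_inv_cancel₀ hn.ne', one_mul, inner_add_right]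
    exact add_le_add (key v hv x) (key v hv y)

lemma Supp.of_subadditive [FiniteDimensional ℝ E] {φ : E → ℝ}
    (h : ∀ x y : E, ‖x + y‖ * φ (‖x + y‖⁻¹ • (x + y)) ≤
      ‖x‖ * φ (‖x‖⁻¹ • x) + ‖y‖ * φ (‖y‖⁻¹ • y)) : Supp φ := by
  intro u hu
  have hu0 : u ≠ 0 := by rintro rfl; simp at hu
  set N : E → ℝ := fun x => ‖x‖ * φ (‖x‖⁻¹ • x)
  have hN1 : ∀ w : E, ‖w‖ = 1 → N w = φ w := fun w hw => by simp [N, hw]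
  have hhom : ∀ c : ℝ, 0 < c → ∀ x, N (c • x) = c * N x := by
    intro c hc x
    simp only [N, norm_smul, Real.norm_eq_abs, abs_of_pos hc, smul_smul]
    rw [mul_inv, mul_assoc c, mul_assoc c⁻¹, mul_comm _ c, ← mul_assoc c⁻¹,
      inv_mul_cancel₀ hc.ne', one_mul]
  set f : E →ₗ.[ℝ] ℝ := LinearPMap.mkSpanSingleton u (φ u) hu0
  obtain ⟨g, hg1, hg2⟩ := exists_extension_of_le_sublinear f N hhom h (by
    rintro ⟨x, hx⟩
    obtain ⟨c, rfl⟩ := Submodule.mem_span_singleton.1 hx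
    have : f ⟨c • u, hx⟩ = c * φ u := by
      exact LinearPMap.mkSpanSingleton'_apply u (φ u) _ c hx
    rw [this]
    rcases lt_trichotomy c 0 with hc | rfl | hc
    · have h1 := h (c • u) ((-c) • u)
      have h2 := hhom (-c) (by linarith) u
      rw [hN1 u hu] at h2
      simp only [N] at h2 ⊢
      rw [h2] at h1
      simp at h1
      linarith
    · simp [N]
    · rw [hhom c hc, hN1 u hu])
  set v := (InnerProductSpace.toDual ℝ E).symm g.toContinuousLinearMap
  have hv : ∀ x, ⟪v, x⟫ = g x := fun x => by simp [v]
  refine ⟨v, fun w hw => ?_, ?_⟩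
  · rw [hv, ← hN1 w hw]; exact hg2 w
  · rw [hv]
    have hmem : u ∈ f.domain := Submodule.mem_span_singleton_self u
    have := hg1 ⟨u, hmem⟩
    rw [show g u = f ⟨u, hmem⟩ from this]
    exact LinearPMap.mkSpanSingleton_apply ℝ ℝ hu0 (φ u)

variable [FiniteDimensional ℝ E] [Nontrivial E]

lemma infDist_le_of_supp {φ ψ : E → ℝ} (hψ : Supp ψ) {δ : ℝ} (hδ : 0 ≤ δ)
    (h : ∀ u : E, ‖u‖ = 1 → φ u ≤ ψ u + δ) {x : E} (hx : x ∈ wulff φ) :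
    ∃ y ∈ wulff ψ, dist x y ≤ δ := by
  by_cases hxK : x ∈ wulff ψ
  · exact ⟨x, hxK, by simpa using hδ⟩
  obtain ⟨y, hy, u, hu, hxy, hz⟩ :=
    exists_separating (convex_wulff ψ) (isClosed_wulff ψ) hψ.nonempty hxK
  refine ⟨y, hy, ?_⟩
  have h2 : ⟪x - y, u⟫ = ‖x - y‖ := by
    conv_lhs => rw [hxy, inner_smul_left, real_inner_self_eq_norm_sq, hu]
    simp
  obtain ⟨v, hv, h3⟩ := hψ u hu
  rw [inner_sub_left] at h2
  rw [dist_eq_norm]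
  linarith [hx u hu, h u hu, hz v hv]

lemma dist_body_le {φ ψ : E → ℝ} (hφ : Supp φ) (hψ : Supp ψ) {δ : ℝ} (hδ : 0 ≤ δ)
    (h : ∀ u : E, ‖u‖ = 1 → |φ u - ψ u| ≤ δ) : dist hφ.body hψ.body ≤ δ := by
  refine Metric.hausdorffDist_le_of_mem_dist hδ
    (fun x hx => infDist_le_of_supp hψ hδ (fun u hu => ?_) hx)
    (fun x hx => infDist_le_of_supp hφ hδ (fun u hu => ?_) hx)
  · linarith [(abs_le.1 (h u hu)).2]
  · linarith [(abs_le.1 (h u hu)).1]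

end SupportFunctions

section SupportFunctional

open Filter Topology
open scoped RealInnerProductSpace

variable {E : Type*} [NormedAddCommGroup E] [InnerProductSpace ℝ E]

/-- The one-homogeneous extension of a function on the unit sphere. -/
def homExt (φ : E → ℝ) (x : E) : ℝ := ‖x‖ * φ (‖x‖⁻¹ • x)

lemma homExt_of_norm_eq_one (φ : E → ℝ) {u : E} (hu : ‖u‖ = 1) : homExt φ u = φ u := by
  simp [homExt, hu]

lemma homExt_smul (φ : E → ℝ) {c : ℝ} (hc : 0 ≤ c) (x : E) :
    homExt φ (c • x) = c * homExt φ x := by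
  rcases hc.eq_or_lt with rfl | hc
  · simp [homExt]
  simp only [homExt, norm_smul, Real.norm_eq_abs, abs_of_pos hc, smul_smul]
  rw [mul_inv, mul_assoc c, mul_assoc c⁻¹, mul_comm _ c, ← mul_assoc c⁻¹,
    inv_mul_cancel₀ hc.ne', one_mul]

lemma homExt_max (φ ψ : E → ℝ) (x : E) :
    homExt (fun u => max (φ u) (ψ u)) x = max (homExt φ x) (homExt ψ x) :=
  mul_max_of_nonneg _ _ (norm_nonneg x)

lemma homExt_min (φ ψ : E → ℝ) (x : E) :
    homExt (fun u => min (φ u) (ψ u)) x = min (homExt φ x) (homExt ψ x) :=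
  mul_min_of_nonneg _ _ (norm_nonneg x)

lemma inner_le_homExt {φ : E → ℝ} {v : E} (hv : v ∈ wulff φ) (x : E) : ⟪v, x⟫ ≤ homExt φ x := by
  rcases eq_or_ne x 0 with rfl | hx
  · simp [homExt]
  have hn : 0 < ‖x‖ := norm_pos_iff.2 hx
  have h1 := mul_le_mul_of_nonneg_left (hv _ (norm_smul_inv_norm (𝕜 := ℝ) hx)) hn.le
  simp only [RCLike.ofReal_real_eq_id, id_eq, inner_smul_right] at h1
  rwa [← mul_assoc, mul_inv_cancel₀ hn.ne', one_mul] at h1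

lemma Supp.homExt_add_le {φ : E → ℝ} (hφ : Supp φ) (x y : E) :
    homExt φ (x + y) ≤ homExt φ x + homExt φ y := hφ.subadditive x y

lemma Supp.continuous_homExt [FiniteDimensional ℝ E] {φ : E → ℝ} (hφ : Supp φ) :
    Continuous (homExt φ) := by
  obtain ⟨R, hR0, hR⟩ := exists_bound_wulff φ
  have hle : ∀ z : E, homExt φ z ≤ R * ‖z‖ := by
    intro z
    rcases eq_or_ne z 0 with rfl | hz
    · simp [homExt]
    have hu : ‖(‖z‖⁻¹ • z : E)‖ = 1 := norm_smul_inv_norm hz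
    obtain ⟨v, hv, h1⟩ := hφ _ hu
    have h2 := real_inner_le_norm v (‖z‖⁻¹ • z)
    rw [h1, hu, mul_one] at h2
    rw [homExt, mul_comm]
    exact mul_le_mul_of_nonneg_right (h2.trans (hR v hv)) (norm_nonneg z)
  refine (LipschitzWith.of_dist_le_mul (K := ⟨R, hR0⟩) fun x y => ?_).continuous
  have key : ∀ x y, homExt φ x - homExt φ y ≤ R * ‖x - y‖ := fun x y => by
    have := hφ.homExt_add_le (x - y) y
    rw [sub_add_cancel] at this
    linarith [hle (x - y)]
  rw [Real.dist_eq, dist_eq_norm]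
  refine abs_le'.2 ⟨key x y, ?_⟩
  rw [neg_sub, norm_sub_rev]
  exact key y x

lemma wulff_add_inner (φ : E → ℝ) (a : E) :
    wulff (fun u => φ u + ⟪a, u⟫) = wulff φ + {a} := by
  ext x
  simp only [Set.add_singleton, Set.image_add_right, Set.mem_preimage, wulff, Set.mem_ofPred_eq,
    inner_add_left, inner_neg_left]
  refine forall_congr' fun u => forall_congr' fun _ => ?_
  constructor <;> intro h <;> linarith

lemma wulff_min (φ ψ : E → ℝ) : wulff (fun u => min (φ u) (ψ u)) = wulff φ ∩ wulff ψ := by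
  ext x
  simp only [wulff, le_min_iff, Set.mem_ofPred_eq, Set.mem_inter_iff]
  exact ⟨fun h => ⟨fun u hu => (h u hu).1, fun u hu => (h u hu).2⟩,
    fun h u hu => ⟨h.1 u hu, h.2 u hu⟩⟩

lemma wulff_max [FiniteDimensional ℝ E] {φ ψ : E → ℝ} (hφ : Supp φ) (hψ : Supp ψ)
    (hm : Supp (fun u => min (φ u) (ψ u))) :
    wulff (fun u => max (φ u) (ψ u)) = wulff φ ∪ wulff ψ := by
  refine subset_antisymm (fun x hx => ?_) (Set.union_subset
    (wulff_mono fun _ _ => le_max_left _ _) (wulff_mono fun _ _ => le_max_right _ _))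
  by_contra hcon
  simp only [Set.mem_union, not_or, wulff, Set.mem_ofPred_eq, not_forall, not_le] at hcon
  obtain ⟨⟨u, hu, hxu⟩, ⟨v, hv, hxv⟩⟩ := hcon
  set y : ℝ → E := fun t => (1 - t) • u + t • v
  have hy : Continuous y := by fun_prop
  set A : Set ℝ := {t | homExt φ (y t) < ⟪x, y t⟫}
  set B : Set ℝ := {t | homExt ψ (y t) < ⟪x, y t⟫}
  have hA : IsOpen A := isOpen_lt (hφ.continuous_homExt.comp hy) (by fun_prop)
  have hB : IsOpen B := isOpen_lt (hψ.continuous_homExt.comp hy) (by fun_prop)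
  have hcov : Set.Icc (0 : ℝ) 1 ⊆ A ∪ B := by
    intro t ht
    have h1 := hm.homExt_add_le ((1 - t) • u) (t • v)
    rw [homExt_smul _ (by linarith [ht.2]), homExt_smul _ ht.1, homExt_of_norm_eq_one _ hu,
      homExt_of_norm_eq_one _ hv, homExt_min] at h1
    have h2 : min (homExt φ (y t)) (homExt ψ (y t)) < ⟪x, y t⟫ := by
      refine h1.trans_lt ?_
      simp only [y, inner_add_right, inner_smul_right]
      have e1 : min (φ u) (ψ u) < ⟪x, u⟫ := (min_le_left _ _).trans_lt hxu
      have e2 : min (φ v) (ψ v) < ⟪x, v⟫ := (min_le_right _ _).trans_lt hxv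
      rcases ht.1.eq_or_lt with h0 | h0
      · rw [← h0]; simpa using Or.inl hxu
      · nlinarith [ht.2]
    exact min_lt_iff.1 h2
  obtain ⟨t, -, htA, htB⟩ := isPreconnected_Icc A B hA hB hcov
    ⟨0, by simp, by simpa [A, y, homExt_of_norm_eq_one _ hu] using hxu⟩
    ⟨1, by simp, by simpa [B, y, homExt_of_norm_eq_one _ hv] using hxv⟩
  have h3 := inner_le_homExt hx (y t)
  rw [homExt_max] at h3
  exact absurd h3 (not_le.2 (max_lt htA htB))

variable [FiniteDimensional ℝ E] [Nontrivial E]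

open Classical in
/-- The value of a functional on convex bodies at the body with support function `φ`. -/
def onSupp (μ : ConvexBody E → ℝ) (φ : E → ℝ) : ℝ := if h : Supp φ then μ h.body else 0

lemma onSupp_of_supp (μ : ConvexBody E → ℝ) {φ : E → ℝ} (h : Supp φ) :
    onSupp μ φ = μ h.body := dif_pos h

lemma onSupp_eq (μ : ConvexBody E → ℝ) {φ : E → ℝ} (h : Supp φ) {K : ConvexBody E}
    (hK : (K : Set E) = wulff φ) : onSupp μ φ = μ K := by
  rw [onSupp_of_supp μ h]
  congr 1
  exact SetLike.coe_injective (by rw [hK]; rfl)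

lemma onSupp_congr (μ : ConvexBody E → ℝ) {φ ψ : E → ℝ} (h : ∀ u : E, ‖u‖ = 1 → φ u = ψ u) :
    onSupp μ φ = onSupp μ ψ := by
  by_cases hφ : Supp φ
  · rw [onSupp_of_supp μ hφ]
    exact (onSupp_eq μ (hφ.congr fun u hu => (h u hu).symm) (wulff_congr h)).symm
  · have hψ : ¬ Supp ψ := fun hψ => hφ (hψ.congr h)
    rw [onSupp, onSupp, dif_neg hφ, dif_neg hψ]

lemma onSupp_suppFun (μ : ConvexBody E → ℝ) (K : ConvexBody E) :
    onSupp μ (suppFun (K : Set E)) = μ K :=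
  onSupp_eq μ (supp_suppFun K.isCompact K.nonempty)
    (wulff_suppFun K.convex K.isCompact K.nonempty).symm

lemma onSupp_max_add_min {μ : ConvexBody E → ℝ} (hμ : IsValuation μ) {φ ψ : E → ℝ} (hφ : Supp φ)
    (hψ : Supp ψ) (hm : Supp (fun u => min (φ u) (ψ u))) :
    onSupp μ (fun u => max (φ u) (ψ u)) + onSupp μ (fun u => min (φ u) (ψ u)) =
      onSupp μ φ + onSupp μ ψ := by
  rw [onSupp_of_supp μ (hφ.max hψ), onSupp_of_supp μ hm, onSupp_of_supp μ hφ, onSupp_of_supp μ hψ]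
  exact hμ _ _ _ _ (wulff_max hφ hψ hm) (wulff_min φ ψ)

lemma onSupp_add_inner {μ : ConvexBody E → ℝ} (hμ : TransInv μ) {φ : E → ℝ} (hφ : Supp φ)
    (a : E) : onSupp μ (fun u => φ u + ⟪a, u⟫) = onSupp μ φ := by
  rw [onSupp_of_supp μ hφ, ← hμ hφ.body a]
  exact onSupp_eq μ (hφ.add (Supp.lin a)) (wulff_add_inner φ a).symm

lemma tendsto_onSupp {μ : ConvexBody E → ℝ} (hμ : Continuous μ) {ι : Type*} {l : Filter ι}
    {f : ι → E → ℝ} {φ : E → ℝ} (hf : ∀ i, Supp (f i)) (hφ : Supp φ) {δ : ι → ℝ}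
    (hδ : Tendsto δ l (𝓝 0)) (h0 : ∀ i, 0 ≤ δ i)
    (h : ∀ i, ∀ u : E, ‖u‖ = 1 → |f i u - φ u| ≤ δ i) :
    Tendsto (fun i => onSupp μ (f i)) l (𝓝 (onSupp μ φ)) := by
  simp_rw [fun i => onSupp_of_supp μ (hf i), onSupp_of_supp μ hφ]
  refine (hμ.tendsto _).comp (tendsto_iff_dist_tendsto_zero.2 ?_)
  exact squeeze_zero (fun _ => dist_nonneg) (fun i => dist_body_le (hf i) hφ (h0 i) (h i)) hδ

end SupportFunctional

section Compactness

open Filter Topology TopologicalSpace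

variable {E : Type*} [NormedAddCommGroup E] [NormedSpace ℝ E]

/-- A convex body as a nonempty compact set. -/
def ConvexBody.toNonemptyCompacts (K : ConvexBody E) : NonemptyCompacts E :=
  ⟨⟨K, K.isCompact⟩, K.nonempty⟩

lemma ConvexBody.isometry_toNonemptyCompacts :
    Isometry (ConvexBody.toNonemptyCompacts (E := E)) :=
  Isometry.of_dist_eq fun _ _ => rfl

lemma infDist_convex_le {L : Set E} (hL : Convex ℝ L) (hc : IsCompact L) (hne : L.Nonempty)
    (x y : E) {a b : ℝ} (ha : 0 ≤ a) (hb : 0 ≤ b) (hab : a + b = 1) :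
    Metric.infDist (a • x + b • y) L ≤ a * Metric.infDist x L + b * Metric.infDist y L := by
  obtain ⟨p, hp, hpx⟩ := hc.exists_infDist_eq_dist hne x
  obtain ⟨q, hq, hqy⟩ := hc.exists_infDist_eq_dist hne y
  rw [hpx, hqy]
  refine (Metric.infDist_le_dist_of_mem (hL hp hq ha hb hab)).trans ?_
  rw [dist_eq_norm, dist_eq_norm, dist_eq_norm]
  calc ‖a • x + b • y - (a • p + b • q)‖ = ‖a • (x - p) + b • (y - q)‖ := by
        congr 1; module
    _ ≤ ‖a • (x - p)‖ + ‖b • (y - q)‖ := norm_add_le _ _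
    _ = _ := by rw [norm_smul, norm_smul, Real.norm_of_nonneg ha, Real.norm_of_nonneg hb]

lemma isClosed_setOf_convex : IsClosed {L : NonemptyCompacts E | Convex ℝ (L : Set E)} := by
  have : {L : NonemptyCompacts E | Convex ℝ (L : Set E)} =
      ⋂ x : E, ⋂ y : E, ⋂ a : ℝ, ⋂ b : ℝ, ⋂ _ : 0 ≤ a ∧ 0 ≤ b ∧ a + b = 1,
        {L : NonemptyCompacts E | Metric.infDist (a • x + b • y) (L : Set E) ≤
          a * Metric.infDist x (L : Set E) + b * Metric.infDist y (L : Set E)} := by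
    ext L
    simp only [Set.mem_ofPred_eq, Set.mem_iInter]
    refine ⟨fun h x y a b hab =>
      infDist_convex_le h L.isCompact L.nonempty x y hab.1 hab.2.1 hab.2.2, fun h => ?_⟩
    intro x hx y hy a b ha hb hab
    have h1 := h x y a b ⟨ha, hb, hab⟩
    rw [Metric.infDist_zero_of_mem hx, Metric.infDist_zero_of_mem hy] at h1
    refine (L.isCompact.isClosed.mem_iff_infDist_zero L.nonempty).2
      (le_antisymm (by simpa using h1) Metric.infDist_nonneg)
  rw [this]
  have hc : ∀ x : E, Continuous fun L : NonemptyCompacts E => Metric.infDist x (L : Set E) :=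
    fun x => (Metric.lipschitz_infDist_set x).continuous
  exact isClosed_iInter fun x => isClosed_iInter fun y => isClosed_iInter fun a =>
    isClosed_iInter fun b => isClosed_iInter fun _ =>
      isClosed_le (hc _) ((continuous_const.mul (hc x)).add (continuous_const.mul (hc y)))

/-- Blaschke's selection theorem. -/
lemma isCompact_bodies {B : Set E} (hB : IsCompact B) :
    IsCompact {K : ConvexBody E | (K : Set E) ⊆ B} := by
  rw [ConvexBody.isometry_toNonemptyCompacts.isEmbedding.isInducing.isCompact_iff]
  have : ConvexBody.toNonemptyCompacts '' {K : ConvexBody E | (K : Set E) ⊆ B} =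
      {L : NonemptyCompacts E | (L : Set E) ⊆ B} ∩
        {L : NonemptyCompacts E | Convex ℝ (L : Set E)} := by
    ext L
    constructor
    · rintro ⟨K, hK, rfl⟩
      exact ⟨hK, K.convex⟩
    · rintro ⟨h1, h2⟩
      exact ⟨⟨L, h2, L.isCompact, L.nonempty⟩, h1, rfl⟩
  rw [this]
  exact (NonemptyCompacts.isCompact_subsets_of_isCompact hB).inter_right isClosed_setOf_convex

end Compactness

section Growth

open Filter Topology
open scoped RealInnerProductSpace

variable {E : Type*} [NormedAddCommGroup E] [InnerProductSpace ℝ E] [FiniteDimensional ℝ E]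

/-- `M` bounds the functional `μ` on the convex bodies contained in the unit ball. -/
def UnitBound (μ : ConvexBody E → ℝ) (M : ℝ) : Prop :=
  ∀ K : ConvexBody E, (K : Set E) ⊆ Metric.closedBall (0 : E) 1 → |μ K| ≤ M

lemma UnitBound.nonneg {μ : ConvexBody E → ℝ} {M : ℝ} (h : UnitBound μ M) : 0 ≤ M :=
  (abs_nonneg _).trans (h 0 (by simp))

lemma exists_unitBound {μ : ConvexBody E → ℝ} (hμ : Continuous μ) : ∃ M, UnitBound μ M := by
  obtain ⟨M, hM⟩ := (isCompact_bodies (isCompact_closedBall (0 : E) 1)).exists_bound_of_continuousOn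
    hμ.continuousOn
  exact ⟨M, fun K hK => hM K hK⟩

variable {ι : Type*} [Fintype ι] [DecidableEq ι]

/-- The widths of `K` in the directions of the orthonormal basis `b` are at most `a`. -/
def WidthLE (b : OrthonormalBasis ι ℝ E) (a : ι → ℝ) (K : ConvexBody E) : Prop :=
  ∀ x ∈ K, ∀ y ∈ K, ∀ i, ⟪b i, x⟫ - ⟪b i, y⟫ ≤ a i

lemma abs_le_of_widthLE_update {μ : ConvexBody E → ℝ} (hμ : IsValuation μ)
    (b : OrthonormalBasis ι ℝ E) {a : ι → ℝ} {M : ℝ} (h : ∀ K, WidthLE b a K → |μ K| ≤ M) (i : ι)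
    (K : ConvexBody E) (hK : WidthLE b (Function.update a i (2 * a i)) K) : |μ K| ≤ 3 * M := by
  set f : E → ℝ := fun x => ⟪b i, x⟫
  have hf : Continuous f := by fun_prop
  obtain ⟨p, hp, hpm⟩ := K.isCompact.exists_isMinOn K.nonempty hf.continuousOn
  obtain ⟨q, hq, hqm⟩ := K.isCompact.exists_isMaxOn K.nonempty hf.continuousOn
  set c := (f p + f q) / 2
  have hpq : f p ≤ f q := hpm hq
  have hr : (1 / 2 : ℝ) • p + (1 / 2 : ℝ) • q ∈ (K : Set E) :=
    K.convex hp hq (by norm_num) (by norm_num) (by norm_num)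
  have hfr : f ((1 / 2 : ℝ) • p + (1 / 2 : ℝ) • q) = c := by
    simp only [f, inner_add_right, inner_smul_right, c]; ring
  have hcv1 : Convex ℝ {x : E | f x ≤ c} :=
    convex_halfSpace_le (f := f) ((innerSL ℝ (b i)).toLinearMap.isLinear) c
  have hcv2 : Convex ℝ {x : E | c ≤ f x} :=
    convex_halfSpace_ge (f := f) ((innerSL ℝ (b i)).toLinearMap.isLinear) c
  have hcl1 : IsClosed {x : E | f x ≤ c} := isClosed_le hf continuous_const
  have hcl2 : IsClosed {x : E | c ≤ f x} := isClosed_le continuous_const hf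
  let K1 : ConvexBody E := ⟨K ∩ {x | f x ≤ c}, K.convex.inter hcv1, K.isCompact.inter_right hcl1,
    ⟨_, hr, hfr.le⟩⟩
  let K2 : ConvexBody E := ⟨K ∩ {x | c ≤ f x}, K.convex.inter hcv2, K.isCompact.inter_right hcl2,
    ⟨_, hr, hfr.ge⟩⟩
  let K3 : ConvexBody E := ⟨(K : Set E) ∩ {x | f x ≤ c} ∩ (K ∩ {x | c ≤ f x}),
    K1.convex.inter K2.convex, K1.isCompact.inter_right K2.isClosed, ⟨_, ⟨hr, hfr.le⟩, hr, hfr.ge⟩⟩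
  have hval := hμ K1 K2 K K3 (by
    change (K : Set E) = ((K : Set E) ∩ {x | f x ≤ c}) ∪ ((K : Set E) ∩ {x | c ≤ f x})
    rw [← Set.inter_union_distrib_left]
    refine (Set.inter_eq_left.2 fun x _ => ?_).symm
    exact le_total (f x) c) rfl
  have hwid : f q - f p ≤ 2 * a i := by
    simpa using hK q hq p hp i
  have hW : ∀ L : ConvexBody E, (L : Set E) ⊆ K →
      (∀ x ∈ L, ∀ y ∈ L, f x - f y ≤ a i) → WidthLE b a L := by
    intro L hLK hL x hx y hy j
    by_cases hj : j = i
    · subst hj; exact hL x hx y hy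
    · simpa [Function.update_of_ne hj] using hK x (hLK hx) y (hLK hy) j
  have h1 := h K1 (hW K1 Set.inter_subset_left fun x hx y hy => by
    have e1 : f x ≤ c := hx.2
    have e2 : f p ≤ f y := hpm hy.1
    simp only [c] at e1; linarith)
  have h2 := h K2 (hW K2 Set.inter_subset_left fun x hx y hy => by
    have e1 : c ≤ f y := hy.2
    have e2 : f x ≤ f q := hqm hx.1
    simp only [c] at e1; linarith)
  have h3 := h K3 (hW K3 (fun x hx => hx.1.1) fun x hx y hy => by
    have e1 : c ≤ f y := hy.2.2
    have e2 : f x ≤ f q := hqm hx.1.1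
    simp only [c] at e1; linarith)
  rw [abs_le] at *
  constructor <;> linarith

lemma abs_le_of_widthLE_mul_two {μ : ConvexBody E → ℝ} (hμ : IsValuation μ)
    (b : OrthonormalBasis ι ℝ E) {a : ι → ℝ} {M : ℝ} (h : ∀ K, WidthLE b a K → |μ K| ≤ M)
    (K : ConvexBody E) (hK : WidthLE b (fun i => 2 * a i) K) :
    |μ K| ≤ 3 ^ Fintype.card ι * M := by
  have key : ∀ s : Finset ι, ∀ K, WidthLE b (fun i => if i ∈ s then 2 * a i else a i) K →
      |μ K| ≤ 3 ^ s.card * M := by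
    intro s
    induction s using Finset.induction_on with
    | empty => simpa using h
    | insert i s hi ih =>
      intro K hK
      rw [Finset.card_insert_of_notMem hi, pow_succ', mul_assoc]
      refine abs_le_of_widthLE_update hμ b ih i K ?_
      convert hK using 1
      ext j
      by_cases hj : j = i
      · subst hj; simp [hi]
      · simp [hj]
  exact key Finset.univ K (by simpa using hK)

lemma abs_le_of_subset_closedBall {μ : ConvexBody E → ℝ} (hμ : IsValuation μ) (ht : TransInv μ)
    {M : ℝ} (hM : UnitBound μ M) (b : OrthonormalBasis ι ℝ E) {R : ℝ} (hR : 0 ≤ R)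
    (K : ConvexBody E) (hK : (K : Set E) ⊆ Metric.closedBall 0 R) :
    |μ K| ≤ (4 * (Fintype.card ι + 1) * (1 + R)) ^ (2 * Fintype.card ι) * M := by
  set N := Fintype.card ι
  have hN : (0 : ℝ) < N + 1 := by positivity
  have base : ∀ K : ConvexBody E, WidthLE b (fun _ => 1 / (N + 1 : ℝ)) K → |μ K| ≤ M := by
    intro K hK
    obtain ⟨x, hx⟩ := K.nonempty
    rw [← ht K (-x)]
    refine hM _ ?_
    rintro _ ⟨y, hy, _, rfl, rfl⟩
    rw [mem_closedBall_zero_iff]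
    change ‖y + -x‖ ≤ 1
    rw [← sub_eq_add_neg]
    calc ‖y - x‖ = ‖∑ i, ⟪b i, y - x⟫ • b i‖ := by rw [b.sum_repr']
      _ ≤ ∑ i, ‖⟪b i, y - x⟫ • b i‖ := norm_sum_le _ _
      _ ≤ ∑ i : ι, 1 / (N + 1 : ℝ) := Finset.sum_le_sum fun i _ => by
        rw [norm_smul, b.norm_eq_one, mul_one, Real.norm_eq_abs, inner_sub_right]
        exact abs_sub_le_iff.2 ⟨hK y hy x hx i, hK x hx y hy i⟩
      _ ≤ 1 := by
        rw [Finset.sum_const, Finset.card_univ, nsmul_eq_mul, mul_one_div, div_le_one hN]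
        change (N : ℝ) ≤ N + 1
        linarith
  have step : ∀ k : ℕ, ∀ K : ConvexBody E, WidthLE b (fun _ => 2 ^ k * (1 / (N + 1 : ℝ))) K →
      |μ K| ≤ (3 ^ N) ^ k * M := by
    intro k
    induction k with
    | zero => simpa using base
    | succ k ih =>
      intro K hK
      rw [pow_succ', mul_assoc]
      refine abs_le_of_widthLE_mul_two hμ b ih K ?_
      convert hK using 2
      ring
  have hM0 := hM.nonneg
  obtain ⟨k, hk1, hk2⟩ := exists_nat_pow_near (x := 2 * (N + 1 : ℝ) * (1 + R)) (y := 2)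
    (by nlinarith [Nat.cast_nonneg (α := ℝ) N]) (by norm_num)
  refine (step (k + 1) K fun x hx y hy i => ?_).trans ?_
  · have hx' := mem_closedBall_zero_iff.1 (hK hx)
    have hy' := mem_closedBall_zero_iff.1 (hK hy)
    rw [← inner_sub_right]
    have h1 := real_inner_le_norm (b i) (x - y)
    rw [b.norm_eq_one, one_mul] at h1
    have h2 := norm_sub_le x y
    have h3 : 2 * (1 + R) ≤ 2 ^ (k + 1) * (1 / (N + 1 : ℝ)) := by
      rw [mul_one_div, le_div_iff₀ hN]; nlinarith
    linarith
  · refine mul_le_mul_of_nonneg_right ?_ hM0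
    have h4 : ((2 : ℝ) ^ (k + 1)) ≤ 4 * (N + 1) * (1 + R) := by rw [pow_succ]; nlinarith
    calc ((3 : ℝ) ^ N) ^ (k + 1) ≤ (4 ^ N) ^ (k + 1) := by gcongr; norm_num
      _ = (2 ^ (k + 1)) ^ (2 * N) := by
        rw [show (4 : ℝ) = 2 ^ 2 by norm_num, ← pow_mul, ← pow_mul, ← pow_mul]; ring_nf
      _ ≤ _ := by gcongr

end Growth

section PartialMaxima

lemma min_partialSups_mul_add {x : ℕ → ℝ} {m j : ℕ} (hj : j + 1 ≤ m) {s t : ℝ} (hs : 0 ≤ s)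
    (ht : 0 ≤ t) :
    min (partialSups (fun i => s * partialSups x i + t * partialSups (fun l => x (max l i)) m) j)
      (s * partialSups x (j + 1) + t * partialSups (fun l => x (max l (j + 1))) m) =
    s * partialSups x j + t * partialSups (fun l => x (max l (j + 1))) m := by
  have hq : ∀ i l, i ≤ l → l ≤ m → x l ≤ partialSups (fun l => x (max l i)) m := by
    intro i l h1 h2
    have := le_partialSups_of_le (fun l => x (max l i)) h2
    simpa [max_eq_left h1] using this
  have hqle : ∀ i c, i ≤ m → (∀ l, i ≤ l → l ≤ m → x l ≤ c) →
      partialSups (fun l => x (max l i)) m ≤ c := by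
    intro i c hi h
    refine partialSups_le _ _ _ fun l hl => h _ (le_max_right _ _) (max_le hl hi)
  refine le_antisymm ?_ (le_min ?_ ?_)
  · rcases le_or_gt (x (j + 1)) (partialSups x j) with h | h
    · refine (min_le_right _ _).trans ?_
      rw [partialSups_add_one, sup_eq_left.2 h]
    · refine (min_le_left _ _).trans (partialSups_le _ _ _ fun i hi => ?_)
      have h1 : partialSups x i ≤ partialSups x j := (partialSups x).monotone hi
      have h2 : partialSups (fun l => x (max l i)) m ≤
          partialSups (fun l => x (max l (j + 1))) m := by
        refine hqle _ _ (by omega) fun l h3 h4 => ?_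
        rcases le_or_gt l j with h5 | h5
        · exact ((le_partialSups_of_le x h5).trans h.le).trans (hq _ _ le_rfl hj)
        · exact hq _ _ h5 h4
      have := mul_le_mul_of_nonneg_left h1 hs
      have := mul_le_mul_of_nonneg_left h2 ht
      linarith
  · refine le_trans ?_ (le_partialSups _ j)
    have h2 : partialSups (fun l => x (max l (j + 1))) m ≤ partialSups (fun l => x (max l j)) m :=
      hqle _ _ hj fun l h3 h4 => hq _ _ (by omega) h4
    have := mul_le_mul_of_nonneg_left h2 ht
    linarith
  · have h1 : partialSups x j ≤ partialSups x (j + 1) := (partialSups x).monotone (by omega)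
    have := mul_le_mul_of_nonneg_left h1 hs
    linarith

lemma partialSups_mul_add {x : ℕ → ℝ} {m : ℕ} {s t : ℝ} (hs : 0 ≤ s) (ht : 0 ≤ t) :
    partialSups (fun i => s * partialSups x i + t * partialSups (fun l => x (max l i)) m) m =
      (s + t) * partialSups x m := by
  refine le_antisymm (partialSups_le _ _ _ fun i hi => ?_) ?_
  · have h1 : partialSups x i ≤ partialSups x m := (partialSups x).monotone hi
    have h2 : partialSups (fun l => x (max l i)) m ≤ partialSups x m :=
      partialSups_le _ _ _ fun l hl => le_partialSups_of_le x (max_le hl hi)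
    have := mul_le_mul_of_nonneg_left h1 hs
    have := mul_le_mul_of_nonneg_left h2 ht
    linarith
  · obtain ⟨i, hi, h⟩ := exists_partialSups_eq x m
    refine le_trans ?_ (le_partialSups_of_le _ hi)
    have h1 : x i ≤ partialSups x i := le_partialSups x i
    have h2 : x i ≤ partialSups (fun l => x (max l i)) m := by
      have := le_partialSups_of_le (fun l => x (max l i)) hi
      simpa using this
    have := mul_le_mul_of_nonneg_left h1 hs
    have := mul_le_mul_of_nonneg_left h2 ht
    rw [h]
    linarith

lemma partialSups_zero_max (x : ℕ → ℝ) (m : ℕ) :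
    partialSups (fun l => x (max l m)) m = x m := by
  refine le_antisymm (partialSups_le _ _ _ fun l hl => by simp [max_eq_right hl]) ?_
  simpa using le_partialSups (fun l => x (max l m)) m

end PartialMaxima

section Polynomiality

open Filter Topology Module
open scoped RealInnerProductSpace

variable {E : Type*} [NormedAddCommGroup E] [InnerProductSpace ℝ E]

lemma Supp.partialSups {f : ℕ → E → ℝ} (hf : ∀ i, Supp (f i)) (m : ℕ) :
    Supp (fun u => partialSups (fun i => f i u) m) := by
  induction m with
  | zero => simpa using hf 0
  | succ m ih =>
    simp only [partialSups_add_one]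
    exact ih.max (hf _)

lemma exists_partialSups_approx [FiniteDimensional ℝ E] [Nontrivial E] {φ : E → ℝ} (hφ : Supp φ)
    {δ : ℝ} (hδ : 0 < δ) : ∃ (a : ℕ → E) (m : ℕ), (∀ i, a i ∈ wulff φ) ∧ ∀ u : E, ‖u‖ = 1 →
      |partialSups (fun i => ⟪a i, u⟫) m - φ u| ≤ δ := by
  obtain ⟨t, ht, hfin, hcov⟩ := (isCompact_wulff φ).finite_cover_balls hδ
  obtain ⟨x₀, hx₀⟩ := hφ.nonempty
  set l := hfin.toFinset.toList
  have hmem : ∀ i, l.getD i x₀ ∈ wulff φ := by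
    intro i
    rcases lt_or_ge i l.length with h | h
    · rw [List.getD_eq_getElem _ _ h]
      have : l[i] ∈ l := List.getElem_mem h
      exact ht (hfin.mem_toFinset.1 (Finset.mem_toList.1 this))
    · rw [List.getD_eq_default _ _ h]; exact hx₀
  refine ⟨fun i => l.getD i x₀, l.length, hmem, fun u hu => abs_sub_le_iff.2 ⟨?_, ?_⟩⟩
  · have : partialSups (fun i => ⟪l.getD i x₀, u⟫) l.length ≤ φ u :=
      partialSups_le _ _ _ fun i _ => hmem i u hu
    linarith
  · obtain ⟨v, hv, h⟩ := hφ u hu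
    obtain ⟨w, hw, hvw⟩ := Set.mem_iUnion₂.1 (hcov hv)
    have hwl : w ∈ l := by simpa [l] using hw
    obtain ⟨i, hi, rfl⟩ := List.mem_iff_getElem.1 hwl
    have h1 : ⟪l[i], u⟫ ≤ partialSups (fun i => ⟪l.getD i x₀, u⟫) l.length := by
      have := le_partialSups_of_le (fun i => ⟪l.getD i x₀, u⟫) hi.le
      rwa [List.getD_eq_getElem _ _ hi] at this
    have h2 := real_inner_le_norm (v - l[i]) u
    rw [hu, mul_one, inner_sub_left] at h2
    rw [Metric.mem_ball, dist_eq_norm] at hvw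
    linarith

/-- Continuous translation invariant valuations. -/
structure IsCTV (μ : ConvexBody E → ℝ) : Prop where
  val : IsValuation μ
  trans : TransInv μ
  cont : Continuous μ

variable [FiniteDimensional ℝ E] [Nontrivial E]

variable (E) in
/-- The rate of growth of valuations with the circumradius. -/
def growth (R : ℝ) : ℝ := (4 * (finrank ℝ E + 1) * (1 + R)) ^ (2 * finrank ℝ E)

namespace IsCTV

variable {μ : ConvexBody E → ℝ}

lemma abs_onSupp_le (hμ : IsCTV μ) {M : ℝ} (hM : UnitBound μ M) {φ : E → ℝ} {R : ℝ} (hR : 0 ≤ R)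
    (h : ∀ u : E, ‖u‖ = 1 → φ u ≤ R) : |onSupp μ φ| ≤ growth E R * M := by
  by_cases hφ : Supp φ
  · rw [onSupp_of_supp μ hφ]
    have := abs_le_of_subset_closedBall hμ.val hμ.trans hM (stdOrthonormalBasis ℝ E) hR hφ.body
      fun x hx => mem_closedBall_zero_iff.2 (norm_le_of_mem_wulff hR h hx)
    rwa [Fintype.card_fin] at this
  · rw [onSupp, dif_neg hφ, abs_zero]
    have := hM.nonneg
    unfold growth
    positivity

lemma polyOn_of_sub (hμ : IsCTV μ) {k l : E → ℝ} (hk : Supp k) (hl : Supp l) {d : ℕ}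
    (h : ∀ t, 0 ≤ t → PolyOn d (fun s => onSupp μ (fun u => k u + (s + t) * l u) -
      onSupp μ (fun u => k u + s * l u)) (Set.Ici 0)) :
    PolyOn (2 * finrank ℝ E) (fun t => onSupp μ (fun u => k u + t * l u)) (Set.Ici 0) := by
  have hbd : ∀ {φ : E → ℝ}, Supp φ → ∃ C, 0 ≤ C ∧ ∀ u : E, ‖u‖ = 1 → |φ u| ≤ C := by
    intro φ hφ
    obtain ⟨C, hC0, hC⟩ := exists_bound_wulff φ
    refine ⟨C, hC0, fun u hu => ?_⟩
    obtain ⟨v, hv, h1⟩ := hφ u hu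
    rw [← h1]
    calc |⟪v, u⟫| ≤ ‖v‖ * ‖u‖ := abs_real_inner_le_norm _ _
      _ ≤ C := by rw [hu, mul_one]; exact hC v hv
  obtain ⟨C, hC0, hC⟩ := hbd hl
  obtain ⟨C', hC'0, hC'⟩ := hbd hk
  have hS : ∀ t, 0 ≤ t → Supp (fun u => k u + t * l u) := fun t ht => hk.add (hl.const_mul ht)
  have hcont : Continuous fun s : ℝ => onSupp μ (fun u => k u + max s 0 * l u) := by
    refine continuous_iff_continuousAt.2 fun s₀ => ?_
    refine tendsto_onSupp hμ.cont (f := fun s u => k u + max s 0 * l u)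
      (δ := fun s => |max s 0 - max s₀ 0| * C) (fun s => hS _ (le_max_right _ _))
      (hS _ (le_max_right _ _)) ?_ (fun s => by positivity) fun s u hu => ?_
    · have : Continuous fun s : ℝ => |max s 0 - max s₀ 0| * C := by fun_prop
      simpa using this.tendsto s₀
    · rw [add_sub_add_left_eq_sub, ← sub_mul, abs_mul]
      gcongr
      exact hC u hu
  obtain ⟨p, hp⟩ := exists_polynomial_of_sub hcont (d := d) fun t ht => by
    refine (h t ht).congr fun s hs => ?_
    have hs' : (0 : ℝ) ≤ s := hs
    rw [max_eq_left hs', max_eq_left (add_nonneg hs' ht)]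
  obtain ⟨M, hM⟩ := exists_unitBound hμ.cont
  have hp' : ∀ t, 0 ≤ t → onSupp μ (fun u => k u + t * l u) = p.eval t := fun t ht => by
    have := hp t ht
    rwa [max_eq_left ht] at this
  refine ⟨p, natDegree_le_of_growth (c := growth E (C' + C) * M) fun t ht => ?_, hp'⟩
  rw [← hp' t ht]
  refine (hμ.abs_onSupp_le hM (R := C' + t * C) (by positivity) fun u hu => ?_).trans ?_
  · have h1 := (le_abs_self _).trans (hC' u hu)
    have h2 := mul_le_mul_of_nonneg_left ((le_abs_self _).trans (hC u hu)) ht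
    linarith
  · have hM0 := hM.nonneg
    rw [mul_right_comm]
    refine mul_le_mul_of_nonneg_right ?_ hM0
    rw [growth, growth, ← mul_pow]
    refine pow_le_pow_left₀ (by positivity) ?_ _
    rw [mul_assoc _ (1 + (C' + C))]
    refine mul_le_mul_of_nonneg_left ?_ (by positivity)
    nlinarith [mul_nonneg ht hC'0]

lemma polyOn_partialSups (hμ : IsCTV μ) (a : ℕ → E) (m : ℕ) : ∀ {k : E → ℝ}, Supp k →
    PolyOn (2 * finrank ℝ E)
      (fun t => onSupp μ (fun u => k u + t * partialSups (fun i => ⟪a i, u⟫) m)) (Set.Ici 0) := by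
  induction m using Nat.strong_induction_on with
  | _ m ih =>
  intro k hk
  rcases m with _ | m
  · refine (PolyOn.const _ (onSupp μ k) _).congr fun t (ht : (0 : ℝ) ≤ t) => ?_
    rw [← onSupp_add_inner hμ.trans hk (t • a 0)]
    exact onSupp_congr _ fun u _ => by simp [inner_smul_left]
  set x : E → ℕ → ℝ := fun u i => ⟪a i, u⟫
  set p : ℕ → E → ℝ := fun i u => partialSups (x u) i
  set q : ℕ → E → ℝ := fun i u => partialSups (fun l => x u (max l i)) (m + 1)
  have hp : ∀ i, Supp (p i) := fun i => Supp.partialSups (fun i => Supp.lin (a i)) i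
  have hq : ∀ i, Supp (q i) := fun i => Supp.partialSups (fun l => Supp.lin (a (max l i))) (m + 1)
  set g : ℝ → ℝ → ℕ → E → ℝ := fun s t i u => s * p i u + t * q i u
  have hg : ∀ s t, 0 ≤ s → 0 ≤ t → ∀ i, Supp (g s t i) := fun s t hs ht i =>
    ((hp i).const_mul hs).add ((hq i).const_mul ht)
  set f : ℝ → ℝ → ℕ → E → ℝ := fun s t i u => partialSups (fun i => g s t i u) i
  have hf : ∀ s t, 0 ≤ s → 0 ≤ t → ∀ i, Supp (f s t i) := fun s t hs ht i =>
    Supp.partialSups (hg s t hs ht) i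
  have hstep : ∀ s t, 0 ≤ s → 0 ≤ t → ∀ j, j ≤ m →
      onSupp μ (fun u => k u + f s t (j + 1) u) = onSupp μ (fun u => k u + f s t j u) +
        onSupp μ (fun u => k u + g s t (j + 1) u) -
        onSupp μ (fun u => (k u + t * q (j + 1) u) + s * p j u) := by
    intro s t hs ht j hj
    have hmin : ∀ u, min (k u + f s t j u) (k u + g s t (j + 1) u) =
        (k u + t * q (j + 1) u) + s * p j u := by
      intro u
      rw [min_add_add_left]
      have := min_partialSups_mul_add (x := x u) (m := m + 1) (j := j) (by omega) hs ht
      simp only [f, g, p, q]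
      rw [this]
      ring
    have h1 := onSupp_max_add_min hμ.val (hk.add (hf s t hs ht j)) (hk.add (hg s t hs ht (j + 1)))
      (by simp only [hmin]; exact (hk.add ((hq _).const_mul ht)).add ((hp _).const_mul hs))
    simp only [hmin, max_add_add_left] at h1
    have h2 : ∀ u, f s t (j + 1) u = max (f s t j u) (g s t (j + 1) u) := fun u => by
      simp only [f, partialSups_add_one]
    simp only [h2]
    linarith
  have hpoly : ∀ t, 0 ≤ t → ∀ i, i ≤ m → ∀ j, PolyOn (2 * finrank ℝ E)
      (fun s => onSupp μ (fun u => (k u + t * q j u) + s * p i u)) (Set.Ici 0) :=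
    fun t ht i hi j => ih i (by omega) (hk.add ((hq j).const_mul ht))
  have hgp : ∀ t, 0 ≤ t → ∀ i, i ≤ m → PolyOn (2 * finrank ℝ E)
      (fun s => onSupp μ (fun u => k u + g s t i u)) (Set.Ici 0) := by
    intro t ht i hi
    refine (hpoly t ht i hi i).congr fun s _ => onSupp_congr _ fun u _ => ?_
    simp only [g]; ring
  have hfp : ∀ t, 0 ≤ t → ∀ j, j ≤ m → PolyOn (2 * finrank ℝ E)
      (fun s => onSupp μ (fun u => k u + f s t j u)) (Set.Ici 0) := by
    intro t ht j
    induction j with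
    | zero =>
      intro h
      simpa [f] using hgp t ht 0 h
    | succ j ihj =>
      intro h
      exact (((ihj (by omega)).add (hgp t ht (j + 1) h)).sub (hpoly t ht j (by omega) (j + 1))).congr
        fun s hs => hstep s t hs ht j (by omega)
  refine hμ.polyOn_of_sub hk (hp (m + 1)) (d := 2 * finrank ℝ E) fun t ht => ?_
  refine ((hfp t ht m le_rfl).sub (hpoly t ht m le_rfl (m + 1))).congr fun s hs => ?_
  have h1 := hstep s t hs ht m le_rfl
  have h2 : ∀ u, f s t (m + 1) u = (s + t) * p (m + 1) u := fun u =>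
    partialSups_mul_add hs ht
  have h3 : onSupp μ (fun u => k u + g s t (m + 1) u) =
      onSupp μ (fun u => k u + s * p (m + 1) u) := by
    rw [← onSupp_add_inner hμ.trans (hk.add ((hp (m + 1)).const_mul hs)) (t • a (m + 1))]
    refine onSupp_congr _ fun u _ => ?_
    have h4 : q (m + 1) u = ⟪a (m + 1), u⟫ := partialSups_zero_max (x u) (m + 1)
    simp only [g, h4, inner_smul_left, conj_trivial]
    ring
  simp only [h2, h3] at h1
  rw [h1]
  ring

/-- The value of a valuation is polynomial along rays of support functions. -/
lemma polyOn (hμ : IsCTV μ) {k l : E → ℝ} (hk : Supp k) (hl : Supp l) :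
    PolyOn (2 * finrank ℝ E) (fun t => onSupp μ (fun u => k u + t * l u)) (Set.Ici 0) := by
  choose a m _ ham using fun j : ℕ => exists_partialSups_approx hl (δ := 1 / ((j : ℝ) + 1))
    (by positivity)
  refine PolyOn.of_tendsto (fun j => hμ.polyOn_partialSups (a j) (m j) hk) fun t ht => ?_
  have ht' : (0 : ℝ) ≤ t := ht
  refine tendsto_onSupp hμ.cont (δ := fun j : ℕ => t * (1 / ((j : ℝ) + 1)))
    (fun j => hk.add ((Supp.partialSups (fun i => Supp.lin _) _).const_mul ht'))
    (hk.add (hl.const_mul ht')) ?_ (fun j => by positivity) fun j u hu => ?_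
  · simpa using (tendsto_one_div_add_atTop_nhds_zero_nat (𝕜 := ℝ)).const_mul t
  · rw [add_sub_add_left_eq_sub, ← mul_sub, abs_mul, abs_of_nonneg ht']
    exact mul_le_mul_of_nonneg_left (ham j u hu) ht'

end IsCTV

end Polynomiality

section NiceFunctions

variable {E : Type*} [NormedAddCommGroup E] [InnerProductSpace ℝ E]

/-- `R + φ` and `R - φ` are support functions and `φ` is bounded by `R` on the unit sphere. -/
structure Nice (φ : E → ℝ) (R : ℝ) : Prop where
  add : Supp (fun u => φ u + R)
  sub : Supp (fun u => R - φ u)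
  abs_le : ∀ u : E, ‖u‖ = 1 → |φ u| ≤ R

namespace Nice

variable {φ ψ : E → ℝ} {R S : ℝ}

lemma mono (hφ : Nice φ R) (h : R ≤ S) : Nice φ S :=
  ⟨(hφ.add.add_const (sub_nonneg.2 h)).congr fun u _ => by ring,
    (hφ.sub.add_const (sub_nonneg.2 h)).congr fun u _ => by ring,
    fun u hu => (hφ.abs_le u hu).trans h⟩

lemma nonneg [Nontrivial E] (hφ : Nice φ R) : 0 ≤ R := by
  obtain ⟨u, hu⟩ := exists_norm_eq E (zero_le_one (α := ℝ))
  exact (abs_nonneg _).trans (hφ.abs_le u hu)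

lemma add_fun (hφ : Nice φ R) (hψ : Nice ψ S) : Nice (φ + ψ) (R + S) :=
  ⟨(hφ.add.add hψ.add).congr fun u _ => by simp only [Pi.add_apply]; ring,
    (hφ.sub.add hψ.sub).congr fun u _ => by simp only [Pi.add_apply]; ring,
    fun u hu => (abs_add_le _ _).trans (add_le_add (hφ.abs_le u hu) (hψ.abs_le u hu))⟩

lemma neg_fun (hφ : Nice φ R) : Nice (-φ) R :=
  ⟨hφ.sub.congr fun u _ => by simp only [Pi.neg_apply]; ring,
    hφ.add.congr fun u _ => by simp only [Pi.neg_apply]; ring,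
    fun u hu => by rw [Pi.neg_apply, abs_neg]; exact hφ.abs_le u hu⟩

lemma sub_fun (hφ : Nice φ R) (hψ : Nice ψ S) : Nice (φ - ψ) (R + S) := by
  rw [sub_eq_add_neg]; exact hφ.add_fun hψ.neg_fun

lemma smul_fun (hφ : Nice φ R) (c : ℝ) : Nice (c • φ) (|c| * R) := by
  have key : ∀ c : ℝ, 0 ≤ c → Nice (c • φ) (c * R) := fun c hc =>
    ⟨(hφ.add.const_mul hc).congr fun u _ => by simp only [Pi.smul_apply, smul_eq_mul]; ring,
      (hφ.sub.const_mul hc).congr fun u _ => by simp only [Pi.smul_apply, smul_eq_mul]; ring,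
      fun u hu => by
        rw [Pi.smul_apply, smul_eq_mul, abs_mul, abs_of_nonneg hc]
        exact mul_le_mul_of_nonneg_left (hφ.abs_le u hu) hc⟩
  rcases le_total 0 c with hc | hc
  · rw [abs_of_nonneg hc]; exact key c hc
  · rw [abs_of_nonpos hc]
    simpa using (key (-c) (by linarith)).neg_fun

lemma supp_add (hφ : Nice φ R) (h : R ≤ S) : Supp (fun u => φ u + S) := (hφ.mono h).add

end Nice

end NiceFunctions

section Extension

open Polynomial Filter Topology Module
open scoped RealInnerProductSpace

variable {E : Type*} [NormedAddCommGroup E] [InnerProductSpace ℝ E] [FiniteDimensional ℝ E]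
  [Nontrivial E]

variable (E) in
/-- A bound for the degree of the polynomials along segments. -/
def polyDeg : ℕ := 2 * finrank ℝ E + 2 * finrank ℝ E

open Classical in
/-- The polynomial extension of a valuation to functions on the unit sphere. -/
def extVal (μ : ConvexBody E → ℝ) (φ : E → ℝ) : ℝ :=
  if h : ∃ R : ℝ, Supp (fun u => φ u + R) then
    ∑ j ∈ Finset.range (polyDeg E + 1), onSupp μ (fun u => φ u + (h.choose + j)) *
      (lagr (polyDeg E) j).eval (-h.choose)
  else 0

namespace IsCTV

variable {μ : ConvexBody E → ℝ}

lemma exists_polynomial (hμ : IsCTV μ) {φ : E → ℝ} {R : ℝ} (hφ : Supp (fun u => φ u + R)) :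
    ∃ p : ℝ[X], p.natDegree ≤ polyDeg E ∧ ∀ s, R ≤ s → onSupp μ (fun u => φ u + s) = p.eval s := by
  obtain ⟨p, hp, h⟩ := (hμ.polyOn hφ (Supp.const zero_le_one)).comp_affine (u := Set.Ici R) 1 (-R)
    fun t ht => by simpa using ht
  refine ⟨p, hp.trans (by simp [polyDeg]), fun s hs => ?_⟩
  rw [← h s hs]
  congr 1
  ext u
  ring

lemma sum_lagr_eq_eval {d : ℕ} {p : ℝ[X]} (hp : p.natDegree ≤ d) (R : ℝ) :
    ∑ j ∈ Finset.range (d + 1), p.eval (R + j) * (lagr d j).eval (-R) = p.eval 0 := by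
  have h : (p.comp (X + C R)).natDegree ≤ d := by
    rw [natDegree_comp, natDegree_X_add_C, mul_one]; exact hp
  have := eval_eq_sum_lagr h (-R)
  simp only [eval_comp, eval_add, eval_X, eval_C, neg_add_cancel] at this
  rw [this]
  simp only [add_comm]

lemma extVal_eq_eval (hμ : IsCTV μ) {φ : E → ℝ} {R : ℝ} (hφ : Supp (fun u => φ u + R)) {p : ℝ[X]}
    (hp : p.natDegree ≤ polyDeg E) (h : ∀ s, R ≤ s → onSupp μ (fun u => φ u + s) = p.eval s) :
    extVal μ φ = p.eval 0 := by
  have hex : ∃ R : ℝ, Supp (fun u => φ u + R) := ⟨R, hφ⟩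
  rw [extVal, dif_pos hex]
  set R' := hex.choose
  obtain ⟨q, hq, hqR⟩ := hμ.exists_polynomial hex.choose_spec
  have hpq : p = q := by
    refine eq_of_infinite_eval_eq p q ((Set.Ici_infinite (max R R')).mono fun s hs => ?_)
    have hs' : max R R' ≤ s := hs
    change p.eval s = q.eval s
    rw [← h s ((le_max_left _ _).trans hs'), hqR s ((le_max_right _ _).trans hs')]
  rw [← sum_lagr_eq_eval hp R', hpq]
  exact Finset.sum_congr rfl fun j _ => by rw [hqR _ (by simp [R'])]

lemma extVal_eq_sum (hμ : IsCTV μ) {φ : E → ℝ} {R : ℝ} (hφ : Supp (fun u => φ u + R)) :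
    extVal μ φ = ∑ j ∈ Finset.range (polyDeg E + 1), onSupp μ (fun u => φ u + (R + j)) *
      (lagr (polyDeg E) j).eval (-R) := by
  obtain ⟨p, hp, h⟩ := hμ.exists_polynomial hφ
  rw [hμ.extVal_eq_eval hφ hp h, ← sum_lagr_eq_eval hp R]
  exact Finset.sum_congr rfl fun j _ => by rw [h _ (by simp)]

lemma extVal_of_supp (hμ : IsCTV μ) {φ : E → ℝ} (hφ : Supp φ) : extVal μ φ = onSupp μ φ := by
  have h0 : Supp (fun u => φ u + 0) := by simpa using hφ
  obtain ⟨p, hp, h⟩ := hμ.exists_polynomial h0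
  rw [hμ.extVal_eq_eval h0 hp h, ← h 0 le_rfl]
  simp

lemma polyOn_segment (hμ : IsCTV μ) {k y : E → ℝ} {T : ℝ} (hT : 0 < T)
    (h1 : Supp (fun u => k u + T * y u)) (h2 : Supp (fun u => k u - T * y u)) :
    PolyOn (polyDeg E) (fun t => onSupp μ (fun u => k u + t * y u)) (Set.Icc (-T) T) := by
  have hc : 0 ≤ (2 * T)⁻¹ := by positivity
  set a : E → ℝ := fun u => (2 * T)⁻¹ * (k u + T * y u)
  set b : E → ℝ := fun u => (2 * T)⁻¹ * (k u - T * y u)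
  have ha : Supp a := h1.const_mul hc
  have hb : Supp b := h2.const_mul hc
  set e := 2 * finrank ℝ E
  have hnode : ∀ i ∈ Finset.range (e + 1), (i : ℝ) ∈ Set.Ici (0 : ℝ) := fun i _ => by simp
  have key : ∀ σ τ : ℝ, 0 ≤ σ → 0 ≤ τ → onSupp μ (fun u => τ * b u + σ * a u) =
      ∑ i ∈ Finset.range (e + 1), ∑ j ∈ Finset.range (e + 1),
        onSupp μ (fun u => (i : ℝ) * a u + j * b u) *
          ((lagr e i).eval σ * (lagr e j).eval τ) := by
    intro σ τ hσ hτ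
    rw [(hμ.polyOn (hb.const_mul hτ) ha).eq_sum_lagr hnode hσ]
    refine Finset.sum_congr rfl fun i hi => ?_
    have h3 := (hμ.polyOn (ha.const_mul (Nat.cast_nonneg i)) hb).eq_sum_lagr hnode hτ
    have h4 : ∀ u, τ * b u + i * a u = i * a u + τ * b u := fun u => add_comm _ _
    simp only [h4]
    rw [h3, Finset.sum_mul]
    exact Finset.sum_congr rfl fun j _ => by ring
  have hpoly : PolyOn (polyDeg E) (fun t => ∑ i ∈ Finset.range (e + 1),
      ∑ j ∈ Finset.range (e + 1), onSupp μ (fun u => (i : ℝ) * a u + j * b u) *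
          ((lagr e i).eval (1 * t + T) * (lagr e j).eval (-1 * t + T))) (Set.Icc (-T) T) :=
    PolyOn.sum _ fun i hi => PolyOn.sum _ fun j hj => PolyOn.const_mul _
      (((PolyOn.lagr hi Set.univ).comp_affine 1 T (by simp)).mul
        ((PolyOn.lagr hj Set.univ).comp_affine (-1) T (by simp)))
  refine hpoly.congr fun t ht => ?_
  rw [← key _ _ (by linarith [ht.1]) (by linarith [ht.2])]
  congr 1
  ext u
  simp only [a, b]
  field_simp
  ring

lemma polyOn_extVal (hμ : IsCTV μ) {x y : E → ℝ} {R S : ℝ} (hx : Nice x R) (hy : Nice y S) :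
    PolyOn (polyDeg E) (fun t : ℝ => extVal μ (x + t • y)) Set.univ := by
  have key : ∀ T : ℝ, 0 < T →
      PolyOn (polyDeg E) (fun t : ℝ => extVal μ (x + t • y)) (Set.Icc (-T) T) := by
    intro T hT
    have hS := hy.nonneg
    have hb : ∀ t : ℝ, |t| ≤ T → ∀ c : ℝ, 0 ≤ c →
        Supp (fun u => (x + t • y) u + (R + T * S + c)) := fun t ht c hc =>
      (hx.add_fun (hy.smul_fun t)).supp_add (by nlinarith [mul_le_mul_of_nonneg_right ht hS])
    have hpoly : PolyOn (polyDeg E) (fun t : ℝ => ∑ j ∈ Finset.range (polyDeg E + 1),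
        (lagr (polyDeg E) j).eval (-(R + T * S)) *
        onSupp μ (fun u => (x u + (R + T * S + j)) + t * y u)) (Set.Icc (-T) T) := by
      refine PolyOn.sum _ fun j _ => PolyOn.const_mul _ (hμ.polyOn_segment hT ?_ ?_)
      · refine (hb T (abs_of_pos hT).le j (Nat.cast_nonneg j)).congr fun u _ => ?_
        simp only [Pi.add_apply, Pi.smul_apply, smul_eq_mul]; ring
      · refine (hb (-T) (by rw [abs_neg, abs_of_pos hT]) j (Nat.cast_nonneg j)).congr fun u _ => ?_
        simp only [Pi.add_apply, Pi.smul_apply, smul_eq_mul]; ring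
    refine hpoly.congr fun t ht => ?_
    have h0 := hb t (abs_le.2 ht) 0 le_rfl
    rw [add_zero] at h0
    rw [hμ.extVal_eq_sum h0]
    refine Finset.sum_congr rfl fun j _ => ?_
    rw [mul_comm]
    congr 2
    ext u
    simp only [Pi.add_apply, Pi.smul_apply, smul_eq_mul]; ring
  refine PolyOn.of_eq_sum_lagr fun t _ => ?_
  refine (key (|t| + polyDeg E + 1) (by positivity)).eq_sum_lagr (fun i hi => ?_) ?_
  · have : (i : ℝ) ≤ polyDeg E := by exact_mod_cast Nat.lt_succ_iff.1 (Finset.mem_range.1 hi)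
    constructor <;> linarith [abs_nonneg t, Nat.cast_nonneg (α := ℝ) i]
  · constructor <;> linarith [abs_nonneg t, neg_abs_le t, le_abs_self t,
      Nat.cast_nonneg (α := ℝ) (polyDeg E)]

open Classical in
lemma extVal_congr (μ : ConvexBody E → ℝ) {φ ψ : E → ℝ} (h : ∀ u : E, ‖u‖ = 1 → φ u = ψ u) :
    extVal μ φ = extVal μ ψ := by
  have h1 : (fun R : ℝ => Supp (fun u => φ u + R)) = fun R : ℝ => Supp (fun u => ψ u + R) :=
    funext fun R => propext ⟨fun hs => hs.congr fun u hu => by rw [h u hu],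
      fun hs => hs.congr fun u hu => by rw [h u hu]⟩
  have h2 : ∀ R : ℝ, onSupp μ (fun u => φ u + R) = onSupp μ (fun u => ψ u + R) := fun R =>
    onSupp_congr μ fun u hu => by rw [h u hu]
  have key : ∀ P Q : ℝ → Prop, P = Q → ∀ f g : ℝ → ℝ, f = g →
      (if h : ∃ R, P R then ∑ j ∈ Finset.range (polyDeg E + 1), f (h.choose + j) *
        (lagr (polyDeg E) j).eval (-h.choose) else 0) =
      if h : ∃ R, Q R then ∑ j ∈ Finset.range (polyDeg E + 1), g (h.choose + j) *
        (lagr (polyDeg E) j).eval (-h.choose) else 0 := by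
    rintro P Q rfl f g rfl
    rfl
  exact key _ _ h1 _ _ (funext h2)

lemma extVal_max_add_min (hμ : IsCTV μ) {x φ ψ : E → ℝ} {R S T : ℝ} (hx : Nice x R) (hφ : Nice φ S)
    (hψ : Nice ψ T) (hφ0 : ∀ u : E, ‖u‖ = 1 → 0 ≤ φ u) (hψ0 : ∀ u : E, ‖u‖ = 1 → 0 ≤ ψ u)
    (h0 : ∀ u : E, ‖u‖ = 1 → φ u * ψ u = 0) :
    extVal μ (x + φ + ψ) + extVal μ x = extVal μ (x + φ) + extVal μ (x + ψ) := by
  have hS := hφ.nonneg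
  have hT := hψ.nonneg
  set c := R + S + T
  have s1 : ∀ s, c ≤ s → Supp (fun u => (x + φ) u + s) := fun s hs =>
    (hx.add_fun hφ).supp_add (by linarith)
  have s2 : ∀ s, c ≤ s → Supp (fun u => (x + ψ) u + s) := fun s hs =>
    (hx.add_fun hψ).supp_add (by linarith)
  have s3 : ∀ s, c ≤ s → Supp (fun u => x u + s) := fun s hs => hx.supp_add (by linarith)
  have s4 : ∀ s, c ≤ s → Supp (fun u => (x + φ + ψ) u + s) := fun s hs =>
    ((hx.add_fun hφ).add_fun hψ).supp_add (by linarith)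
  rw [hμ.extVal_eq_sum (s1 c le_rfl), hμ.extVal_eq_sum (s2 c le_rfl), hμ.extVal_eq_sum (s3 c le_rfl),
    hμ.extVal_eq_sum (s4 c le_rfl), ← Finset.sum_add_distrib, ← Finset.sum_add_distrib]
  refine Finset.sum_congr rfl fun j _ => ?_
  rw [← add_mul, ← add_mul]
  congr 1
  have hj : c ≤ c + j := by simp
  have hmin : ∀ u : E, ‖u‖ = 1 →
      min ((x + φ) u + (c + j)) ((x + ψ) u + (c + j)) = x u + (c + j) := by
    intro u hu
    simp only [Pi.add_apply, min_add_add_right, min_add_add_left]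
    rcases mul_eq_zero.1 (h0 u hu) with h | h
    · rw [h, min_eq_left (hψ0 u hu), add_zero]
    · rw [h, min_eq_right (hφ0 u hu), add_zero]
  have hmax : ∀ u : E, ‖u‖ = 1 →
      max ((x + φ) u + (c + j)) ((x + ψ) u + (c + j)) = (x + φ + ψ) u + (c + j) := by
    intro u hu
    simp only [Pi.add_apply, max_add_add_right, max_add_add_left]
    rcases mul_eq_zero.1 (h0 u hu) with h | h
    · rw [h, max_eq_right (hψ0 u hu), add_zero]
    · rw [h, max_eq_left (hφ0 u hu), add_zero]
  have := onSupp_max_add_min hμ.val (s1 _ hj) (s2 _ hj) ((s3 _ hj).congr hmin)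
  rwa [onSupp_congr μ hmin, onSupp_congr μ hmax] at this

end IsCTV

end Extension

section LagrangeBounds

open Polynomial

lemma exists_abs_eval_le {p : ℝ[X]} {d : ℕ} (hp : p.natDegree ≤ d) :
    ∃ C, 0 ≤ C ∧ ∀ t : ℝ, |p.eval t| ≤ C * (1 + |t|) ^ d := by
  refine ⟨∑ i ∈ Finset.range (d + 1), |p.coeff i|, Finset.sum_nonneg fun _ _ => abs_nonneg _,
    fun t => ?_⟩
  rw [eval_eq_sum_range' (Nat.lt_succ_of_le hp), Finset.sum_mul]
  refine (Finset.abs_sum_le_sum_abs _ _).trans (Finset.sum_le_sum fun i hi => ?_)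
  rw [abs_mul, abs_pow]
  refine mul_le_mul_of_nonneg_left ?_ (abs_nonneg _)
  have h0 := abs_nonneg t
  calc |t| ^ i ≤ (1 + |t|) ^ i := by gcongr; linarith
    _ ≤ (1 + |t|) ^ d := pow_le_pow_right₀ (by linarith) (Nat.lt_succ_iff.1 (Finset.mem_range.1 hi))

lemma exists_abs_lagr_le (d : ℕ) :
    ∃ C, 0 ≤ C ∧ ∀ i ∈ Finset.range (d + 1), ∀ t : ℝ, |(lagr d i).eval t| ≤ C * (1 + |t|) ^ d := by
  choose! C hC0 hC using fun i (hi : i ∈ Finset.range (d + 1)) =>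
    exists_abs_eval_le (natDegree_lagr_le hi)
  refine ⟨∑ i ∈ Finset.range (d + 1), C i, Finset.sum_nonneg hC0, fun i hi t =>
    (hC i hi t).trans ?_⟩
  gcongr
  exact Finset.single_le_sum hC0 hi

lemma exists_abs_lagr_sub_le (d : ℕ) :
    ∃ C, 0 ≤ C ∧ ∀ i ∈ Finset.range (d + 1), ∀ t : ℝ, 0 ≤ t → t ≤ 1 →
      |(lagr d i).eval t - (lagr d i).eval 0| ≤ C * t := by
  have key : ∀ p : ℝ[X], ∃ C, 0 ≤ C ∧ ∀ t : ℝ, 0 ≤ t → t ≤ 1 → |p.eval t - p.eval 0| ≤ C * t := by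
    intro p
    obtain ⟨C, hC0, hC⟩ := exists_abs_eval_le (le_refl p.divX.natDegree)
    refine ⟨C * 2 ^ p.divX.natDegree, by positivity, fun t h0 h1 => ?_⟩
    have h2 : p.eval t - p.eval 0 = p.divX.eval t * t := by
      conv_lhs => rw [← divX_mul_X_add p]
      simp
    rw [h2, abs_mul, abs_of_nonneg h0]
    refine mul_le_mul_of_nonneg_right ((hC t).trans ?_) h0
    gcongr
    rw [abs_of_nonneg h0]
    linarith
  choose C hC0 hC using fun i => key (lagr d i)
  refine ⟨∑ i ∈ Finset.range (d + 1), C i, Finset.sum_nonneg fun i _ => hC0 i,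
    fun i hi t h0 h1 => (hC i t h0 h1).trans ?_⟩
  gcongr
  exact Finset.single_le_sum (fun i _ => hC0 i) hi

end LagrangeBounds

section Linearity

variable {E : Type*} [NormedAddCommGroup E] [InnerProductSpace ℝ E] [FiniteDimensional ℝ E]
  [Nontrivial E]

lemma onSupp_add_smul (μ ν : ConvexBody E → ℝ) (c : ℝ) (φ : E → ℝ) :
    onSupp (μ + c • ν) φ = onSupp μ φ + c * onSupp ν φ := by
  unfold onSupp
  split_ifs <;> simp

lemma extVal_add_smul (μ ν : ConvexBody E → ℝ) (c : ℝ) (φ : E → ℝ) :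
    extVal (μ + c • ν) φ = extVal μ φ + c * extVal ν φ := by
  unfold extVal
  split_ifs
  · rw [Finset.mul_sum, ← Finset.sum_add_distrib]
    refine Finset.sum_congr rfl fun j _ => ?_
    rw [onSupp_add_smul]
    ring
  · simp

lemma IsCTV.add_smul {μ ν : ConvexBody E → ℝ} (hμ : IsCTV μ) (hν : IsCTV ν) (c : ℝ) :
    IsCTV (μ + c • ν) where
  val K L M I h1 h2 := by
    have e1 := hμ.val K L M I h1 h2
    have e2 := hν.val K L M I h1 h2
    simp only [Pi.add_apply, Pi.smul_apply, smul_eq_mul]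
    linear_combination e1 + c * e2
  trans K x := by
    simp only [Pi.add_apply, Pi.smul_apply, smul_eq_mul, hμ.trans K x, hν.trans K x]
  cont := hμ.cont.add (hν.cont.const_smul c)

end Linearity

section Isometry

open scoped RealInnerProductSpace

variable {E : Type*} [NormedAddCommGroup E] [InnerProductSpace ℝ E]

lemma wulff_comp_isometry (A : E ≃ₗᵢ[ℝ] E) (φ : E → ℝ) :
    A '' wulff (φ ∘ A) = wulff φ := by
  ext x
  constructor
  · rintro ⟨y, hy, rfl⟩ u hu
    have := hy (A.symm u) (by simpa using hu)
    simpa [LinearIsometryEquiv.inner_map_eq_flip] using this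
  · intro hx
    refine ⟨A.symm x, fun u hu => ?_, by simp⟩
    have := hx (A u) (by simpa using hu)
    simpa [LinearIsometryEquiv.inner_map_eq_flip] using this

lemma Supp.comp_isometry {φ : E → ℝ} (hφ : Supp φ) (A : E ≃ₗᵢ[ℝ] E) : Supp (φ ∘ A) := by
  intro u hu
  obtain ⟨v, hv, h⟩ := hφ (A u) (by simpa using hu)
  rw [← wulff_comp_isometry A φ] at hv
  obtain ⟨w, hw, rfl⟩ := hv
  exact ⟨w, hw, by simpa using h⟩

lemma Nice.comp_isometry {φ : E → ℝ} {R : ℝ} (hφ : Nice φ R) (A : E ≃ₗᵢ[ℝ] E) :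
    Nice (φ ∘ A) R :=
  ⟨hφ.add.comp_isometry A, hφ.sub.comp_isometry A, fun u hu => hφ.abs_le _ (by simpa using hu)⟩

variable [FiniteDimensional ℝ E] [Nontrivial E]

lemma onSupp_comp_isometry {μ : ConvexBody E → ℝ} {A : E ≃ₗᵢ[ℝ] E}
    (hA : ∀ K L : ConvexBody E, (L : Set E) = A '' K → μ L = μ K) {φ : E → ℝ} (hφ : Supp φ) :
    onSupp μ (φ ∘ A) = onSupp μ φ := by
  rw [onSupp_of_supp μ hφ, onSupp_of_supp μ (hφ.comp_isometry A)]
  exact (hA _ _ (by simp [wulff_comp_isometry])).symm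

lemma IsCTV.extVal_comp_isometry {μ : ConvexBody E → ℝ} (hμ : IsCTV μ) {A : E ≃ₗᵢ[ℝ] E}
    (hA : ∀ K L : ConvexBody E, (L : Set E) = A '' K → μ L = μ K) {φ : E → ℝ} {R : ℝ}
    (hφ : Nice φ R) : extVal μ (φ ∘ A) = extVal μ φ := by
  rw [hμ.extVal_eq_sum hφ.add, hμ.extVal_eq_sum (hφ.comp_isometry A).add]
  refine Finset.sum_congr rfl fun j _ => ?_
  congr 1
  exact onSupp_comp_isometry hA (φ := fun u => φ u + (R + j)) (hφ.supp_add (by simp))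

end Isometry

section Derivative

open Polynomial Filter Topology Module

variable {E : Type*} [NormedAddCommGroup E] [InnerProductSpace ℝ E] [FiniteDimensional ℝ E]
  [Nontrivial E]

variable (E) in
lemma exists_abs_extVal_le : ∃ (C : ℝ) (e : ℕ), 0 ≤ C ∧ ∀ (μ : ConvexBody E → ℝ) (M : ℝ), IsCTV μ →
    UnitBound μ M → ∀ (φ : E → ℝ) (R : ℝ), Nice φ R → |extVal μ φ| ≤ C * (1 + R) ^ e * M := by
  set d := polyDeg E
  set k := finrank ℝ E
  obtain ⟨C, hC0, hC⟩ := exists_abs_lagr_le d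
  refine ⟨(d + 1) * ((4 * (k + 1) * (2 + d)) ^ (2 * k) * C), 2 * k + d, by positivity,
    fun μ M hμ hM φ R hφ => ?_⟩
  have hR := hφ.nonneg
  have hM0 := hM.nonneg
  rw [hμ.extVal_eq_sum hφ.add]
  have hterm : ∀ j ∈ Finset.range (d + 1), |onSupp μ (fun u => φ u + (R + j)) *
      (lagr d j).eval (-R)| ≤
      ((4 * (k + 1) * (2 + d)) ^ (2 * k) * C) * (1 + R) ^ (2 * k + d) * M := by
    intro j hj
    have hjd : (j : ℝ) ≤ d := by exact_mod_cast Nat.lt_succ_iff.1 (Finset.mem_range.1 hj)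
    have h1 : |onSupp μ (fun u => φ u + (R + j))| ≤ growth E (2 * R + d) * M :=
      hμ.abs_onSupp_le hM (by positivity) fun u hu => by
        have := (abs_le.1 (hφ.abs_le u hu)).2
        linarith
    have h2 : growth E (2 * R + d) ≤ (4 * (k + 1) * (2 + d)) ^ (2 * k) * (1 + R) ^ (2 * k) := by
      rw [growth, ← mul_pow]
      have h3 : 1 + (2 * R + d) ≤ (2 + d) * (1 + R) := by
        nlinarith [mul_nonneg (Nat.cast_nonneg (α := ℝ) d) hR]
      refine pow_le_pow_left₀ (by positivity) ?_ _
      rw [mul_assoc (4 * ((k : ℝ) + 1))]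
      exact mul_le_mul_of_nonneg_left h3 (by positivity)
    have h3 := hC j hj (-R)
    rw [abs_neg, abs_of_nonneg hR] at h3
    rw [abs_mul]
    calc _ ≤ (((4 * (k + 1) * (2 + d)) ^ (2 * k) * (1 + R) ^ (2 * k)) * M) * (C * (1 + R) ^ d) := by
          gcongr
          exact h1.trans (by gcongr)
      _ = _ := by rw [pow_add]; ring
  refine (Finset.abs_sum_le_sum_abs _ _).trans ((Finset.sum_le_sum hterm).trans (le_of_eq ?_))
  simp
  ring

lemma Nice.add_smul {x y : E → ℝ} {R S : ℝ} (hx : Nice x R) (hy : Nice y S) (t : ℝ) :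
    Nice (x + t • y) (R + |t| * S) := hx.add_fun (hy.smul_fun t)

namespace IsCTV

variable {μ : ConvexBody E → ℝ}

lemma extVal_segment (hμ : IsCTV μ) {x y : E → ℝ} {R S : ℝ} (hx : Nice x R) (hy : Nice y S)
    (t : ℝ) : extVal μ (x + t • y) = ∑ i ∈ Finset.range (polyDeg E + 1),
      extVal μ (x + (i : ℝ) • y) * (lagr (polyDeg E) i).eval t :=
  (hμ.polyOn_extVal hx hy).eq_sum_lagr (by simp) (Set.mem_univ t)

end IsCTV

variable (E) in
lemma exists_abs_extVal_sub_le : ∃ (C : ℝ) (e : ℕ), 0 ≤ C ∧ ∀ (μ : ConvexBody E → ℝ) (M : ℝ),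
    IsCTV μ → UnitBound μ M → ∀ (x r : E → ℝ) (R ρ : ℝ), Nice x R → Nice r ρ → ρ ≤ 1 →
      |extVal μ (x + r) - extVal μ x| ≤ C * ρ * (1 + R) ^ e * M := by
  set d := polyDeg E
  obtain ⟨C, e, hC0, hC⟩ := exists_abs_extVal_le E
  obtain ⟨C', hC'0, hC'⟩ := exists_abs_lagr_sub_le d
  refine ⟨(d + 1) * (C * (1 + d) ^ e * C'), e, by positivity, fun μ M hμ hM x r R ρ hx hr hρ => ?_⟩
  have hR := hx.nonneg
  have hρ0 := hr.nonneg
  have hM0 := hM.nonneg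
  rcases hρ0.eq_or_lt with rfl | hpos
  · have : extVal μ (x + r) = extVal μ x := IsCTV.extVal_congr μ fun u hu => by
      have := hr.abs_le u hu
      simpa using this
    simp [this]
  have hy : Nice (ρ⁻¹ • r) 1 := by
    have := hr.smul_fun ρ⁻¹
    rwa [abs_of_pos (inv_pos.2 hpos), inv_mul_cancel₀ hpos.ne'] at this
  have h1 := hμ.extVal_segment hx hy ρ
  have h0 := hμ.extVal_segment hx hy 0
  rw [smul_smul, mul_inv_cancel₀ hpos.ne', one_smul] at h1
  rw [zero_smul, add_zero] at h0
  rw [h1, h0, ← Finset.sum_sub_distrib]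
  have hterm : ∀ i ∈ Finset.range (d + 1), |extVal μ (x + (i : ℝ) • ρ⁻¹ • r) * (lagr d i).eval ρ -
      extVal μ (x + (i : ℝ) • ρ⁻¹ • r) * (lagr d i).eval 0| ≤
      (C * (1 + d) ^ e * C') * ρ * (1 + R) ^ e * M := by
    intro i hi
    have hid : (i : ℝ) ≤ d := by exact_mod_cast Nat.lt_succ_iff.1 (Finset.mem_range.1 hi)
    have h2 := hC μ M hμ hM _ _ (hx.add_smul hy i)
    rw [← mul_sub, abs_mul]
    have h3 : C * (1 + (R + |(i : ℝ)| * 1)) ^ e * M ≤ C * ((1 + d) * (1 + R)) ^ e * M := by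
      have : (0 : ℝ) ≤ i := Nat.cast_nonneg i
      gcongr
      rw [abs_of_nonneg this]
      nlinarith [mul_nonneg (Nat.cast_nonneg (α := ℝ) d) hR]
    calc _ ≤ (C * ((1 + d) * (1 + R)) ^ e * M) * (C' * ρ) :=
          mul_le_mul (h2.trans h3) (hC' i hi ρ hρ0 hρ) (abs_nonneg _) (by positivity)
      _ = _ := by rw [mul_pow]; ring
  refine (Finset.abs_sum_le_sum_abs _ _).trans ((Finset.sum_le_sum hterm).trans (le_of_eq ?_))
  simp
  ring

/-- The directional derivative at `x` of the extension of a valuation. -/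
def dVal (μ : ConvexBody E → ℝ) (x φ : E → ℝ) : ℝ :=
  ∑ i ∈ Finset.range (polyDeg E + 1),
    extVal μ (x + (i : ℝ) • φ) * (lagr (polyDeg E) i).derivative.eval 0

namespace IsCTV

variable {μ : ConvexBody E → ℝ}

lemma hasDerivAt_extVal (hμ : IsCTV μ) {x φ : E → ℝ} {R S : ℝ} (hx : Nice x R) (hφ : Nice φ S) :
    HasDerivAt (fun t : ℝ => extVal μ (x + t • φ)) (dVal μ x φ) 0 := by
  have h : (fun t : ℝ => extVal μ (x + t • φ)) = fun t => ∑ i ∈ Finset.range (polyDeg E + 1),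
      extVal μ (x + (i : ℝ) • φ) * (lagr (polyDeg E) i).eval t :=
    funext fun t => hμ.extVal_segment hx hφ t
  rw [h]
  exact HasDerivAt.fun_sum fun i _ => (Polynomial.hasDerivAt _ _).const_mul _

lemma dVal_add_smul (hμ : IsCTV μ) {x φ ψ : E → ℝ} {R S T : ℝ} (hx : Nice x R) (hφ : Nice φ S)
    (hψ : Nice ψ T) (c : ℝ) : dVal μ x (φ + c • ψ) = dVal μ x φ + c * dVal μ x ψ := by
  have h1 := hμ.hasDerivAt_extVal hx (hφ.add_smul hψ c)
  set d := polyDeg E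
  have hP : (fun t : ℝ => extVal μ (x + t • (φ + c • ψ))) = fun t : ℝ =>
      ∑ i ∈ Finset.range (d + 1), ∑ j ∈ Finset.range (d + 1),
        extVal μ (x + (i : ℝ) • φ + (j : ℝ) • ψ) * (lagr d j).eval (c * t) *
          (lagr d i).eval t := by
    funext t
    have e1 : x + t • (φ + c • ψ) = (x + (c * t) • ψ) + t • φ := by
      rw [smul_add, smul_smul, mul_comm c t]; abel
    rw [e1, hμ.extVal_segment (hx.add_smul hψ _) hφ]
    refine Finset.sum_congr rfl fun i _ => ?_
    rw [add_right_comm, hμ.extVal_segment (hx.add_smul hφ _) hψ, Finset.sum_mul]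
  rw [hP] at h1
  have h2 : HasDerivAt (fun t : ℝ =>
      ∑ i ∈ Finset.range (d + 1), ∑ j ∈ Finset.range (d + 1),
        extVal μ (x + (i : ℝ) • φ + (j : ℝ) • ψ) * (lagr d j).eval (c * t) *
          (lagr d i).eval t) (∑ i ∈ Finset.range (d + 1), ∑ j ∈ Finset.range (d + 1),
        (extVal μ (x + (i : ℝ) • φ + (j : ℝ) • ψ) * ((lagr d j).derivative.eval (c * 0) * c) *
          (lagr d i).eval 0 + extVal μ (x + (i : ℝ) • φ + (j : ℝ) • ψ) * (lagr d j).eval (c * 0) *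
          (lagr d i).derivative.eval 0)) 0 := by
    refine HasDerivAt.fun_sum fun i _ => HasDerivAt.fun_sum fun j _ => ?_
    refine HasDerivAt.mul (HasDerivAt.const_mul _ ?_) (Polynomial.hasDerivAt _ _)
    have h3 : HasDerivAt (fun t : ℝ => c * t) c 0 := by
      simpa using (hasDerivAt_id (0 : ℝ)).const_mul c
    exact (Polynomial.hasDerivAt (lagr d j) (c * 0)).comp (0 : ℝ) h3
  rw [h1.unique h2]
  simp only [mul_zero, Finset.sum_add_distrib]
  rw [add_comm]
  congr 1
  · refine Finset.sum_congr rfl fun i _ => ?_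
    rw [← Finset.sum_mul, ← hμ.extVal_segment (hx.add_smul hφ _) hψ]
    simp [d]
  · rw [Finset.sum_comm, dVal, Finset.mul_sum]
    refine Finset.sum_congr rfl fun j _ => ?_
    have h4 : ∀ i : ℕ, x + (i : ℝ) • φ + (j : ℝ) • ψ = x + (j : ℝ) • ψ + (i : ℝ) • φ :=
      fun i => by abel
    have h5 := hμ.extVal_segment (hx.add_smul hψ j) hφ 0
    simp only [zero_smul, add_zero] at h5
    rw [h5]
    simp only [h4, Finset.mul_sum, Finset.sum_mul]
    exact Finset.sum_congr rfl fun i _ => by ring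

lemma dVal_congr (μ : ConvexBody E → ℝ) {x y φ ψ : E → ℝ} (hx : ∀ u : E, ‖u‖ = 1 → x u = y u)
    (h : ∀ u : E, ‖u‖ = 1 → φ u = ψ u) : dVal μ x φ = dVal μ y ψ :=
  Finset.sum_congr rfl fun i _ => by
    rw [extVal_congr μ (ψ := y + (i : ℝ) • ψ) fun u hu => by simp [h u hu, hx u hu]]

lemma sum_derivative_lagr (d : ℕ) :
    ∑ i ∈ Finset.range (d + 1), (lagr d i).derivative.eval 0 = 0 := by
  have h : ∀ t : ℝ, ∑ i ∈ Finset.range (d + 1), (lagr d i).eval t = 1 := fun t => by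
    have := eval_eq_sum_lagr (p := (1 : ℝ[X])) (d := d) (by simp) t
    simpa using this.symm
  have h1 : HasDerivAt (fun t : ℝ => ∑ i ∈ Finset.range (d + 1), (lagr d i).eval t)
      (∑ i ∈ Finset.range (d + 1), (lagr d i).derivative.eval 0) 0 :=
    HasDerivAt.fun_sum fun i _ => Polynomial.hasDerivAt _ _
  rw [funext h] at h1
  exact h1.unique (hasDerivAt_const _ _)

lemma dVal_zero (μ : ConvexBody E → ℝ) (x : E → ℝ) : dVal μ x 0 = 0 := by
  simp [dVal, ← Finset.mul_sum, sum_derivative_lagr]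

lemma dVal_smul (hμ : IsCTV μ) {x φ : E → ℝ} {R S : ℝ} (hx : Nice x R) (hφ : Nice φ S) (c : ℝ) :
    dVal μ x (c • φ) = c * dVal μ x φ := by
  have h0 : Nice (0 : E → ℝ) 0 := by simpa using hφ.smul_fun 0
  have := hμ.dVal_add_smul hx h0 hφ c
  simpa [dVal_zero] using this

lemma exists_abs_dVal_le (hμ : IsCTV μ) {x : E → ℝ} {R : ℝ} (hx : Nice x R) :
    ∃ Λ, 0 ≤ Λ ∧ ∀ (φ : E → ℝ) (r : ℝ), Nice φ r → |dVal μ x φ| ≤ Λ * r := by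
  obtain ⟨M, hM⟩ := exists_unitBound hμ.cont
  obtain ⟨C, e, hC0, hC⟩ := exists_abs_extVal_le E
  have hM0 := hM.nonneg
  have hR := hx.nonneg
  refine ⟨∑ i ∈ Finset.range (polyDeg E + 1), (C * (1 + (R + |(i : ℝ)| * 1)) ^ e * M) *
    |(lagr (polyDeg E) i).derivative.eval 0|, by positivity, fun φ r hφ => ?_⟩
  rcases hφ.nonneg.eq_or_lt with rfl | hr
  · have : dVal μ x φ = dVal μ x 0 := dVal_congr μ (fun _ _ => rfl) fun u hu => by
      simpa using hφ.abs_le u hu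
    simp [this, dVal_zero]
  have hy : Nice (r⁻¹ • φ) 1 := by
    have := hφ.smul_fun r⁻¹
    rwa [abs_of_pos (inv_pos.2 hr), inv_mul_cancel₀ hr.ne'] at this
  have h1 : dVal μ x φ = r * dVal μ x (r⁻¹ • φ) := by
    rw [hμ.dVal_smul hx hφ, mul_inv_cancel_left₀ hr.ne']
  rw [h1, abs_mul, abs_of_pos hr, mul_comm]
  refine mul_le_mul_of_nonneg_right ?_ hr.le
  refine (Finset.abs_sum_le_sum_abs _ _).trans (Finset.sum_le_sum fun i _ => ?_)
  rw [abs_mul]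
  exact mul_le_mul_of_nonneg_right (hC μ M hμ hM _ _ (hx.add_smul hy i)) (abs_nonneg _)

lemma dVal_add_of_disjoint_of_nonneg (hμ : IsCTV μ) {x φ ψ : E → ℝ} {R S T : ℝ} (hx : Nice x R)
    (hφ : Nice φ S) (hψ : Nice ψ T) (hφ0 : ∀ u : E, ‖u‖ = 1 → 0 ≤ φ u)
    (hψ0 : ∀ u : E, ‖u‖ = 1 → 0 ≤ ψ u) (h0 : ∀ u : E, ‖u‖ = 1 → φ u * ψ u = 0) :
    dVal μ (x + ψ) φ = dVal μ x φ := by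
  have h1 : ∀ i : ℕ, extVal μ (x + ψ + (i : ℝ) • φ) =
      extVal μ (x + (i : ℝ) • φ) + (extVal μ (x + ψ) - extVal μ x) := by
    intro i
    have h2 := hμ.extVal_max_add_min hx (hφ.smul_fun i) hψ
      (fun u hu => mul_nonneg (Nat.cast_nonneg i) (hφ0 u hu)) hψ0
      (fun u hu => by
        rw [Pi.smul_apply, smul_eq_mul, mul_assoc, h0 u hu, mul_zero])
    rw [add_right_comm]
    linarith
  simp only [dVal, h1, add_mul, Finset.sum_add_distrib, ← Finset.mul_sum, sum_derivative_lagr,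
    mul_zero, add_zero]

lemma dVal_add_of_disjoint (hμ : IsCTV μ) {x φ₁ φ₂ ψ₁ ψ₂ : E → ℝ} {R S₁ S₂ T₁ T₂ : ℝ}
    (hx : Nice x R) (hφ₁ : Nice φ₁ S₁) (hφ₂ : Nice φ₂ S₂) (hψ₁ : Nice ψ₁ T₁) (hψ₂ : Nice ψ₂ T₂)
    (hφ₁0 : ∀ u : E, ‖u‖ = 1 → 0 ≤ φ₁ u) (hφ₂0 : ∀ u : E, ‖u‖ = 1 → 0 ≤ φ₂ u)
    (hψ₁0 : ∀ u : E, ‖u‖ = 1 → 0 ≤ ψ₁ u) (hψ₂0 : ∀ u : E, ‖u‖ = 1 → 0 ≤ ψ₂ u)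
    (h₁₁ : ∀ u : E, ‖u‖ = 1 → φ₁ u * ψ₁ u = 0) (h₁₂ : ∀ u : E, ‖u‖ = 1 → φ₁ u * ψ₂ u = 0)
    (h₂₁ : ∀ u : E, ‖u‖ = 1 → φ₂ u * ψ₁ u = 0) (h₂₂ : ∀ u : E, ‖u‖ = 1 → φ₂ u * ψ₂ u = 0) :
    dVal μ (x + (ψ₁ - ψ₂)) (φ₁ - φ₂) = dVal μ x (φ₁ - φ₂) := by
  have key : ∀ {φ : E → ℝ} {S : ℝ}, Nice φ S → (∀ u : E, ‖u‖ = 1 → 0 ≤ φ u) →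
      (∀ u : E, ‖u‖ = 1 → φ u * ψ₁ u = 0) → (∀ u : E, ‖u‖ = 1 → φ u * ψ₂ u = 0) →
      dVal μ (x + (ψ₁ - ψ₂)) φ = dVal μ x φ := by
    intro φ S hφ h0 h1 h2
    have e1 := hμ.dVal_add_of_disjoint_of_nonneg (hx.sub_fun hψ₂) hφ hψ₁ h0 hψ₁0 h1
    have e2 := hμ.dVal_add_of_disjoint_of_nonneg (hx.sub_fun hψ₂) hφ hψ₂ h0 hψ₂0 h2
    rw [sub_add_cancel] at e2
    rw [e2, ← e1]
    congr 1
    abel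
  have hx' := hx.add_fun (hψ₁.sub_fun hψ₂)
  have e : φ₁ - φ₂ = φ₁ + (-1 : ℝ) • φ₂ := by rw [neg_one_smul, sub_eq_add_neg]
  rw [e, hμ.dVal_add_smul hx' hφ₁ hφ₂, hμ.dVal_add_smul hx hφ₁ hφ₂, key hφ₁ hφ₁0 h₁₁ h₁₂,
    key hφ₂ hφ₂0 h₂₁ h₂₂]

lemma dVal_comp_isometry (hμ : IsCTV μ) {A : E ≃ₗᵢ[ℝ] E}
    (hA : ∀ K L : ConvexBody E, (L : Set E) = A '' K → μ L = μ K) {x φ : E → ℝ} {R S : ℝ}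
    (hx : Nice x R) (hφ : Nice φ S) : dVal μ (x ∘ A) (φ ∘ A) = dVal μ x φ :=
  Finset.sum_congr rfl fun i _ => by
    rw [← hμ.extVal_comp_isometry hA (hx.add_smul hφ i)]; rfl

/-- The mean value theorem for the extension of a valuation. -/
lemma exists_extVal_sub_eq_dVal (hμ : IsCTV μ) {x φ : E → ℝ} {R S : ℝ} (hx : Nice x R)
    (hφ : Nice φ S) : ∃ t ∈ Set.Ioo (0 : ℝ) 1,
      extVal μ (x + φ) - extVal μ x = dVal μ (x + t • φ) φ := by
  have hd : ∀ s : ℝ, HasDerivAt (fun t : ℝ => extVal μ (x + t • φ)) (dVal μ (x + s • φ) φ) s := by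
    intro s
    have h1 := hμ.hasDerivAt_extVal (hx.add_smul hφ s) hφ
    have h2 : HasDerivAt (fun t : ℝ => t - s) 1 s := (hasDerivAt_id s).sub_const s
    have h3 := HasDerivAt.comp s (h₂ := fun t : ℝ => extVal μ (x + s • φ + t • φ))
      (h := fun t : ℝ => t - s) (by simpa using h1) h2
    rw [mul_one] at h3
    refine h3.congr_of_eventuallyEq (Eventually.of_forall fun t => ?_)
    simp only [Function.comp_apply]
    congr 1
    rw [sub_smul]
    abel
  obtain ⟨t, ht, h⟩ := exists_hasDerivAt_eq_slope (fun t : ℝ => extVal μ (x + t • φ))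
    (fun s => dVal μ (x + s • φ) φ) zero_lt_one
    (fun s _ => (hd s).continuousAt.continuousWithinAt) fun s _ => hd s
  exact ⟨t, ht, by simpa using h.symm⟩

end IsCTV

end Derivative

section Jets

open Metric
open scoped RealInnerProductSpace ContDiff

variable {E : Type*} [NormedAddCommGroup E] [InnerProductSpace ℝ E]

lemma Supp.of_tangent {φ : E → ℝ} (h : ∀ u : E, ‖u‖ = 1 → ∃ (G : E) (B : ℝ),
    2 * B ≤ φ u - ⟪G, u⟫ ∧ ∀ w : E, ‖w‖ = 1 → φ u + ⟪G, w - u⟫ - B * ‖w - u‖ ^ 2 ≤ φ w) :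
    Supp φ := by
  intro u hu
  obtain ⟨G, B, hB, hG⟩ := h u hu
  refine ⟨(φ u - ⟪G, u⟫) • u + G, fun w hw => ?_, ?_⟩
  · refine le_trans ?_ (hG w hw)
    have h1 : ‖w - u‖ ^ 2 = 2 - 2 * ⟪u, w⟫ := by
      rw [norm_sub_sq_real, hw, hu, real_inner_comm]; ring
    rw [inner_add_left, real_inner_smul_left, inner_sub_right]
    have h2 := mul_nonneg (sub_nonneg.2 hB) (sq_nonneg ‖w - u‖)
    rw [h1] at h2 ⊢
    linarith
  · rw [inner_add_left, real_inner_smul_left, real_inner_self_eq_norm_sq, hu]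
    ring

/-- The derivatives of `φ` up to order two are bounded by `A` on the unit ball. -/
def JetBound (φ : E → ℝ) (A : ℝ) : Prop :=
  ∀ j ≤ 2, ∀ x : E, ‖x‖ ≤ 1 → ‖iteratedFDeriv ℝ j φ x‖ ≤ A

lemma JetBound.nonneg {φ : E → ℝ} {A : ℝ} (h : JetBound φ A) : 0 ≤ A :=
  (norm_nonneg _).trans (h 0 (by norm_num) 0 (by simp))

lemma JetBound.neg {φ : E → ℝ} {A : ℝ} (h : JetBound φ A) : JetBound (-φ) A := by
  intro j hj x hx
  rw [iteratedFDeriv_neg_apply, norm_neg]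
  exact h j hj x hx

lemma norm_sub_sub_fderiv_le {φ : E → ℝ} (hφ : ContDiff ℝ 2 φ) {A : ℝ} (h : JetBound φ A)
    {u w : E} (hu : ‖u‖ ≤ 1) (hw : ‖w‖ ≤ 1) :
    |φ w - φ u - fderiv ℝ φ u (w - u)| ≤ A * ‖w - u‖ ^ 2 := by
  have hd1 : Differentiable ℝ φ := hφ.differentiable (by norm_num)
  have hd2 : Differentiable ℝ (fderiv ℝ φ) :=
    (hφ.fderiv_right (m := 1) (by norm_num)).differentiable (by norm_num)
  have hlip : ∀ z : E, ‖z‖ ≤ 1 → ‖fderiv ℝ φ z - fderiv ℝ φ u‖ ≤ A * ‖z - u‖ := fun z hz => by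
    refine (convex_closedBall (0 : E) 1).norm_image_sub_le_of_norm_fderiv_le
      (fun x _ => hd2 x) (fun x hx => ?_) (by simpa using hu) (by simpa using hz)
    have := h 2 le_rfl x (by simpa using hx)
    rw [← norm_iteratedFDeriv_one]
    simpa only [norm_iteratedFDeriv_fderiv] using this
  have hconv : Convex ℝ (closedBall (0 : E) 1 ∩ closedBall u ‖w - u‖) :=
    (convex_closedBall _ _).inter (convex_closedBall _ _)
  have := hconv.norm_image_sub_le_of_norm_fderiv_le' (f := φ) (φ := fderiv ℝ φ u)
    (C := A * ‖w - u‖) (x := u) (y := w) (fun x _ => hd1 x) (fun x hx => ?_)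
    ⟨by simpa using hu, by simp⟩ ⟨by simpa using hw, by simp [dist_eq_norm]⟩
  · rw [Real.norm_eq_abs] at this
    linarith [this, sq ‖w - u‖]
  · refine (hlip x (by simpa using hx.1)).trans ?_
    have h2 := hx.2
    rw [mem_closedBall, dist_eq_norm] at h2
    exact mul_le_mul_of_nonneg_left h2 h.nonneg

variable [FiniteDimensional ℝ E]

lemma JetBound.supp_add {φ : E → ℝ} (hφ : ContDiff ℝ 2 φ) {A : ℝ} (h : JetBound φ A) :
    Supp (fun u => φ u + 4 * A) := by
  have := FiniteDimensional.complete ℝ E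
  refine Supp.of_tangent fun u hu => ⟨(InnerProductSpace.toDual ℝ E).symm (fderiv ℝ φ u), A, ?_, ?_⟩
  · have h0 := h 0 (by norm_num) u hu.le
    have h1 := h 1 (by norm_num) u hu.le
    rw [norm_iteratedFDeriv_zero, Real.norm_eq_abs] at h0
    rw [norm_iteratedFDeriv_one] at h1
    have h2 := (fderiv ℝ φ u).le_opNorm u
    rw [hu, mul_one, Real.norm_eq_abs] at h2
    rw [InnerProductSpace.toDual_symm_apply]
    linarith [(abs_le.1 h0).1, (abs_le.1 h2).2]
  · intro w hw
    rw [InnerProductSpace.toDual_symm_apply]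
    linarith [(abs_le.1 (norm_sub_sub_fderiv_le hφ h hu.le hw.le)).1]

lemma JetBound.nice {φ : E → ℝ} (hφ : ContDiff ℝ 2 φ) {A : ℝ} (h : JetBound φ A) :
    Nice φ (4 * A) := by
  refine ⟨h.supp_add hφ, (h.neg.supp_add hφ.neg).congr fun u _ => ?_, fun u hu => ?_⟩
  · ring
  · have h0 := h 0 (by norm_num) u hu.le
    rw [norm_iteratedFDeriv_zero, Real.norm_eq_abs] at h0
    linarith [h.nonneg]

lemma exists_jetBound {φ : E → ℝ} (hφ : ContDiff ℝ 2 φ) : ∃ A, JetBound φ A := by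
  have key : ∀ j ∈ Finset.range 3, ∃ A, 0 ≤ A ∧ ∀ x : E, ‖x‖ ≤ 1 → ‖iteratedFDeriv ℝ j φ x‖ ≤ A := by
    intro j hj
    have hc : Continuous (iteratedFDeriv ℝ j φ) :=
      hφ.continuous_iteratedFDeriv (m := j) (by
        exact_mod_cast Nat.lt_succ_iff.1 (Finset.mem_range.1 hj))
    obtain ⟨A, hA⟩ := (isCompact_closedBall (0 : E) 1).exists_bound_of_continuousOn hc.continuousOn
    exact ⟨max A 0, le_max_right _ _, fun x hx => (hA x (by simpa using hx)).trans (le_max_left _ _)⟩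
  choose! A hA0 hA using key
  refine ⟨∑ j ∈ Finset.range 3, A j, fun j hj x hx => ?_⟩
  have hj' : j ∈ Finset.range 3 := Finset.mem_range.2 (by omega)
  exact (hA j hj' x hx).trans (Finset.single_le_sum hA0 hj')

lemma exists_nice_of_contDiff {φ : E → ℝ} (hφ : ContDiff ℝ 2 φ) : ∃ R, Nice φ R := by
  obtain ⟨A, hA⟩ := exists_jetBound hφ
  exact ⟨_, hA.nice hφ⟩

end Jets

section SmoothApproximation

open Metric Filter Topology
open scoped RealInnerProductSpace ContDiff Convolution

variable {E : Type*} [NormedAddCommGroup E] [InnerProductSpace ℝ E]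

lemma ConvexOn.add_fderiv_le {g : E → ℝ} (hg : ConvexOn ℝ Set.univ g) {x : E}
    (hd : DifferentiableAt ℝ g x) (y : E) : g x + fderiv ℝ g x (y - x) ≤ g y := by
  have hline : HasDerivAt (fun t : ℝ => x + t • (y - x)) (y - x) 0 := by
    simpa using ((hasDerivAt_id (0 : ℝ)).smul_const (y - x)).const_add x
  have hd' : HasFDerivAt g (fderiv ℝ g x) (x + (0 : ℝ) • (y - x)) := by
    simpa using hd.hasFDerivAt
  have h1 := hd'.comp_hasDerivAt (0 : ℝ) hline
  have h2 : ConvexOn ℝ Set.univ (fun t : ℝ => g (x + t • (y - x))) := by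
    refine ⟨convex_univ, fun s _ t _ a b ha hb hab => ?_⟩
    have := hg.2 (Set.mem_univ (x + s • (y - x))) (Set.mem_univ (x + t • (y - x))) ha hb hab
    refine le_of_eq_of_le ?_ this
    rw [smul_add, smul_add, add_add_add_comm, ← add_smul, hab, one_smul, smul_smul, smul_smul,
      ← add_smul, smul_eq_mul, smul_eq_mul]
  have h3 := h2.le_slope_of_hasDerivAt (Set.mem_univ 0) (Set.mem_univ 1) zero_lt_one h1
  simp only [slope, vsub_eq_sub, sub_zero, inv_one, one_smul, zero_smul, add_zero,
    add_sub_cancel] at h3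
  linarith

variable [FiniteDimensional ℝ E]

lemma suppFun_add_le {K : Set E} (hK : IsCompact K) (hne : K.Nonempty) (x y : E) :
    suppFun K (x + y) ≤ suppFun K x + suppFun K y :=
  suppFun_le hne fun z hz => by
    rw [inner_add_right]
    exact add_le_add (inner_le_suppFun hK hz x) (inner_le_suppFun hK hz y)

lemma suppFun_smul {K : Set E} (hK : IsCompact K) (hne : K.Nonempty) {c : ℝ} (hc : 0 ≤ c) (x : E) :
    suppFun K (c • x) = c * suppFun K x := by
  obtain ⟨z, hz, h⟩ := exists_eq_suppFun hK hne x
  refine le_antisymm (suppFun_le hne fun w hw => ?_) ?_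
  · rw [real_inner_smul_right]
    exact mul_le_mul_of_nonneg_left (inner_le_suppFun hK hw x) hc
  · rw [← h, ← real_inner_smul_right]
    exact inner_le_suppFun hK hz _

lemma exists_suppFun_lipschitz {K : Set E} (hK : IsCompact K) (hne : K.Nonempty) :
    ∃ L, 0 < L ∧ ∀ x y : E, |suppFun K x - suppFun K y| ≤ L * ‖x - y‖ := by
  obtain ⟨L, hL0, hL⟩ := hK.isBounded.exists_pos_norm_le
  have key : ∀ x y : E, suppFun K x - suppFun K y ≤ L * ‖x - y‖ := by
    intro x y
    have h1 := suppFun_add_le hK hne (x - y) y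
    rw [sub_add_cancel] at h1
    have h2 : suppFun K (x - y) ≤ L * ‖x - y‖ := suppFun_le hne fun z hz =>
      (real_inner_le_norm _ _).trans (mul_le_mul_of_nonneg_right (hL z hz) (norm_nonneg _))
    linarith
  refine ⟨L, hL0, fun x y => abs_sub_le_iff.2 ⟨key x y, ?_⟩⟩
  rw [norm_sub_rev]
  exact key y x

lemma convexOn_suppFun {K : Set E} (hK : IsCompact K) (hne : K.Nonempty) :
    ConvexOn ℝ Set.univ (suppFun K) := by
  refine ⟨convex_univ, fun x _ y _ a b ha hb _ => ?_⟩
  rw [smul_eq_mul, smul_eq_mul, ← suppFun_smul hK hne ha, ← suppFun_smul hK hne hb]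
  exact suppFun_add_le hK hne _ _

lemma supp_of_convexOn_of_approx {K : Set E} (hK : IsCompact K) (hne : K.Nonempty) {g : E → ℝ}
    (hg : ConvexOn ℝ Set.univ g) (hd : Differentiable ℝ g) {η : ℝ}
    (h : ∀ x, |g x - suppFun K x| ≤ η) : Supp (fun u => g u + 3 * η) := by
  have := FiniteDimensional.complete ℝ E
  refine Supp.of_tangent fun u hu => ⟨(InnerProductSpace.toDual ℝ E).symm (fderiv ℝ g u), 0, ?_, ?_⟩
  · rw [InnerProductSpace.toDual_symm_apply]
    have h1 := hg.add_fderiv_le (hd u) ((2 : ℝ) • u)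
    have h2 : (2 : ℝ) • u - u = u := by rw [two_smul, add_sub_cancel_right]
    rw [h2] at h1
    have h3 := abs_le.1 (h u)
    have h4 := abs_le.1 (h ((2 : ℝ) • u))
    rw [suppFun_smul hK hne zero_le_two] at h4
    linarith [h3.1, h4.2]
  · intro w hw
    rw [InnerProductSpace.toDual_symm_apply]
    have := hg.add_fderiv_le (hd u) w
    linarith

lemma exists_smooth_supp_approx [MeasurableSpace E] [BorelSpace E] {K : Set E} (hK : IsCompact K)
    (hne : K.Nonempty) {δ : ℝ} (hδ : 0 < δ) :
    ∃ h : E → ℝ, ContDiff ℝ ∞ h ∧ Supp h ∧ ∀ u : E, |h u - suppFun K u| ≤ δ := by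
  obtain ⟨L, hL0, hL⟩ := exists_suppFun_lipschitz hK hne
  set r : ℝ := δ / (4 * L)
  have hr : 0 < r := by positivity
  let ρ : ContDiffBump (0 : E) := ⟨r / 2, r, by positivity, by linarith⟩
  have hLip : LipschitzWith ⟨L, hL0.le⟩ (suppFun K) := LipschitzWith.of_dist_le_mul fun x y => by
    rw [Real.dist_eq, dist_eq_norm]; exact hL x y
  have hcont : Continuous (suppFun K) := hLip.continuous
  set g : E → ℝ := ρ.normed volume ⋆[ContinuousLinearMap.lsmul ℝ ℝ, volume] suppFun K
  have hgd : ContDiff ℝ ∞ g := ρ.hasCompactSupport_normed.contDiff_convolution_left _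
    ρ.contDiff_normed hcont.locallyIntegrable
  have happ : ∀ x, |g x - suppFun K x| ≤ L * r := fun x => by
    rw [← Real.dist_eq]
    refine ρ.dist_normed_convolution_le hcont.aestronglyMeasurable fun y hy => ?_
    rw [Real.dist_eq]
    refine (hL y x).trans (mul_le_mul_of_nonneg_left ?_ hL0.le)
    rw [← dist_eq_norm]
    exact (mem_ball.1 hy).le
  have hint : ∀ x, Integrable (fun t => ρ.normed volume t • suppFun K (x - t)) := fun x =>
    Continuous.integrable_of_hasCompactSupport
      (ρ.continuous_normed.smul (hcont.comp (continuous_const.sub continuous_id)))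
      (ρ.hasCompactSupport_normed.smul_right)
  have hconv : ConvexOn ℝ Set.univ g := by
    refine ⟨convex_univ, fun x _ y _ a b ha hb hab => ?_⟩
    simp only [g, convolution_def, ContinuousLinearMap.lsmul_apply]
    rw [← integral_smul, ← integral_smul, ← integral_add (f := fun t => a • ρ.normed volume t • suppFun K (x - t))
      (g := fun t => b • ρ.normed volume t • suppFun K (y - t)) ((hint x).smul a) ((hint y).smul b)]
    refine integral_mono (hint _) (((hint x).smul a).add ((hint y).smul b)) fun t => ?_
    have h1 : a • x + b • y - t = a • (x - t) + b • (y - t) := by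
      rw [smul_sub, smul_sub, sub_add_sub_comm, ← add_smul, hab, one_smul]
    have h2 := (convexOn_suppFun hK hne).2 (Set.mem_univ (x - t)) (Set.mem_univ (y - t)) ha hb hab
    have h3 := mul_le_mul_of_nonneg_left h2 (ρ.nonneg_normed (μ := volume) t)
    simp only [smul_eq_mul, h1] at h3 ⊢
    linarith
  refine ⟨fun u => g u + 3 * (L * r), hgd.add contDiff_const,
    supp_of_convexOn_of_approx hK hne hconv (hgd.differentiable (by simp)) happ, fun u => ?_⟩
  have h4 : L * r = δ / 4 := by simp only [r]; field_simp
  have := abs_le.1 (happ u)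
  rw [h4] at this ⊢
  exact abs_le.2 ⟨by linarith, by linarith⟩

end SmoothApproximation

section Cutoff

open Metric Set
open scoped ContDiff

variable {E : Type*} [NormedAddCommGroup E] [InnerProductSpace ℝ E]

lemma norm_iteratedFDeriv_mul_le_of_le {f g : E → ℝ} (hf : ContDiff ℝ 2 f) (hg : ContDiff ℝ 2 g)
    {x : E} {a b : ℝ} (ha : ∀ j ≤ 2, ‖iteratedFDeriv ℝ j f x‖ ≤ a)
    (hb : ∀ j ≤ 2, ‖iteratedFDeriv ℝ j g x‖ ≤ b) {j : ℕ} (hj : j ≤ 2) :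
    ‖iteratedFDeriv ℝ j (f * g) x‖ ≤ 4 * a * b := by
  have ha0 : 0 ≤ a := (norm_nonneg _).trans (ha 0 (by norm_num))
  have hb0 : 0 ≤ b := (norm_nonneg _).trans (hb 0 (by norm_num))
  have h := norm_iteratedFDeriv_mul_le hf hg x
    (n := j) (N := 2) (by exact_mod_cast hj)
  refine h.trans ?_
  have h2 : ∑ i ∈ Finset.range (j + 1), (j.choose i : ℝ) * ‖iteratedFDeriv ℝ i f x‖ *
      ‖iteratedFDeriv ℝ (j - i) g x‖ ≤ ∑ i ∈ Finset.range (j + 1), (j.choose i : ℝ) * a * b := by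
    refine Finset.sum_le_sum fun i hi => ?_
    rw [Finset.mem_range] at hi
    gcongr
    · exact ha i (by omega)
    · exact hb _ (by omega)
  refine h2.trans ?_
  rw [← Finset.sum_mul, ← Finset.sum_mul]
  gcongr
  have := Nat.sum_range_choose j
  rw [← Nat.cast_sum, this]
  push_cast
  interval_cases j <;> norm_num

lemma JetBound.mul {f g : E → ℝ} (hf : ContDiff ℝ 2 f) (hg : ContDiff ℝ 2 g) {a b : ℝ}
    (ha : JetBound f a) (hb : JetBound g b) : JetBound (f * g) (4 * a * b) :=
  fun _ hj x hx => norm_iteratedFDeriv_mul_le_of_le hf hg (fun i hi => ha i hi x hx)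
    (fun i hi => hb i hi x hx) hj

lemma JetBound.mono {f : E → ℝ} {a b : ℝ} (h : JetBound f a) (hab : a ≤ b) : JetBound f b :=
  fun j hj x hx => (h j hj x hx).trans hab

/-- A smooth radial bump function at the origin. -/
def bump (x : E) : ℝ := Real.smoothTransition (2 - ‖x‖ ^ 2)

lemma contDiff_bump : ContDiff ℝ ∞ (bump : E → ℝ) :=
  Real.smoothTransition.contDiff.comp (contDiff_const.sub (contDiff_norm_sq ℝ))

lemma bump_eq_zero {x : E} (h : 2 ≤ ‖x‖ ^ 2) : bump x = 0 :=
  Real.smoothTransition.zero_of_nonpos (by linarith)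

/-- A bump function of width `ε` centered at `y`. -/
def cutoff (ε : ℝ) (y x : E) : ℝ := bump (ε⁻¹ • (x - y))

lemma contDiff_cutoff (ε : ℝ) (y : E) : ContDiff ℝ ∞ (cutoff ε y) :=
  contDiff_bump.comp (contDiff_const.smul (contDiff_id.sub contDiff_const))

lemma cutoff_nonneg (ε : ℝ) (y x : E) : 0 ≤ cutoff ε y x := Real.smoothTransition.nonneg _

lemma cutoff_le_one (ε : ℝ) (y x : E) : cutoff ε y x ≤ 1 := Real.smoothTransition.le_one _

lemma norm_inv_smul_sub_sq {ε : ℝ} (x y : E) : ‖ε⁻¹ • (x - y)‖ ^ 2 = ‖x - y‖ ^ 2 / ε ^ 2 := by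
  rw [norm_smul, mul_pow, norm_inv, inv_pow, Real.norm_eq_abs, sq_abs]; ring

lemma cutoff_eq_zero {ε : ℝ} (hε : 0 < ε) {x y : E} (h : 2 * ε ^ 2 ≤ ‖x - y‖ ^ 2) :
    cutoff ε y x = 0 :=
  bump_eq_zero (by rw [norm_inv_smul_sub_sq, le_div_iff₀ (by positivity)]; exact h)

lemma cutoff_eq_one {ε : ℝ} (hε : 0 < ε) {x y : E} (h : ‖x - y‖ ^ 2 ≤ ε ^ 2) :
    cutoff ε y x = 1 := by
  have : ‖ε⁻¹ • (x - y)‖ ^ 2 ≤ 1 := by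
    rw [norm_inv_smul_sub_sq, div_le_one (by positivity)]; exact h
  exact Real.smoothTransition.one_of_one_le (by linarith)

lemma cutoff_comp_isometry (ε : ℝ) (A : E ≃ₗᵢ[ℝ] E) (y x : E) :
    cutoff ε (A y) (A x) = cutoff ε y x := by
  unfold cutoff bump
  rw [← map_sub, ← map_smul, A.norm_map]

lemma cutoff_mul_one_sub {ε : ℝ} (hε : 0 < ε) (x y : E) :
    cutoff ε y x * (1 - cutoff (2 * ε) y x) = 0 := by
  rcases le_total (2 * ε ^ 2) (‖x - y‖ ^ 2) with h | h
  · rw [cutoff_eq_zero hε h, zero_mul]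
  · rw [cutoff_eq_one (by positivity : 0 < 2 * ε) (by nlinarith), sub_self, mul_zero]

lemma iteratedFDeriv_cutoff_eq_zero {ε : ℝ} (hε : 0 < ε) {x y : E} (h : 2 * ε < ‖x - y‖) (j : ℕ) :
    iteratedFDeriv ℝ j (cutoff ε y) x = 0 := by
  have h1 : cutoff ε y =ᶠ[nhds x] fun _ => (0 : ℝ) := by
    have ho : IsOpen {z : E | 2 * ε < ‖z - y‖} :=
      isOpen_lt continuous_const (continuous_id.sub continuous_const).norm
    filter_upwards [ho.mem_nhds h] with z hz
    refine cutoff_eq_zero hε ?_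
    have hz' : 2 * ε < ‖z - y‖ := hz
    nlinarith
  rw [(h1.iteratedFDeriv ℝ j).eq_of_nhds]
  simp

lemma hasCompactSupport_cutoff [FiniteDimensional ℝ E] {ε : ℝ} (hε : 0 < ε) (y : E) :
    HasCompactSupport (cutoff ε y) := by
  have : ProperSpace E := FiniteDimensional.proper_real E
  refine HasCompactSupport.of_support_subset_isCompact (isCompact_closedBall y (2 * ε)) fun x hx => ?_
  rw [mem_closedBall, dist_eq_norm]
  by_contra! h
  exact hx (cutoff_eq_zero hε (by nlinarith))

lemma cutoff_eq_comp_sub (ε : ℝ) (y : E) : cutoff ε y = fun x => cutoff ε 0 (x - y) := by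
  funext x; simp [cutoff]

variable (E) in
lemma exists_norm_iteratedFDeriv_cutoff_le [FiniteDimensional ℝ E] :
    ∃ C, 1 ≤ C ∧ ∀ ε : ℝ, 0 < ε → ε ≤ 1 → ∀ (y x : E), ∀ j ≤ 2,
      ‖iteratedFDeriv ℝ j (cutoff ε y) x‖ ≤ C * (ε⁻¹) ^ 2 := by
  have : ProperSpace E := FiniteDimensional.proper_real E
  have h1 : ∀ j ∈ Finset.range 3, ∃ C, 0 ≤ C ∧ ∀ x : E, ‖iteratedFDeriv ℝ j (cutoff 1 (0 : E)) x‖ ≤ C := by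
    intro j _
    have hc : Continuous (iteratedFDeriv ℝ j (cutoff 1 (0 : E))) :=
      (contDiff_cutoff 1 0).continuous_iteratedFDeriv (by exact_mod_cast le_top)
    obtain ⟨C, hC⟩ := ((hasCompactSupport_cutoff one_pos (0 : E)).iteratedFDeriv
      (𝕜 := ℝ) j).exists_bound_of_continuous hc
    exact ⟨C, (norm_nonneg _).trans (hC 0), hC⟩
  choose! C hC0 hC using h1
  refine ⟨1 + ∑ j ∈ Finset.range 3, C j, by linarith [Finset.sum_nonneg hC0],
    fun ε hε hε1 y x j hj => ?_⟩
  have hj' : j ∈ Finset.range 3 := by rw [Finset.mem_range]; omega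
  have he : cutoff ε y = fun z => (cutoff 1 (0 : E) ∘ (ε⁻¹ • ContinuousLinearMap.id ℝ E)) (z - y) := by
    funext z; simp [cutoff]
  have h1 : 1 ≤ ε⁻¹ := (one_le_inv₀ hε).2 hε1
  rw [he, iteratedFDeriv_comp_sub, ContinuousLinearMap.iteratedFDeriv_comp_right _
    (contDiff_cutoff 1 (0 : E)) _ (by exact_mod_cast le_top)]
  refine (ContinuousMultilinearMap.norm_compContinuousLinearMap_le _ _).trans ?_
  have hn : ‖ε⁻¹ • ContinuousLinearMap.id ℝ E‖ ≤ ε⁻¹ := by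
    rw [norm_smul, Real.norm_eq_abs, abs_of_pos (by positivity)]
    exact mul_le_of_le_one_right (by positivity) ContinuousLinearMap.norm_id_le
  refine mul_le_mul ?_ ?_ (Finset.prod_nonneg fun _ _ => norm_nonneg _)
    (by linarith [Finset.sum_nonneg hC0])
  · have := Finset.single_le_sum hC0 hj'
    exact (hC j hj' _).trans (by linarith)
  · rw [Finset.prod_const, Finset.card_univ, Fintype.card_fin]
    exact (pow_le_pow_left₀ (norm_nonneg _) hn _).trans (pow_le_pow_right₀ h1 hj)

lemma exists_norm_iteratedFDeriv_cutoff_sub_le [FiniteDimensional ℝ E] {ε : ℝ} (hε : 0 < ε)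
    {η : ℝ} (hη : 0 < η) : ∃ δ > 0, ∀ y z : E, ‖y - z‖ < δ →
      JetBound (cutoff ε y - cutoff ε z) η := by
  have : ProperSpace E := FiniteDimensional.proper_real E
  have h1 : ∀ j ∈ Finset.range 3, ∃ δ > 0, ∀ y z : E, dist y z < δ →
      dist (iteratedFDeriv ℝ j (cutoff ε (0 : E)) y) (iteratedFDeriv ℝ j (cutoff ε (0 : E)) z) < η := by
    intro j _
    have hc : Continuous (iteratedFDeriv ℝ j (cutoff ε (0 : E))) :=
      (contDiff_cutoff ε 0).continuous_iteratedFDeriv (by exact_mod_cast le_top)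
    exact Metric.uniformContinuous_iff.1 (((hasCompactSupport_cutoff hε (0 : E)).iteratedFDeriv
      (𝕜 := ℝ) j).uniformContinuous_of_continuous hc) η hη
  choose! δ hδ0 hδ using h1
  have hne : (Finset.range 3).Nonempty := ⟨0, by simp⟩
  refine ⟨(Finset.range 3).inf' hne δ, (Finset.lt_inf'_iff hne).2 hδ0, fun y z hyz j hj x _ => ?_⟩
  have hj' : j ∈ Finset.range 3 := by rw [Finset.mem_range]; omega
  rw [iteratedFDeriv_sub_apply ((contDiff_cutoff ε y).contDiffAt.of_le (by exact_mod_cast le_top))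
    ((contDiff_cutoff ε z).contDiffAt.of_le (by exact_mod_cast le_top)), cutoff_eq_comp_sub ε y,
    cutoff_eq_comp_sub ε z, iteratedFDeriv_comp_sub, iteratedFDeriv_comp_sub, ← dist_eq_norm]
  refine (hδ j hj' _ _ ?_).le
  rw [dist_sub_left, dist_eq_norm]
  exact hyz.trans_le (Finset.inf'_le _ hj')

end Cutoff

section Averaging

open Metric Set
open scoped ContDiff

variable {E : Type*} [NormedAddCommGroup E] [InnerProductSpace ℝ E] [FiniteDimensional ℝ E]

lemma Supp.integral {α : Type*} {m : MeasurableSpace α} {ν : Measure α} {F : α → E → ℝ}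
    (hF : ∀ᵐ a ∂ν, Supp (F a)) (hi : ∀ u, Integrable (fun a => F a u) ν) :
    Supp (fun u => ∫ a, F a u ∂ν) := by
  refine Supp.of_subadditive fun x y => ?_
  simp only [← integral_const_mul]
  rw [← integral_add ((hi _).const_mul _) ((hi _).const_mul _)]
  refine integral_mono_ae ((hi _).const_mul _)
    (((hi _).const_mul _).add ((hi _).const_mul _)) ?_
  filter_upwards [hF] with a ha using ha.subadditive x y

lemma Nice.integral {α : Type*} {m : MeasurableSpace α} {ν : Measure α} [IsFiniteMeasure ν]
    {F : α → E → ℝ} {r : ℝ} (hF : ∀ᵐ a ∂ν, Nice (F a) r)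
    (hi : ∀ u, Integrable (fun a => F a u) ν) :
    Nice (fun u => ∫ a, F a u ∂ν) (ν.real univ * r) := by
  refine ⟨?_, ?_, fun u hu => ?_⟩
  · refine (Supp.integral (F := fun a u => F a u + r) (hF.mono fun a ha => ha.add)
      fun u => (hi u).add (integrable_const r)).congr fun u _ => ?_
    rw [integral_add (hi u) (integrable_const r)]; simp
  · refine (Supp.integral (F := fun a u => r - F a u) (hF.mono fun a ha => ha.sub)
      fun u => (integrable_const r).sub (hi u)).congr fun u _ => ?_
    rw [integral_sub (integrable_const r) (hi u)]; simp
  · have := norm_integral_le_of_norm_le_const (μ := ν) (f := fun a => F a u) (C := r)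
      (hF.mono fun a ha => ha.abs_le u hu)
    rw [mul_comm]; exact this

variable [Nontrivial E]

lemma IsCTV.dVal_sum {μ : ConvexBody E → ℝ} (hμ : IsCTV μ) {x : E → ℝ} {R : ℝ} (hx : Nice x R)
    {ι : Type*} (s : Finset ι) {f : ι → E → ℝ} {S : ℝ} (hf : ∀ i ∈ s, Nice (f i) S) (c : ι → ℝ) :
    (∃ T, Nice (∑ i ∈ s, c i • f i) T) ∧
      dVal μ x (∑ i ∈ s, c i • f i) = ∑ i ∈ s, c i * dVal μ x (f i) := by
  classical
  induction s using Finset.induction_on with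
  | empty =>
    refine ⟨⟨0, ?_⟩, by simp [IsCTV.dVal_zero]⟩
    simpa using hx.smul_fun 0
  | insert a s ha ih =>
    obtain ⟨⟨T, hT⟩, h⟩ := ih fun i hi => hf i (Finset.mem_insert_of_mem hi)
    have h1 := hf a (Finset.mem_insert_self a s)
    simp only [Finset.sum_insert ha]
    refine ⟨⟨_, (h1.smul_fun (c a)).add_fun hT⟩, ?_⟩
    rw [add_comm, hμ.dVal_add_smul hx hT h1, h, add_comm]

lemma exists_norm_sub_lt_of_isCompact {S : Set E} (hS : IsCompact S) (hne : S.Nonempty) {δ : ℝ}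
    (hδ : 0 < δ) : ∃ (e : ℕ → E) (N : ℕ), (∀ k, e k ∈ S) ∧ ∀ y ∈ S, ∃ k ≤ N, ‖e k - y‖ < δ := by
  obtain ⟨t, htS, hfin, ht⟩ := hS.finite_cover_balls hδ
  have htne : t.Nonempty := by
    obtain ⟨y, hy⟩ := hne
    obtain ⟨z, hz, -⟩ := mem_iUnion₂.1 (ht hy)
    exact ⟨z, hz⟩
  obtain ⟨e, he⟩ := hfin.countable.exists_eq_range htne
  have h1 : ∀ v ∈ t, ∃ k, e k = v := fun v hv => by rw [he] at hv; exact hv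
  choose! k hk using h1
  refine ⟨e, hfin.toFinset.sup k, fun i => htS (he ▸ mem_range_self i), fun y hy => ?_⟩
  obtain ⟨z, hz, hyz⟩ := mem_iUnion₂.1 (ht hy)
  refine ⟨k z, Finset.le_sup (f := k) (hfin.mem_toFinset.2 hz), ?_⟩
  rw [hk z hz, ← dist_eq_norm, dist_comm]
  exact hyz

variable (E) in
/-- A closed spherical shell. -/
def shell : Set E := {y | 1 / 2 ≤ ‖y‖ ∧ ‖y‖ ≤ 1}

variable [MeasurableSpace E] [BorelSpace E]

variable (E) in
lemma measurableSet_shell : MeasurableSet (shell E) :=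
  ((isClosed_le continuous_const continuous_norm).inter
    (isClosed_le continuous_norm continuous_const)).measurableSet

variable (E) in
lemma volume_shell_lt_top : volume (shell E) < (⊤ : ℝ≥0∞) := by
  have : ProperSpace E := FiniteDimensional.proper_real E
  refine (measure_mono fun y hy => ?_).trans_lt
    (isCompact_closedBall (0 : E) 1).measure_lt_top
  simpa using hy.2

lemma measurable_normalize : Measurable fun y : E => ‖y‖⁻¹ • y :=
  (measurable_norm.inv).smul measurable_id

lemma continuous_cutoff_center (ε : ℝ) (u : E) : Continuous fun y => cutoff ε y u :=
  contDiff_bump.continuous.comp ((continuous_const.sub continuous_id).const_smul ε⁻¹)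

lemma integrable_cutoff {α : Type*} {m : MeasurableSpace α} {ν : Measure α} [IsFiniteMeasure ν]
    {f : α → E} (hf : Measurable f) (ε : ℝ) (u : E) :
    Integrable (fun a => cutoff ε (f a) u) ν := by
  refine Integrable.of_bound
    ((continuous_cutoff_center ε u).measurable.comp hf).aestronglyMeasurable 1
    (Filter.Eventually.of_forall fun a => ?_)
  rw [Real.norm_eq_abs, abs_of_nonneg (cutoff_nonneg _ _ _)]
  exact cutoff_le_one _ _ _

lemma IsCTV.mul_abs_dVal_le {μ : ConvexBody E → ℝ} (hμ : IsCTV μ) {x φ : E → ℝ} {R : ℝ}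
    (hx : Nice x R) (hφ : ContDiff ℝ ∞ φ) {ε s κ : ℝ} (hε : 0 < ε)
    (hs : ∀ y : E, ‖y‖ = 1 → |dVal μ x (cutoff ε y * φ)| ≤ s)
    (hκ : ∀ u : E, ‖u‖ = 1 → ∫ y in shell E, cutoff ε (‖y‖⁻¹ • y) u = κ) :
    |κ| * |dVal μ x φ| ≤ volume.real (shell E) * s := by
  have : ProperSpace E := FiniteDimensional.proper_real E
  have hφ2 : ContDiff ℝ 2 φ := contDiff_infty.1 hφ 2
  have hc2 : ∀ y : E, ContDiff ℝ 2 (cutoff ε y) := fun y =>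
    contDiff_infty.1 (contDiff_cutoff ε y) 2
  obtain ⟨A, hA⟩ := exists_jetBound hφ2
  obtain ⟨S, hS⟩ := exists_nice_of_contDiff hφ2
  obtain ⟨Λ, hΛ0, hΛ⟩ := hμ.exists_abs_dVal_le hx
  obtain ⟨C, hC1, hC⟩ := exists_norm_iteratedFDeriv_cutoff_le E
  set ν : Measure E := volume.restrict (shell E) with hν
  have hfinite : IsFiniteMeasure ν := ⟨by simpa [hν] using volume_shell_lt_top E⟩
  set V := ν.real univ with hV
  have hVe : V = volume.real (shell E) := by simp [hV, hν, measureReal_def]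
  have hV0 : 0 ≤ V := measureReal_nonneg
  have hA0 := hA.nonneg
  refine le_of_forall_pos_le_add fun η' hη' => ?_
  set D := Λ * (V * (4 * (4 * 1 * A)))
  have hD0 : 0 ≤ D := by positivity
  obtain ⟨η, hη, hηD⟩ : ∃ η : ℝ, 0 < η ∧ η * D ≤ η' := by
    refine ⟨η' / (D + 1), by positivity, ?_⟩
    rw [div_mul_eq_mul_div, div_le_iff₀ (by positivity)]
    nlinarith
  obtain ⟨δ, hδ, hcl⟩ := exists_norm_iteratedFDeriv_cutoff_sub_le (E := E) hε hη
  obtain ⟨u₀, hu₀⟩ := exists_norm_eq E (zero_le_one (α := ℝ))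
  obtain ⟨e, N, heS, hnet⟩ := exists_norm_sub_lt_of_isCompact (isCompact_sphere (0 : E) 1)
    ⟨u₀, by simpa using hu₀⟩ hδ
  have he1 : ∀ k, ‖e k‖ = 1 := fun k => by simpa using heS k
  set hat : E → E := fun y => ‖y‖⁻¹ • y with hhat
  set ind : E → ℕ := fun y => SimpleFunc.nearestPtInd e N (hat y) with hind
  have hindm : Measurable ind :=
    (SimpleFunc.nearestPtInd e N).measurable.comp measurable_normalize
  have hindN : ∀ y, ind y ≤ N := fun y => SimpleFunc.nearestPtInd_le e N _
  have hclose : ∀ y ∈ shell E, ‖hat y - e (ind y)‖ < δ := by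
    intro y hy
    have hy0 : ‖y‖ ≠ 0 := by have := hy.1; positivity
    obtain ⟨k, hk, hk'⟩ := hnet (hat y) (by simp [hhat, norm_smul, hy0])
    have h1 := SimpleFunc.edist_nearestPt_le e (hat y) hk
    have h2 : edist (e (ind y)) (hat y) ≤ edist (e k) (hat y) := by
      simpa [SimpleFunc.nearestPt, hind] using h1
    rw [edist_dist, edist_dist, ENNReal.ofReal_le_ofReal_iff dist_nonneg] at h2
    rw [← dist_eq_norm, dist_comm]
    exact h2.trans_lt (by rwa [dist_eq_norm])
  set w : ℕ → ℝ := fun k => ν.real (ind ⁻¹' {k}) with hw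
  have hw0 : ∀ k, 0 ≤ w k := fun k => measureReal_nonneg
  have hsum : ∀ c : ℕ → ℝ, ∫ y, c (ind y) ∂ν = ∑ k ∈ Finset.range (N + 1), w k * c k := by
    intro c
    have h1 : (fun y => c (ind y)) = fun y => ∑ k ∈ Finset.range (N + 1),
        (ind ⁻¹' {k}).indicator (fun _ => c k) y := by
      funext y
      rw [Finset.sum_eq_single (ind y)]
      · simp
      · intro k _ hk
        exact indicator_of_notMem (fun h => hk (by simpa using h.symm)) _
      · intro h
        exact absurd (Finset.mem_range.2 (Nat.lt_succ_of_le (hindN y))) h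
    rw [h1, integral_finsetSum]
    · refine Finset.sum_congr rfl fun k _ => ?_
      rw [integral_indicator_const _ (hindm (measurableSet_singleton k)), smul_eq_mul]
    · intro k _
      exact (integrable_const _).indicator (hindm (measurableSet_singleton k))
  have hsumw : ∑ k ∈ Finset.range (N + 1), w k = V := by
    have := hsum fun _ => 1
    simp only [integral_const, smul_eq_mul, mul_one] at this
    rw [← this]
  have hcn : ∀ k, ∃ T, Nice (cutoff ε (e k) * φ) T := fun k =>
    exists_nice_of_contDiff ((hc2 _).mul hφ2)
  choose T hT using hcn
  set T' := ∑ k ∈ Finset.range (N + 1), T k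
  have hT' : ∀ k ∈ Finset.range (N + 1), Nice (cutoff ε (e k) * φ) T' := fun k hk =>
    (hT k).mono (Finset.single_le_sum (f := T) (fun i _ => (hT i).nonneg) hk)
  obtain ⟨⟨T₁, hT₁⟩, hL⟩ := hμ.dVal_sum hx (Finset.range (N + 1)) hT' w
  set F : E → E → ℝ := fun y => (cutoff ε (hat y) - cutoff ε (e (ind y))) * φ with hF
  have hFi : ∀ u, Integrable (fun y => F y u) ν := fun u => by
    simp only [hF, Pi.mul_apply, Pi.sub_apply]
    exact ((integrable_cutoff measurable_normalize ε u).sub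
      (integrable_cutoff (measurable_from_top.comp hindm) ε u)).mul_const _
  have hr : Nice (fun u => ∫ y, F y u ∂ν) (V * (4 * (4 * η * A))) := by
    refine Nice.integral ?_ hFi
    refine (ae_restrict_iff' (measurableSet_shell E)).2 (Filter.Eventually.of_forall fun y hy => ?_)
    exact ((hcl _ _ (hclose y hy)).mul ((hc2 _).sub (hc2 _)) hφ2 hA).nice
      (((hc2 _).sub (hc2 _)).mul hφ2)
  have hid : ∀ u : E, ‖u‖ = 1 → (κ • φ) u = ((∑ k ∈ Finset.range (N + 1),
      w k • (cutoff ε (e k) * φ)) + (1 : ℝ) • fun u => ∫ y, F y u ∂ν) u := by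
    intro u hu
    have h1 : ∫ y, F y u ∂ν = κ * φ u -
        (∑ k ∈ Finset.range (N + 1), w k * cutoff ε (e k) u) * φ u := by
      simp only [hF, Pi.mul_apply, Pi.sub_apply]
      rw [integral_mul_const, integral_sub (integrable_cutoff (f := hat) measurable_normalize ε u)
        (integrable_cutoff (f := fun y => e (ind y)) (measurable_from_top.comp hindm) ε u), hκ u hu,
        hsum fun k => cutoff ε (e k) u, sub_mul]
    simp only [Pi.smul_apply, Pi.add_apply, Finset.sum_apply, Pi.mul_apply, smul_eq_mul, one_mul]
    rw [h1, Finset.sum_mul]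
    simp only [mul_assoc]
    ring
  have hfinal : κ * dVal μ x φ = ∑ k ∈ Finset.range (N + 1), w k * dVal μ x (cutoff ε (e k) * φ) +
      dVal μ x (fun u => ∫ y, F y u ∂ν) := by
    rw [← hμ.dVal_smul hx hS, IsCTV.dVal_congr μ (fun u _ => rfl) hid, hμ.dVal_add_smul hx hT₁ hr, hL,
      one_mul]
  rw [← abs_mul, hfinal, ← hVe]
  refine (abs_add_le _ _).trans (add_le_add ?_ ?_)
  · refine (Finset.abs_sum_le_sum_abs _ _).trans ?_
    rw [← hsumw, Finset.sum_mul]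
    refine Finset.sum_le_sum fun k _ => ?_
    rw [abs_mul, abs_of_nonneg (hw0 k)]
    exact mul_le_mul_of_nonneg_left (hs _ (he1 k)) (hw0 k)
  · refine (hΛ _ _ hr).trans (le_trans (le_of_eq ?_) hηD)
    ring

end Averaging

section AveragingConstant

open Metric Set Module
open scoped ContDiff

variable {E : Type*} [NormedAddCommGroup E] [InnerProductSpace ℝ E] [FiniteDimensional ℝ E]
  [Nontrivial E] [MeasurableSpace E] [BorelSpace E]

lemma setIntegral_shell_cutoff_comp_isometry (ε : ℝ) (A : E ≃ₗᵢ[ℝ] E) (u : E) :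
    ∫ y in shell E, cutoff ε (‖y‖⁻¹ • y) (A u) = ∫ y in shell E, cutoff ε (‖y‖⁻¹ • y) u := by
  have h := A.measurePreserving.setIntegral_preimage_emb
    A.toHomeomorph.measurableEmbedding (fun y => cutoff ε (‖y‖⁻¹ • y) (A u)) (shell E)
  have hs : A ⁻¹' shell E = shell E := by ext y; simp [shell]
  rw [← h, hs]
  refine setIntegral_congr_fun (measurableSet_shell E) fun y _ => ?_
  rw [A.norm_map, ← map_smul, cutoff_comp_isometry]

lemma le_setIntegral_shell_cutoff {ε : ℝ} (hε : 0 < ε) (hε1 : ε ≤ 1) {u : E} (hu : ‖u‖ = 1) :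
    (ε / 8) ^ finrank ℝ E * volume.real (ball (0 : E) 1) ≤
      ∫ y in shell E, cutoff ε (‖y‖⁻¹ • y) u := by
  have : ProperSpace E := FiniteDimensional.proper_real E
  have hfinite : IsFiniteMeasure (volume.restrict (shell E)) :=
    ⟨by simpa using volume_shell_lt_top E⟩
  set B := closedBall ((3 / 4 : ℝ) • u) (ε / 8)
  have hB : ∀ y ∈ B, |‖y‖ - 3 / 4| ≤ ε / 8 := by
    intro y hy
    have h1 := abs_norm_sub_norm_le y ((3 / 4 : ℝ) • u)
    rw [norm_smul, hu, Real.norm_eq_abs, mul_one, abs_of_pos (by norm_num : (0 : ℝ) < 3 / 4)] at h1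
    exact h1.trans (by simpa [B, dist_eq_norm] using hy)
  have hBs : B ⊆ shell E := fun y hy => by
    have := abs_le.1 (hB y hy)
    exact ⟨by linarith, by linarith⟩
  have hB1 : ∀ y ∈ B, cutoff ε (‖y‖⁻¹ • y) u = 1 := by
    intro y hy
    have h1 := abs_le.1 (hB y hy)
    have hy0 : 0 < ‖y‖ := by linarith
    have h2 : ‖y‖ * ‖u - ‖y‖⁻¹ • y‖ ≤ ε / 4 := by
      have e1 : ‖y‖ * ‖u - ‖y‖⁻¹ • y‖ = ‖‖y‖ • (u - ‖y‖⁻¹ • y)‖ := by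
        rw [norm_smul, norm_norm]
      have e2 : ‖y‖ • (u - ‖y‖⁻¹ • y) = (‖y‖ - 3 / 4) • u - (y - (3 / 4 : ℝ) • u) := by
        rw [smul_sub, smul_inv_smul₀ hy0.ne', sub_smul]; abel
      rw [e1, e2]
      refine (norm_sub_le _ _).trans ?_
      rw [norm_smul, hu, mul_one, Real.norm_eq_abs]
      have h3 : ‖y - (3 / 4 : ℝ) • u‖ ≤ ε / 8 := by simpa [B, dist_eq_norm] using hy
      linarith [hB y hy]
    have h4 : ‖u - ‖y‖⁻¹ • y‖ ≤ ε := by nlinarith [norm_nonneg (u - ‖y‖⁻¹ • y)]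
    exact cutoff_eq_one hε (pow_le_pow_left₀ (norm_nonneg _) h4 2)
  have h5 : volume.real B = (ε / 8) ^ finrank ℝ E * volume.real (ball (0 : E) 1) :=
    Measure.addHaar_real_closedBall _ _ (by positivity)
  rw [← h5]
  calc volume.real B = ∫ y in B, (1 : ℝ) := by simp
    _ = ∫ y in B, cutoff ε (‖y‖⁻¹ • y) u :=
        (setIntegral_congr_fun isClosed_closedBall.measurableSet fun y hy => hB1 y hy).symm
    _ ≤ _ := setIntegral_mono_set (integrable_cutoff measurable_normalize ε u)
        (Filter.Eventually.of_forall fun y => cutoff_nonneg _ _ _) hBs.eventuallyLE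

lemma exists_abs_dVal_le_of_cutoff
    (htr : ∀ u v : E, ‖u‖ = 1 → ‖v‖ = 1 → ∃ A : E ≃ₗᵢ[ℝ] E, A u = v) :
    ∃ C, 0 ≤ C ∧ ∀ (μ : ConvexBody E → ℝ) (x φ : E → ℝ) (R ε s : ℝ), IsCTV μ → Nice x R →
      ContDiff ℝ ∞ φ → 0 < ε → ε ≤ 1 → (∀ y : E, ‖y‖ = 1 → |dVal μ x (cutoff ε y * φ)| ≤ s) →
      |dVal μ x φ| ≤ C * (ε⁻¹) ^ finrank ℝ E * s := by
  have : ProperSpace E := FiniteDimensional.proper_real E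
  obtain ⟨u₀, hu₀⟩ := exists_norm_eq E (zero_le_one (α := ℝ))
  set b := volume.real (ball (0 : E) 1)
  have hb : 0 < b := ENNReal.toReal_pos (measure_ball_pos _ _ one_pos).ne' measure_ball_lt_top.ne
  refine ⟨8 ^ finrank ℝ E * volume.real (shell E) / b, by positivity, ?_⟩
  intro μ x φ R ε s hμ hx hφ hε hε1 hs
  set κ := ∫ y in shell E, cutoff ε (‖y‖⁻¹ • y) u₀
  have hκ : (ε / 8) ^ finrank ℝ E * b ≤ κ := le_setIntegral_shell_cutoff hε hε1 hu₀
  have hκ0 : 0 < κ := lt_of_lt_of_le (by positivity) hκ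
  have h := hμ.mul_abs_dVal_le hx hφ hε hs (κ := κ) fun u hu => by
    obtain ⟨A, rfl⟩ := htr u₀ u hu₀ hu
    exact setIntegral_shell_cutoff_comp_isometry ε A u₀
  rw [abs_of_pos hκ0] at h
  have h2 := (mul_le_mul_of_nonneg_right hκ (abs_nonneg (dVal μ x φ))).trans h
  have e : 8 ^ finrank ℝ E * volume.real (shell E) / b * (ε⁻¹) ^ finrank ℝ E * s =
      (volume.real (shell E) * s) / ((ε / 8) ^ finrank ℝ E * b) := by
    rw [div_pow, inv_pow]; field_simp
  rw [e, le_div_iff₀ (by positivity), mul_comm]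
  exact h2

end AveragingConstant

section Projection

open Metric Set Module
open scoped ContDiff

variable {E : Type*} [NormedAddCommGroup E] [InnerProductSpace ℝ E]

lemma norm_iteratedFDeriv_le_of_jet_eq_zero {r : E → ℝ} (hr : ContDiff ℝ ∞ r) {x₀ : E}
    (hx₀ : ‖x₀‖ ≤ 1) {N : ℕ} {K : ℝ} (h0 : ∀ j ≤ N, iteratedFDeriv ℝ j r x₀ = 0)
    (hK : ∀ x : E, ‖x‖ ≤ 1 → ‖iteratedFDeriv ℝ (N + 1) r x‖ ≤ K) (m j : ℕ) (hj : j + m = N + 1)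
    {x : E} (hx : ‖x‖ ≤ 1) : ‖iteratedFDeriv ℝ j r x‖ ≤ K * ‖x - x₀‖ ^ m := by
  induction m generalizing j x with
  | zero =>
    obtain rfl : j = N + 1 := by omega
    simpa using hK x hx
  | succ m ih =>
    have hK0 : 0 ≤ K := (norm_nonneg _).trans (hK 0 (by simp))
    have hd : Differentiable ℝ (iteratedFDeriv ℝ j r) :=
      hr.differentiable_iteratedFDeriv (by exact_mod_cast ENat.natCast_lt_top j)
    have hconv : Convex ℝ (closedBall (0 : E) 1 ∩ closedBall x₀ ‖x - x₀‖) :=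
      (convex_closedBall _ _).inter (convex_closedBall _ _)
    have key := hconv.norm_image_sub_le_of_norm_fderiv_le (𝕜 := ℝ)
      (f := iteratedFDeriv ℝ j r) (C := K * ‖x - x₀‖ ^ m) (x := x₀) (y := x)
      (fun z _ => hd z) (fun z hz => by
        rw [norm_fderiv_iteratedFDeriv]
        have hz2 : ‖z - x₀‖ ≤ ‖x - x₀‖ := by simpa [dist_eq_norm] using hz.2
        exact (ih (j + 1) (by omega) (by simpa using hz.1)).trans (by gcongr))
      ⟨by simpa using hx₀, by simp⟩ ⟨by simpa using hx, by simp [dist_eq_norm]⟩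
    rw [h0 j (by omega), sub_zero] at key
    rw [pow_succ, ← mul_assoc]
    exact key

end Projection

section JetProjection

open Metric Set Module
open scoped ContDiff

variable {E : Type*} [NormedAddCommGroup E] [InnerProductSpace ℝ E]

lemma iteratedFDeriv_sum_smul {ι : Type*} (s : Finset ι) {q : ι → E → ℝ}
    (hq : ∀ i, ContDiff ℝ ∞ (q i)) (c : ι → ℝ) (j : ℕ) (x : E) :
    iteratedFDeriv ℝ j (∑ i ∈ s, c i • q i) x = ∑ i ∈ s, c i • iteratedFDeriv ℝ j (q i) x := by
  rw [iteratedFDeriv_sum_apply (f := fun i => c i • q i) fun i _ =>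
    (contDiff_infty.1 ((hq i).const_smul (c i)) j).contDiffAt]
  exact Finset.sum_congr rfl fun i _ =>
    iteratedFDeriv_const_smul_apply (contDiff_infty.1 (hq i) j).contDiffAt

lemma contDiff_sum_smul {ι : Type*} (s : Finset ι) {q : ι → E → ℝ}
    (hq : ∀ i, ContDiff ℝ ∞ (q i)) (c : ι → ℝ) : ContDiff ℝ ∞ (∑ i ∈ s, c i • q i) := by
  have : (∑ i ∈ s, c i • q i) = fun x => ∑ i ∈ s, c i • q i x := by funext x; simp
  rw [this]
  exact ContDiff.sum fun i _ => (hq i).const_smul (c i)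

variable [FiniteDimensional ℝ E]

lemma exists_norm_iteratedFDeriv_le_of_finset {ι : Type*} (s : Finset ι) {q : ι → E → ℝ}
    (hq : ∀ i, ContDiff ℝ ∞ (q i)) (N : ℕ) :
    ∃ Q, 0 ≤ Q ∧ ∀ i ∈ s, ∀ j ≤ N, ∀ x : E, ‖x‖ ≤ 1 → ‖iteratedFDeriv ℝ j (q i) x‖ ≤ Q := by
  have : ProperSpace E := FiniteDimensional.proper_real E
  have h1 : ∀ p : ι × ℕ, ∃ Q, 0 ≤ Q ∧ ∀ x : E, ‖x‖ ≤ 1 → ‖iteratedFDeriv ℝ p.2 (q p.1) x‖ ≤ Q := by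
    intro p
    have hc : Continuous (iteratedFDeriv ℝ p.2 (q p.1)) :=
      (hq p.1).continuous_iteratedFDeriv (by exact_mod_cast le_top)
    obtain ⟨Q, hQ⟩ := (isCompact_closedBall (0 : E) 1).exists_bound_of_continuousOn hc.continuousOn
    exact ⟨Q, (norm_nonneg _).trans (hQ 0 (by simp)), fun x hx => hQ x (by simpa using hx)⟩
  choose Q hQ0 hQ using h1
  refine ⟨∑ p ∈ s ×ˢ Finset.range (N + 1), Q p, Finset.sum_nonneg fun p _ => hQ0 p,
    fun i hi j hj x hx => (hQ (i, j) x hx).trans ?_⟩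
  exact Finset.single_le_sum (f := Q) (fun p _ => hQ0 p)
    (Finset.mem_product.2 ⟨hi, Finset.mem_range.2 (Nat.lt_succ_of_le hj)⟩)

variable (E) in
/-- The space of smooth functions. -/
def smoothSubmodule : Submodule ℝ (E → ℝ) where
  carrier := {f | ContDiff ℝ ∞ f}
  add_mem' {a b} (ha : ContDiff ℝ ∞ a) (hb : ContDiff ℝ ∞ b) := ha.add hb
  zero_mem' := show ContDiff ℝ ∞ (fun _ : E => (0 : ℝ)) from contDiff_const
  smul_mem' c f (h : ContDiff ℝ ∞ f) := h.const_smul c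

/-- The linear map sending a smooth function to its jet of order `N` at `x₀`. -/
def jetMap (x₀ : E) (N : ℕ) :
    smoothSubmodule E →ₗ[ℝ] ((j : Fin (N + 1)) → E [×(j : ℕ)]→L[ℝ] ℝ) where
  toFun f := fun j => iteratedFDeriv ℝ (j : ℕ) f.1 x₀
  map_add' f g := by
    funext j
    exact iteratedFDeriv_add_apply (contDiff_infty.1 f.2 _).contDiffAt
      (contDiff_infty.1 g.2 _).contDiffAt
  map_smul' c f := by
    funext j
    exact iteratedFDeriv_const_smul_apply (contDiff_infty.1 f.2 _).contDiffAt

lemma finiteDimensional_jet (j : ℕ) : FiniteDimensional ℝ (E [×j]→L[ℝ] ℝ) :=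
  FiniteDimensional.of_injective
    (ContinuousMultilinearMap.toMultilinearMapLinear (R' := ℝ) (A := ℝ) (M₁ := fun _ : Fin j => E)
      (M₂ := ℝ)) ContinuousMultilinearMap.toMultilinearMap_injective

lemma exists_bounded_section {V X : Type*} [AddCommGroup V] [Module ℝ V] [NormedAddCommGroup X]
    [NormedSpace ℝ X] [FiniteDimensional ℝ X] (T : V →ₗ[ℝ] X) :
    ∃ (d : ℕ) (q : Fin d → V) (C : ℝ), 0 ≤ C ∧ ∀ v, ∃ c : Fin d → ℝ,
      T v = T (∑ k, c k • q k) ∧ ∀ k, |c k| ≤ C * ‖T v‖ := by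
  set W := LinearMap.range T
  set b := finBasis ℝ W
  have h1 : ∀ k, ∃ q : V, T q = b k := fun k => (b k).2
  choose q hq using h1
  have h2 : ∀ k, ∃ C, 0 ≤ C ∧ ∀ w : W, |b.repr w k| ≤ C * ‖w‖ := by
    intro k
    set l := (LinearMap.toContinuousLinearMap (b.coord k))
    exact ⟨‖l‖, norm_nonneg l, fun w => l.le_opNorm w⟩
  choose C hC0 hC using h2
  refine ⟨_, q, ∑ k, C k, Finset.sum_nonneg fun k _ => hC0 k, fun v =>
    ⟨b.repr ⟨T v, LinearMap.mem_range_self T v⟩, ?_, fun k => ?_⟩⟩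
  · have e2 := congrArg (Subtype.val) (b.sum_repr ⟨T v, LinearMap.mem_range_self T v⟩)
    have e3 : T v = _ := e2.symm
    simp only [map_sum, map_smul, hq]
    refine e3.trans ?_
    rw [Submodule.coe_sum]
    rfl
  · refine (hC k _).trans (mul_le_mul_of_nonneg_right ?_ (norm_nonneg _))
    exact Finset.single_le_sum (fun i _ => hC0 i) (Finset.mem_univ k)

lemma exists_jet_projection {x₀ : E} (hx₀ : ‖x₀‖ ≤ 1) {N : ℕ} (hN : 2 ≤ N) :
    ∃ (d : ℕ) (q : Fin d → E → ℝ) (C : ℝ), 0 ≤ C ∧ (∀ k, ContDiff ℝ ∞ (q k)) ∧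
      ∀ f : E → ℝ, ContDiff ℝ ∞ f → ∀ B, (∀ j ≤ N + 1, ∀ x : E, ‖x‖ ≤ 1 →
        ‖iteratedFDeriv ℝ j f x‖ ≤ B) → ∃ c : Fin d → ℝ,
        JetBound (∑ k, c k • q k) (C * B) ∧ ∀ j ≤ N, ∀ x : E, ‖x‖ ≤ 1 →
          ‖iteratedFDeriv ℝ j (f - ∑ k, c k • q k) x‖ ≤ C * B * ‖x - x₀‖ ^ (N + 1 - j) := by
  have hfd : ∀ j : Fin (N + 1), FiniteDimensional ℝ (E [×(j : ℕ)]→L[ℝ] ℝ) :=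
    fun j => finiteDimensional_jet j
  set J := jetMap x₀ N
  obtain ⟨d, q, C₁, hC₁0, hC₁⟩ := exists_bounded_section J
  obtain ⟨Q, hQ0, hQ⟩ := exists_norm_iteratedFDeriv_le_of_finset Finset.univ
    (fun k => (q k).2) (N + 1)
  have hS0 : 0 ≤ d * C₁ * Q := by positivity
  refine ⟨d, fun k => (q k).1, 1 + d * C₁ * Q, by linarith, fun k => (q k).2,
    fun f hf B hB => ?_⟩
  have hB0 : 0 ≤ B := (norm_nonneg _).trans (hB 0 (by omega) 0 (by simp))
  set F : smoothSubmodule E := ⟨f, hf⟩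
  have hw : ‖J F‖ ≤ B := (pi_norm_le_iff_of_nonneg hB0).2 fun j => hB j (by omega) x₀ hx₀
  obtain ⟨c, e1, hc'⟩ := hC₁ F
  have hc : ∀ k, |c k| ≤ C₁ * B := fun k => (hc' k).trans (mul_le_mul_of_nonneg_left hw hC₁0)
  have hsum : ∀ j ≤ N + 1, ∀ x : E, ‖x‖ ≤ 1 →
      ‖iteratedFDeriv ℝ j (∑ k, c k • (q k).1) x‖ ≤ d * C₁ * Q * B := by
    intro j hj x hx
    rw [iteratedFDeriv_sum_smul _ fun k => (q k).2]
    refine (norm_sum_le _ _).trans ?_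
    refine (Finset.sum_le_card_nsmul _ _ (C₁ * B * Q) fun k hk => ?_).trans ?_
    · rw [norm_smul, Real.norm_eq_abs]
      exact mul_le_mul (hc k) (hQ k hk j hj x hx) (norm_nonneg _) (mul_nonneg hC₁0 hB0)
    · rw [Finset.card_univ, Fintype.card_fin, nsmul_eq_mul]
      exact le_of_eq (by ring)
  have hsm : ContDiff ℝ ∞ (∑ k, c k • (q k).1) := contDiff_sum_smul _ (fun k => (q k).2) c
  have hjet : ∀ j ≤ N, iteratedFDeriv ℝ j (f - ∑ k, c k • (q k).1) x₀ = 0 := by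
    intro j hj
    have e3 := congrFun e1 ⟨j, Nat.lt_succ_of_le hj⟩
    have e4 : iteratedFDeriv ℝ j f x₀ = iteratedFDeriv ℝ j (∑ k, c k • (q k).1) x₀ := by
      have : ((∑ k, c k • q k : smoothSubmodule E) : E → ℝ) = ∑ k, c k • (q k).1 := by simp
      rw [← this]; exact e3
    rw [iteratedFDeriv_sub_apply (contDiff_infty.1 hf j).contDiffAt
      (contDiff_infty.1 hsm j).contDiffAt, e4, sub_self]
  refine ⟨c, fun j hj x hx => (hsum j (by omega) x hx).trans ?_, fun j hj x hx => ?_⟩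
  · exact mul_le_mul_of_nonneg_right (by linarith) hB0
  · refine norm_iteratedFDeriv_le_of_jet_eq_zero (N := N) (r := f - _) (hf.sub hsm) hx₀ hjet ?_
      (N + 1 - j) j (by omega) hx
    intro y hy
    rw [iteratedFDeriv_sub_apply (contDiff_infty.1 hf _).contDiffAt
      (contDiff_infty.1 hsm _).contDiffAt]
    refine (norm_sub_le _ _).trans ?_
    have := hB _ le_rfl y hy
    have := hsum _ le_rfl y hy
    linarith

end JetProjection

section Grid

open Set Module
open scoped ContDiff

lemma eq_zero_of_grid {ι : Type*} [Fintype ι] [DecidableEq ι] {D : ℕ} {F : (ι → ℝ) → ℝ}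
    (hF : ∀ x i, PolyOn D (fun t => F (Function.update x i t)) univ)
    (h0 : ∀ a : ι → Fin (D + 1), F (fun i => ((a i : ℕ) : ℝ)) = 0) (x : ι → ℝ) : F x = 0 := by
  have key : ∀ s : Finset ι, ∀ x : ι → ℝ, (∀ i ∉ s, ∃ a : Fin (D + 1), x i = ((a : ℕ) : ℝ)) →
      F x = 0 := by
    intro s
    induction s using Finset.induction_on with
    | empty =>
      intro x hx
      choose a ha using fun i => hx i (Finset.notMem_empty i)
      rw [show x = fun i => ((a i : ℕ) : ℝ) from funext ha]
      exact h0 a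
    | insert i s hi ih =>
      intro x hx
      have h1 := (hF x i).eq_sum_lagr (by simp) (mem_univ (x i))
      simp only [Function.update_eq_self] at h1
      rw [h1]
      refine Finset.sum_eq_zero fun k hk => ?_
      rw [ih (Function.update x i k), zero_mul]
      intro j hj
      by_cases hji : j = i
      · subst hji
        exact ⟨⟨k, Finset.mem_range.1 hk⟩, by simp⟩
      · rw [Function.update_of_ne hji]
        exact hx j (by simp [hji, hj])
  exact key Finset.univ x (by simp)

variable {E : Type*} [NormedAddCommGroup E] [InnerProductSpace ℝ E] [FiniteDimensional ℝ E]
  [Nontrivial E]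

lemma IsCTV.extVal_sum_smul_eq_zero {μ : ConvexBody E → ℝ} (hμ : IsCTV μ) {ι : Type*} [Fintype ι]
    {b : ι → E → ℝ} (hb : ∀ i, ContDiff ℝ ∞ (b i))
    (h0 : ∀ a : ι → Fin (polyDeg E + 1), extVal μ (∑ i, ((a i : ℕ) : ℝ) • b i) = 0) (c : ι → ℝ) :
    extVal μ (∑ i, c i • b i) = 0 := by
  classical
  refine eq_zero_of_grid (F := fun c => extVal μ (∑ i, c i • b i)) (fun c i => ?_) h0 c
  have h1 : ∀ t : ℝ, ∑ j, Function.update c i t j • b j =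
      (∑ j, Function.update c i 0 j • b j) + t • b i := by
    intro t
    have e : t • b i = ∑ j, if j = i then t • b i else 0 := by simp
    rw [e, ← Finset.sum_add_distrib]
    refine Finset.sum_congr rfl fun j _ => ?_
    by_cases hji : j = i
    · subst hji; simp
    · simp [hji]
  have h2 : (fun t => extVal μ (∑ j, Function.update c i t j • b j)) = fun t =>
      extVal μ ((∑ j, Function.update c i 0 j • b j) + t • b i) := funext fun t => by rw [h1 t]
  rw [h2]
  obtain ⟨R, hR⟩ := exists_nice_of_contDiff (contDiff_infty.1
    (contDiff_sum_smul Finset.univ hb (Function.update c i 0)) 2)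
  obtain ⟨S, hS⟩ := exists_nice_of_contDiff (contDiff_infty.1 (hb i) 2)
  exact hμ.polyOn_extVal hR hS

end Grid

section Localization

open Set Module
open scoped ContDiff

variable {E : Type*} [NormedAddCommGroup E] [InnerProductSpace ℝ E] [FiniteDimensional ℝ E]
  [Nontrivial E]

lemma IsCTV.dVal_cutoff_mul {μ : ConvexBody E → ℝ} (hμ : IsCTV μ) {A : E ≃ₗᵢ[ℝ] E}
    (hA : ∀ K L : ConvexBody E, (L : Set E) = A '' K → μ L = μ K) {g φ : E → ℝ}
    (hg : ContDiff ℝ ∞ g) (hφ : ContDiff ℝ ∞ φ) {ε : ℝ} (hε : 0 < ε) (y : E) :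
    dVal μ g (cutoff ε (A y) * φ) =
      dVal μ (cutoff (2 * ε) y * (g ∘ A)) (cutoff ε y * (φ ∘ A)) := by
  have nice : ∀ f : E → ℝ, ContDiff ℝ ∞ f → ∃ R, Nice f R := fun f hf =>
    exists_nice_of_contDiff (contDiff_infty.1 hf 2)
  obtain ⟨R, hR⟩ := nice g hg
  obtain ⟨S, hS⟩ := nice (cutoff ε (A y) * φ) ((contDiff_cutoff ε (A y)).mul hφ)
  have hAs : ContDiff ℝ ∞ A := A.contDiff
  have hgA : ContDiff ℝ ∞ (g ∘ A) := hg.comp hAs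
  have hφA : ContDiff ℝ ∞ (φ ∘ A) := hφ.comp hAs
  obtain ⟨T, hT⟩ := nice _ hgA
  obtain ⟨T', hT'⟩ := nice _ hφA
  set c := T + T' with hc
  have hT0 := hT.nonneg
  have hT'0 := hT'.nonneg
  have hc0 : 0 ≤ c := by positivity
  have hχ := contDiff_cutoff ε y
  have hχ' := contDiff_cutoff (2 * ε) y
  have hχ1 : ContDiff ℝ ∞ fun u => 1 - cutoff (2 * ε) y u := contDiff_const.sub hχ'
  rw [← hμ.dVal_comp_isometry hA hR hS]
  have h1 : (cutoff ε (A y) * φ) ∘ A = cutoff ε y * (φ ∘ A) := by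
    funext u; simp [cutoff_comp_isometry]
  rw [h1]
  obtain ⟨R₀, h₀⟩ := nice (cutoff (2 * ε) y * (g ∘ A)) (hχ'.mul hgA)
  obtain ⟨R₁, h₁⟩ := nice (fun u => cutoff ε y u * ((φ ∘ A) u + c)) (hχ.mul (hφA.add contDiff_const))
  obtain ⟨R₂, h₂⟩ := nice (fun u => cutoff ε y u * c) (hχ.mul contDiff_const)
  obtain ⟨R₃, h₃⟩ := nice (fun u => (1 - cutoff (2 * ε) y u) * ((g ∘ A) u + c))
    (hχ1.mul (hgA.add contDiff_const))
  obtain ⟨R₄, h₄⟩ := nice (fun u => (1 - cutoff (2 * ε) y u) * c) (hχ1.mul contDiff_const)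
  have hpos : ∀ u : E, 0 ≤ 1 - cutoff (2 * ε) y u := fun u => by
    linarith [cutoff_le_one (2 * ε) y u]
  have hd : ∀ (u : E) (a b : ℝ), cutoff ε y u * a * ((1 - cutoff (2 * ε) y u) * b) = 0 := by
    intro u a b
    have := cutoff_mul_one_sub hε u y
    calc _ = (cutoff ε y u * (1 - cutoff (2 * ε) y u)) * (a * b) := by ring
      _ = 0 := by rw [this, zero_mul]
  have key := hμ.dVal_add_of_disjoint h₀ h₁ h₂ h₃ h₄
    (fun u hu => mul_nonneg (cutoff_nonneg _ _ _)
      (by linarith [(abs_le.1 (hT'.abs_le u hu)).1]))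
    (fun u _ => mul_nonneg (cutoff_nonneg _ _ _) hc0)
    (fun u hu => mul_nonneg (hpos u) (by linarith [(abs_le.1 (hT.abs_le u hu)).1]))
    (fun u _ => mul_nonneg (hpos u) hc0) (fun u _ => hd u _ _) (fun u _ => hd u _ _)
    (fun u _ => hd u _ _) (fun u _ => hd u _ _)
  have e1 : (fun u => cutoff ε y u * ((φ ∘ A) u + c)) - (fun u => cutoff ε y u * c) =
      cutoff ε y * (φ ∘ A) := by
    funext u; simp only [Pi.sub_apply, Pi.mul_apply]; ring
  have e2 : cutoff (2 * ε) y * (g ∘ A) + ((fun u => (1 - cutoff (2 * ε) y u) * ((g ∘ A) u + c)) -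
      fun u => (1 - cutoff (2 * ε) y u) * c) = g ∘ A := by
    funext u; simp only [Pi.sub_apply, Pi.mul_apply, Pi.add_apply]; ring
  rw [e1, e2] at key
  exact key

variable (E) in
lemma exists_abs_dVal_add_le : ∃ (C : ℝ) (e : ℕ), 0 ≤ C ∧ ∀ (μ : ConvexBody E → ℝ) (M : ℝ),
    IsCTV μ → UnitBound μ M → ∀ (x φ r₀ r₁ : E → ℝ) (R ρ : ℝ), Nice x R → Nice φ R →
      Nice r₀ ρ → Nice r₁ ρ → (1 + polyDeg E) * ρ ≤ 1 →
      (∀ i ≤ polyDeg E, extVal μ (x + (i : ℝ) • φ) = 0) →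
      |dVal μ (x + r₀) (φ + r₁)| ≤ C * ρ * (1 + R) ^ e * M := by
  set D := polyDeg E
  obtain ⟨C, e, hC0, hC⟩ := exists_abs_extVal_sub_le E
  set L := ∑ i ∈ Finset.range (D + 1), |(lagr D i).derivative.eval 0|
  have hL0 : 0 ≤ L := Finset.sum_nonneg fun _ _ => abs_nonneg _
  refine ⟨L * (C * (1 + D) * (1 + D) ^ e), e, by positivity, ?_⟩
  intro μ M hμ hM x φ r₀ r₁ R ρ hx hφ hr₀ hr₁ hρ h0
  have hM0 := hM.nonneg
  have hR0 := hx.nonneg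
  have hρ0 := hr₀.nonneg
  have hterm : ∀ i ∈ Finset.range (D + 1), |extVal μ (x + r₀ + (i : ℝ) • (φ + r₁))| ≤
      C * ((1 + D) * ρ) * ((1 + D) ^ e * (1 + R) ^ e) * M := by
    intro i hi
    have hiD : i ≤ D := Nat.lt_succ_iff.1 (Finset.mem_range.1 hi)
    have hiD' : (i : ℝ) ≤ D := by exact_mod_cast hiD
    have h1 := (hx.add_smul hφ (i : ℝ)).mono (S := (1 + D) * R) (by
      rw [abs_of_nonneg (by positivity)]; nlinarith)
    have h2 := (hr₀.add_smul hr₁ (i : ℝ)).mono (S := (1 + D) * ρ) (by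
      rw [abs_of_nonneg (by positivity)]; nlinarith)
    have h3 := hC μ M hμ hM _ _ _ _ h1 h2 hρ
    rw [h0 i hiD, sub_zero] at h3
    have e1 : x + (i : ℝ) • φ + (r₀ + (i : ℝ) • r₁) = x + r₀ + (i : ℝ) • (φ + r₁) := by
      rw [smul_add]; abel
    rw [e1] at h3
    refine h3.trans ?_
    rw [← mul_pow]
    gcongr
    have : (0 : ℝ) ≤ D := by positivity
    nlinarith
  unfold dVal
  refine (Finset.abs_sum_le_sum_abs _ _).trans ?_
  calc _ ≤ ∑ i ∈ Finset.range (D + 1), C * ((1 + D) * ρ) * ((1 + D) ^ e * (1 + R) ^ e) * M *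
        |(lagr D i).derivative.eval 0| := by
        refine Finset.sum_le_sum fun i hi => ?_
        rw [abs_mul]
        exact mul_le_mul_of_nonneg_right (hterm i hi) (abs_nonneg _)
    _ = _ := by rw [← Finset.mul_sum]; ring

end Localization

section Determination

open Set Module
open scoped ContDiff

variable {E : Type*} [NormedAddCommGroup E] [InnerProductSpace ℝ E]

lemma jetBound_cutoff_mul {C ε K : ℝ} {y : E} {N : ℕ}
    (hχ : ∀ x : E, ∀ j ≤ 2, ‖iteratedFDeriv ℝ j (cutoff ε y) x‖ ≤ C * (ε⁻¹) ^ 2) (hε : 0 < ε)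
    (hε1 : 2 * ε ≤ 1) (hN : 2 ≤ N) (hK : 0 ≤ K) {r : E → ℝ} (hr : ContDiff ℝ ∞ r)
    (h : ∀ j ≤ N, ∀ x : E, ‖x‖ ≤ 1 → ‖iteratedFDeriv ℝ j r x‖ ≤ K * ‖x - y‖ ^ (N + 1 - j)) :
    JetBound (cutoff ε y * r) (4 * (C * (ε⁻¹) ^ 2) * (K * (2 * ε) ^ (N - 1))) := by
  intro j hj x hx
  have hχ2 : ContDiff ℝ 2 (cutoff ε y) := contDiff_infty.1 (contDiff_cutoff ε y) 2
  have hr2 : ContDiff ℝ 2 r := contDiff_infty.1 hr 2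
  have hC0 : 0 ≤ C * (ε⁻¹) ^ 2 := (norm_nonneg _).trans (hχ x 0 (by norm_num))
  by_cases hxy : ‖x - y‖ ≤ 2 * ε
  · refine norm_iteratedFDeriv_mul_le_of_le hχ2 hr2 (hχ x) (fun i hi => ?_) hj
    refine (h i (hi.trans hN) x hx).trans (mul_le_mul_of_nonneg_left ?_ hK)
    exact (pow_le_pow_left₀ (norm_nonneg _) hxy _).trans
      (pow_le_pow_of_le_one (by positivity) hε1 (by omega))
  · have h1 := norm_iteratedFDeriv_mul_le_of_le hχ2 hr2 (x := x) (a := 0)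
      (b := K * ‖x - y‖ ^ (N - 1) + ∑ i ∈ Finset.range 3, ‖iteratedFDeriv ℝ i r x‖)
      (fun i _ => by rw [iteratedFDeriv_cutoff_eq_zero hε (not_le.1 hxy), norm_zero])
      (fun i hi => (Finset.single_le_sum (f := fun i => ‖iteratedFDeriv ℝ i r x‖)
        (fun _ _ => norm_nonneg _) (Finset.mem_range.2 (Nat.lt_succ_of_le hi))).trans
        (le_add_of_nonneg_left (by positivity))) hj
    refine h1.trans ?_
    rw [mul_zero, zero_mul]
    positivity

variable [FiniteDimensional ℝ E]

lemma exists_norm_iteratedFDeriv_one_add_smul_le {φ : E → ℝ} (hφ : ContDiff ℝ ∞ φ) (N : ℕ) :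
    ∃ B, 0 ≤ B ∧ (∀ j ≤ N, ∀ x : E, ‖x‖ ≤ 1 → ‖iteratedFDeriv ℝ j φ x‖ ≤ B) ∧
      ∀ t ∈ Ioo (0 : ℝ) 1, ∀ j ≤ N, ∀ x : E, ‖x‖ ≤ 1 →
        ‖iteratedFDeriv ℝ j ((fun _ => 1) + t • φ) x‖ ≤ B := by
  have h1 : ContDiff ℝ ∞ (fun _ : E => (1 : ℝ)) := contDiff_const
  obtain ⟨Q, hQ0, hQ⟩ := exists_norm_iteratedFDeriv_le_of_finset (Finset.univ : Finset Bool)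
    (q := fun b => if b then φ else fun _ => 1) (by intro b; cases b <;> simpa) N
  have hQφ : ∀ j ≤ N, ∀ x : E, ‖x‖ ≤ 1 → ‖iteratedFDeriv ℝ j φ x‖ ≤ Q := fun j hj x hx => by
    simpa using hQ true (Finset.mem_univ _) j hj x hx
  have hQ1 : ∀ j ≤ N, ∀ x : E, ‖x‖ ≤ 1 → ‖iteratedFDeriv ℝ j (fun _ : E => (1 : ℝ)) x‖ ≤ Q :=
    fun j hj x hx => by simpa using hQ false (Finset.mem_univ _) j hj x hx
  refine ⟨Q + Q, by positivity, fun j hj x hx => (hQφ j hj x hx).trans (by linarith),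
    fun t ht j hj x hx => ?_⟩
  have hle : (j : ℕ∞ω) ≤ ((⊤ : ℕ∞) : ℕ∞ω) := by exact_mod_cast le_top
  have hφt : ContDiff ℝ ∞ (t • φ) := hφ.const_smul t
  rw [iteratedFDeriv_add_apply (h1.contDiffAt.of_le hle) (hφt.contDiffAt.of_le hle),
    iteratedFDeriv_const_smul_apply (hφ.contDiffAt.of_le hle)]
  refine (norm_add_le _ _).trans (add_le_add (hQ1 j hj x hx) ?_)
  rw [norm_smul, Real.norm_eq_abs, abs_of_pos ht.1]
  exact (mul_le_of_le_one_left (norm_nonneg _) ht.2.le).trans (hQφ j hj x hx)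

variable [Nontrivial E]

lemma IsCTV.abs_dVal_cutoff_mul_le {μ : ConvexBody E → ℝ} {M CB Cχ Cq B ε : ℝ} {e m N d : ℕ}
    {x₀ : E} {q : Fin d → E → ℝ} (hμ : IsCTV μ)
    (hCB : ∀ (x φ r₀ r₁ : E → ℝ) (R ρ : ℝ), Nice x R → Nice φ R →
      Nice r₀ ρ → Nice r₁ ρ → (1 + polyDeg E) * ρ ≤ 1 →
      (∀ i ≤ polyDeg E, extVal μ (x + (i : ℝ) • φ) = 0) →
      |dVal μ (x + r₀) (φ + r₁)| ≤ CB * ρ * (1 + R) ^ e * M)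
    (hM0 : 0 ≤ M) (hCB0 : 0 ≤ CB)
    (hCχ1 : 1 ≤ Cχ) (hCχ : ∀ ε : ℝ, 0 < ε → ε ≤ 1 → ∀ (y x : E), ∀ j ≤ 2,
      ‖iteratedFDeriv ℝ j (cutoff ε y) x‖ ≤ Cχ * (ε⁻¹) ^ 2)
    (hN : N = 2 * e + m + 4) (hCq : 0 ≤ Cq) (hB : 0 ≤ B) (hq : ∀ k, ContDiff ℝ ∞ (q k))
    (hε : 0 < ε) (hε4 : 4 * ε ≤ 1)
    (hε5 : (1 + polyDeg E) * (16 * Cχ * (Cq * B) * 4 ^ (N - 1)) * ε ≤ 1)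
    (h0 : ∀ a : Fin d ⊕ Fin d → Fin (polyDeg E + 1), extVal μ (∑ i, ((a i : ℕ) : ℝ) •
      Sum.elim (fun k => cutoff (2 * ε) x₀ * q k) (fun k => cutoff ε x₀ * q k) i) = 0)
    {g φ : E → ℝ} (hg : ContDiff ℝ ∞ g) (hφ : ContDiff ℝ ∞ φ) {c c' : Fin d → ℝ}
    (hc : JetBound (∑ k, c k • q k) (Cq * B)) (hc' : JetBound (∑ k, c' k • q k) (Cq * B))
    (hr : ∀ j ≤ N, ∀ x : E, ‖x‖ ≤ 1 →
      ‖iteratedFDeriv ℝ j (g - ∑ k, c k • q k) x‖ ≤ Cq * B * ‖x - x₀‖ ^ (N + 1 - j))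
    (hr' : ∀ j ≤ N, ∀ x : E, ‖x‖ ≤ 1 →
      ‖iteratedFDeriv ℝ j (φ - ∑ k, c' k • q k) x‖ ≤ Cq * B * ‖x - x₀‖ ^ (N + 1 - j)) :
    |dVal μ (cutoff (2 * ε) x₀ * g) (cutoff ε x₀ * φ)| ≤
      CB * (16 * Cχ * (Cq * B) * 4 ^ (N - 1)) * (1 + 16 * Cχ * (Cq * B)) ^ e * ε ^ (m + 1) * M := by
  set K := Cq * B with hK
  have hK0 : 0 ≤ K := by positivity
  have hCχ0 : 0 ≤ Cχ := by linarith
  set P := ∑ k, c k • q k with hP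
  set P' := ∑ k, c' k • q k with hP'
  have hPs : ContDiff ℝ ∞ P := contDiff_sum_smul _ hq c
  have hPs' : ContDiff ℝ ∞ P' := contDiff_sum_smul _ hq c'
  have two : ∀ {f : E → ℝ}, ContDiff ℝ ∞ f → ContDiff ℝ 2 f := fun hf => contDiff_infty.1 hf 2
  have hχ := contDiff_cutoff ε x₀
  have hχ' := contDiff_cutoff (2 * ε) x₀
  have hinv : (2 * ε)⁻¹ ≤ ε⁻¹ := inv_anti₀ hε (by linarith)
  have hinv0 : 0 ≤ (2 * ε)⁻¹ := by positivity
  have hinv1 : 1 ≤ ε⁻¹ := (one_le_inv₀ hε).2 (by linarith)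
  have hε1 : ε ≤ 1 := by linarith
  have hj1 : JetBound (cutoff (2 * ε) x₀) (Cχ * (ε⁻¹) ^ 2) := fun j hj x _ =>
    (hCχ (2 * ε) (by positivity) (by linarith) x₀ x j hj).trans (by gcongr)
  have hj2 : JetBound (cutoff ε x₀) (Cχ * (ε⁻¹) ^ 2) := fun j hj x _ =>
    hCχ ε hε (by linarith) x₀ x j hj
  have n1 := (hj1.mul (two hχ') (two hPs) hc).nice (two (hχ'.mul hPs))
  have n2 := (hj2.mul (two hχ) (two hPs') hc').nice (two (hχ.mul hPs'))
  have n3 := ((jetBound_cutoff_mul (hCχ (2 * ε) (by positivity) (by linarith) x₀)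
    (by positivity) (by linarith) (by omega) hK0 (hg.sub hPs) hr).mono
    (b := 4 * (Cχ * (ε⁻¹) ^ 2) * (K * (2 * (2 * ε)) ^ (N - 1))) (by gcongr)).nice
    (two (hχ'.mul (hg.sub hPs)))
  have n4 := ((jetBound_cutoff_mul (hCχ ε hε (by linarith) x₀)
    hε (by linarith) (by omega) hK0 (hφ.sub hPs') hr').mono
    (b := 4 * (Cχ * (ε⁻¹) ^ 2) * (K * (2 * (2 * ε)) ^ (N - 1))) (by gcongr; linarith)).nice
    (two (hχ.mul (hφ.sub hPs')))
  have hρ : 4 * (4 * (Cχ * (ε⁻¹) ^ 2) * (K * (2 * (2 * ε)) ^ (N - 1))) =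
      16 * Cχ * K * 4 ^ (N - 1) * ε ^ (2 * e + m + 1) := by
    rw [show 2 * (2 * ε) = 4 * ε by ring, mul_pow, show N - 1 = 2 * e + m + 1 + 2 by omega,
      pow_add ε]
    field_simp
    ring
  have hεp : ε ^ (2 * e + m + 1) ≤ ε := by
    calc _ ≤ ε ^ 1 := pow_le_pow_of_le_one hε.le hε1 (by omega)
      _ = ε := pow_one _
  have hgrid : ∀ i ≤ polyDeg E,
      extVal μ (cutoff (2 * ε) x₀ * P + (i : ℝ) • (cutoff ε x₀ * P')) = 0 := by
    intro i _
    have hb : ∀ k, ContDiff ℝ ∞ (Sum.elim (fun k => cutoff (2 * ε) x₀ * q k)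
        (fun k => cutoff ε x₀ * q k) k : E → ℝ) := by
      rintro (k | k)
      · exact hχ'.mul (hq k)
      · exact hχ.mul (hq k)
    rw [← hμ.extVal_sum_smul_eq_zero hb h0 (Sum.elim c fun k => (i : ℝ) * c' k)]
    congr 1
    simp only [Fintype.sum_sum_type, Sum.elim_inl, Sum.elim_inr, hP, hP', Finset.mul_sum,
      Finset.smul_sum, mul_smul, mul_smul_comm]
  have key := hCB (cutoff (2 * ε) x₀ * P) (cutoff ε x₀ * P')
    (cutoff (2 * ε) x₀ * (g - P)) (cutoff ε x₀ * (φ - P')) _ _ n1 n2 n3 n4 (by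
    rw [hρ]
    calc _ = (1 + polyDeg E) * (16 * Cχ * K * 4 ^ (N - 1)) * ε ^ (2 * e + m + 1) := by ring
      _ ≤ (1 + polyDeg E) * (16 * Cχ * K * 4 ^ (N - 1)) * ε := by gcongr
      _ ≤ 1 := hε5) hgrid
  rw [← mul_add, ← mul_add, add_sub_cancel, add_sub_cancel, hρ] at key
  refine key.trans ?_
  have h1 : 1 + 4 * (4 * (Cχ * (ε⁻¹) ^ 2) * K) ≤ (1 + 16 * Cχ * K) * (ε⁻¹) ^ 2 := by
    have : 1 ≤ (ε⁻¹) ^ 2 := one_le_pow₀ hinv1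
    nlinarith
  calc _ ≤ CB * (16 * Cχ * K * 4 ^ (N - 1) * ε ^ (2 * e + m + 1)) *
        ((1 + 16 * Cχ * K) * (ε⁻¹) ^ 2) ^ e * M := by gcongr
    _ = _ := by
      rw [mul_pow, ← pow_mul, show 2 * e + m + 1 = 2 * e + (m + 1) by ring, pow_add ε, inv_pow]
      field_simp

theorem exists_extVal_determination [MeasurableSpace E] [BorelSpace E] (𝒜 : Set (E ≃ₗᵢ[ℝ] E))
    (htr : ∀ u v : E, ‖u‖ = 1 → ‖v‖ = 1 → ∃ A ∈ 𝒜, A u = v) :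
    ∃ (ι : Type) (_ : Fintype ι) (ψ : ℝ → ι → E → ℝ), (∀ ε i, ContDiff ℝ ∞ (ψ ε i)) ∧
      ∀ h : E → ℝ, ContDiff ℝ ∞ h →
      ∃ C ε₀ : ℝ, 0 < ε₀ ∧ ∀ ε, 0 < ε → ε ≤ ε₀ → ∀ (μ : ConvexBody E → ℝ) (M : ℝ), IsCTV μ →
        UnitBound μ M → (∀ A ∈ 𝒜, ∀ K L : ConvexBody E, (L : Set E) = A '' K → μ L = μ K) →
        (∀ i, extVal μ (ψ ε i) = 0) → |extVal μ h| ≤ C * ε * M := by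
  obtain ⟨x₀, hx₀⟩ := exists_norm_eq E (zero_le_one (α := ℝ))
  obtain ⟨CB, e, hCB0, hCB⟩ := exists_abs_dVal_add_le E
  obtain ⟨Ca, hCa0, hCa⟩ := exists_abs_dVal_le_of_cutoff (E := E)
    (fun u v hu hv => let ⟨A, _, h⟩ := htr u v hu hv; ⟨A, h⟩)
  obtain ⟨Cχ, hCχ1, hCχ⟩ := exists_norm_iteratedFDeriv_cutoff_le E
  set m := finrank ℝ E
  set N := 2 * e + m + 4 with hN
  obtain ⟨d, q, Cq, hCq0, hq, hproj⟩ := exists_jet_projection hx₀.le (N := N) (by omega)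
  have h1s : ContDiff ℝ ∞ (fun _ : E => (1 : ℝ)) := contDiff_const
  refine ⟨Option (Fin d ⊕ Fin d → Fin (polyDeg E + 1)), inferInstance, fun ε o => o.elim
    (fun _ => 1) fun a => ∑ i, ((a i : ℕ) : ℝ) •
      Sum.elim (fun k => cutoff (2 * ε) x₀ * q k) (fun k => cutoff ε x₀ * q k) i, ?_, ?_⟩
  · rintro ε (_ | a)
    · exact h1s
    · refine contDiff_sum_smul _ ?_ _
      rintro (k | k)
      · exact (contDiff_cutoff _ _).mul (hq k)
      · exact (contDiff_cutoff _ _).mul (hq k)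
  intro h hh
  set φ : E → ℝ := h - fun _ => 1 with hφdef
  have hφ : ContDiff ℝ ∞ φ := hh.sub h1s
  obtain ⟨B, hB0, hBφ, hBg⟩ := exists_norm_iteratedFDeriv_one_add_smul_le hφ (N + 1)
  have hCχ0 : 0 ≤ Cχ := by linarith
  set K1 := 16 * Cχ * (Cq * B)
  set K2 := K1 * 4 ^ (N - 1)
  have hK1 : 0 ≤ K1 := by positivity
  have hK2 : 0 ≤ K2 := by positivity
  refine ⟨Ca * (CB * K2 * (1 + K1) ^ e), min (1 / 4) (1 / ((1 + polyDeg E) * K2 + 1)),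
    by positivity, ?_⟩
  intro ε hε hεle μ M hμ hM hinv h0
  have hM0 := hM.nonneg
  have hε4 : 4 * ε ≤ 1 := by linarith [hεle.trans (min_le_left _ _)]
  have hε5 : (1 + polyDeg E) * K2 * ε ≤ 1 := by
    have h1 := hεle.trans (min_le_right _ _)
    rw [le_div_iff₀ (by positivity)] at h1
    nlinarith
  obtain ⟨S, hS⟩ := exists_nice_of_contDiff (contDiff_infty.1 hφ 2)
  obtain ⟨S', hS'⟩ := exists_nice_of_contDiff (contDiff_infty.1 h1s 2)
  obtain ⟨t, ht, hval⟩ := hμ.exists_extVal_sub_eq_dVal hS' hS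
  have e0 : (fun _ : E => (1 : ℝ)) + φ = h := by rw [hφdef]; abel
  have h00 : extVal μ (fun _ : E => (1 : ℝ)) = 0 := h0 none
  rw [e0, h00, sub_zero] at hval
  rw [hval]
  set g : E → ℝ := (fun _ => 1) + t • φ with hg
  have hgs : ContDiff ℝ ∞ g := h1s.add (hφ.const_smul t)
  obtain ⟨T, hT⟩ := exists_nice_of_contDiff (contDiff_infty.1 hgs 2)
  have key := hCa μ g φ T ε (CB * K2 * (1 + K1) ^ e * ε ^ (m + 1) * M) hμ hT hφ hε (by linarith) ?_
  · refine key.trans (le_of_eq ?_)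
    rw [inv_pow, pow_succ]
    field_simp
  intro y hy
  obtain ⟨A, hA, rfl⟩ := htr x₀ y hx₀ hy
  rw [hμ.dVal_cutoff_mul (hinv A hA) hgs hφ hε]
  have hAs : ContDiff ℝ ∞ A := A.contDiff
  have jet : ∀ f : E → ℝ, (∀ j ≤ N + 1, ∀ x : E, ‖x‖ ≤ 1 → ‖iteratedFDeriv ℝ j f x‖ ≤ B) →
      ∀ j ≤ N + 1, ∀ x : E, ‖x‖ ≤ 1 → ‖iteratedFDeriv ℝ j (f ∘ A) x‖ ≤ B := by
    intro f hf j hj x hx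
    rw [LinearIsometryEquiv.norm_iteratedFDeriv_comp_right]
    exact hf j hj _ (by rwa [A.norm_map])
  obtain ⟨c, hc, hr⟩ := hproj (g ∘ A) (hgs.comp hAs) B (jet g (hBg t ht))
  obtain ⟨c', hc', hr'⟩ := hproj (φ ∘ A) (hφ.comp hAs) B (jet φ hBφ)
  exact hμ.abs_dVal_cutoff_mul_le (hCB μ M hμ hM) hM0 hCB0 hCχ1 hCχ hN hCq0 hB0 hq hε hε4 hε5
    (fun a => h0 (some a)) (hgs.comp hAs) (hφ.comp hAs) hc hc' hr hr'

end Determination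

section FiniteDimensionality

open Set Module Filter Topology
open scoped ContDiff

variable {E : Type*} [NormedAddCommGroup E] [InnerProductSpace ℝ E] [FiniteDimensional ℝ E]
  [Nontrivial E]

lemma extVal_zero (φ : E → ℝ) : extVal (0 : ConvexBody E → ℝ) φ = 0 := by
  have h := extVal_add_smul (0 : ConvexBody E → ℝ) 0 1 φ
  simp only [smul_zero, add_zero, one_mul] at h
  linarith

/-- The polynomial extension as a linear functional of the valuation. -/
def extValHom (φ : E → ℝ) : (ConvexBody E → ℝ) →ₗ[ℝ] ℝ where
  toFun μ := extVal μ φ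
  map_add' μ ν := by simpa using extVal_add_smul μ ν 1 φ
  map_smul' c μ := by simpa [extVal_zero] using extVal_add_smul 0 μ c φ

lemma IsCTV.eq_zero_of_extVal [MeasurableSpace E] [BorelSpace E] {μ : ConvexBody E → ℝ}
    (hμ : IsCTV μ) (h : ∀ f : E → ℝ, ContDiff ℝ ∞ f → extVal μ f = 0) : μ = 0 := by
  funext K
  choose f hf hs hb using fun k : ℕ => exists_smooth_supp_approx K.isCompact K.nonempty
    (Nat.one_div_pos_of_nat (α := ℝ) (n := k))
  have h1 := tendsto_onSupp hμ.cont hs (supp_suppFun K.isCompact K.nonempty)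
    (tendsto_one_div_add_atTop_nhds_zero_nat (𝕜 := ℝ)) (fun k => by positivity)
    (fun k u _ => hb k u)
  have h2 : ∀ k, onSupp μ (f k) = 0 := fun k => by rw [← hμ.extVal_of_supp (hs k), h _ (hf k)]
  simp_rw [h2, onSupp_suppFun] at h1
  exact tendsto_nhds_unique h1 tendsto_const_nhds

/-- The continuous translation invariant valuations invariant under a set of isometries. -/
def invVal (𝒜 : Set (E ≃ₗᵢ[ℝ] E)) : Submodule ℝ (ConvexBody E → ℝ) where
  carrier := {μ | IsCTV μ ∧ ∀ A ∈ 𝒜, ∀ K L : ConvexBody E, (L : Set E) = A '' K → μ L = μ K}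
  add_mem' {μ ν} hμ hν := ⟨by simpa using hμ.1.add_smul hν.1 1, fun A hA K L h => by
    simp only [Pi.add_apply, hμ.2 A hA K L h, hν.2 A hA K L h]⟩
  zero_mem' := ⟨⟨fun _ _ _ _ _ _ => by simp, fun _ _ => rfl, continuous_const⟩,
    fun _ _ _ _ _ => rfl⟩
  smul_mem' c μ hμ := ⟨⟨fun K L M I h1 h2 => by
      simp only [Pi.smul_apply, smul_eq_mul, ← mul_add, hμ.1.val K L M I h1 h2],
    fun K x => by simp only [Pi.smul_apply, hμ.1.trans K x], hμ.1.cont.const_smul c⟩,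
    fun A hA K L h => by simp only [Pi.smul_apply, hμ.2 A hA K L h]⟩

lemma mem_invVal {𝒜 : Set (E ≃ₗᵢ[ℝ] E)} {μ : ConvexBody E → ℝ} : μ ∈ invVal 𝒜 ↔
    IsCTV μ ∧ ∀ A ∈ 𝒜, ∀ K L : ConvexBody E, (L : Set E) = A '' K → μ L = μ K := Iff.rfl

theorem finiteDimensional_invVal [MeasurableSpace E] [BorelSpace E] (𝒜 : Set (E ≃ₗᵢ[ℝ] E))
    (htr : ∀ u v : E, ‖u‖ = 1 → ‖v‖ = 1 → ∃ A ∈ 𝒜, A u = v) :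
    FiniteDimensional ℝ (invVal 𝒜) := by
  classical
  obtain ⟨ι, _, ψ, -, hψ⟩ := exists_extVal_determination 𝒜 htr
  refine rank_lt_aleph0_iff.1 ((rank_le (n := Fintype.card ι) fun s hs => ?_).trans_lt
    (Cardinal.natCast_lt_aleph0))
  by_contra! hcard
  let S : (s → ℝ) →ₗ[ℝ] (ConvexBody E → ℝ) :=
    (invVal 𝒜).subtype ∘ₗ Fintype.linearCombination ℝ (fun i : s => (i : invVal 𝒜))
  have hS : ∀ c, S c = ∑ i, c i • ((i : invVal 𝒜) : ConvexBody E → ℝ) := fun c => by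
    simp [S, Fintype.linearCombination_apply]
  have hSm : ∀ c, S c ∈ invVal 𝒜 := fun c => Subtype.property _
  choose M hM using fun i : s => exists_unitBound (i : invVal 𝒜).2.1.cont
  have hMS : ∀ c : s → ℝ, ‖c‖ = 1 → UnitBound (S c) (∑ i, M i) := by
    intro c hc K hK
    rw [hS, Finset.sum_apply]
    refine (Finset.abs_sum_le_sum_abs _ _).trans (Finset.sum_le_sum fun i _ => ?_)
    rw [Pi.smul_apply, smul_eq_mul, abs_mul]
    have h1 : |c i| ≤ 1 := hc ▸ norm_le_pi_norm c i
    exact (mul_le_of_le_one_left (abs_nonneg _) h1).trans (hM i K hK)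
  have hex : ∀ ε : ℝ, ∃ c : s → ℝ, ‖c‖ = 1 ∧ ∀ i, extVal (S c) (ψ ε i) = 0 := by
    intro ε
    let T : (s → ℝ) →ₗ[ℝ] (ι → ℝ) := LinearMap.pi fun i => extValHom (ψ ε i) ∘ₗ S
    have hker : LinearMap.ker T ≠ ⊥ := LinearMap.ker_ne_bot_of_finrank_lt (by simpa using hcard)
    obtain ⟨c, hc, hc0⟩ := (Submodule.ne_bot_iff _).1 hker
    refine ⟨‖c‖⁻¹ • c, norm_smul_inv_norm hc0, fun i => ?_⟩
    have h1 : T (‖c‖⁻¹ • c) = 0 := by rw [map_smul, LinearMap.mem_ker.1 hc, smul_zero]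
    exact congrFun h1 i
  choose c hc1 hc0 using fun k : ℕ => hex (1 / ((k : ℝ) + 1))
  obtain ⟨a, ha, θ, hθ, hlim⟩ := (isCompact_sphere (0 : s → ℝ) 1).tendsto_subseq
    (x := c) (fun k => by simpa using hc1 k)
  have ha1 : ‖a‖ = 1 := by simpa using ha
  have hz : S a = 0 := by
    refine (hSm a).1.eq_zero_of_extVal fun f hf => ?_
    obtain ⟨C, ε₀, hε₀, hC⟩ := hψ f hf
    have hcont : Continuous (extValHom f ∘ₗ S) := LinearMap.continuous_of_finiteDimensional _
    have h1 : Tendsto (fun k => |extVal (S (c (θ k))) f|) atTop (𝓝 |extVal (S a) f|) :=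
      ((hcont.tendsto a).comp hlim).abs
    have hε : Tendsto (fun k => 1 / ((θ k : ℝ) + 1)) atTop (𝓝 0) :=
      (tendsto_one_div_add_atTop_nhds_zero_nat (𝕜 := ℝ)).comp hθ.tendsto_atTop
    have h2 : Tendsto (fun k => C * (1 / ((θ k : ℝ) + 1)) * ∑ i, M i) atTop (𝓝 0) := by
      simpa using (hε.const_mul C).mul_const (∑ i, M i)
    have h3 : ∀ᶠ k in atTop, |extVal (S (c (θ k))) f| ≤ C * (1 / ((θ k : ℝ) + 1)) * ∑ i, M i := by
      filter_upwards [hε.eventually (gt_mem_nhds hε₀)] with k hk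
      exact hC _ (by positivity) hk.le _ _ (hSm _).1 (hMS _ (hc1 _)) (hSm _).2 (hc0 _)
    exact abs_nonpos_iff.1 (le_of_tendsto_of_tendsto h1 h2 h3)
  have hz' : Fintype.linearCombination ℝ (fun i : s => (i : invVal 𝒜)) a = 0 :=
    Subtype.val_injective hz
  have ha0 : a = 0 := by
    funext i
    exact Fintype.linearIndependent_iff.1 hs a
      (by simpa [Fintype.linearCombination_apply] using hz') i
  rw [ha0, norm_zero] at ha1
  exact zero_ne_one ha1

end FiniteDimensionality

section MatrixAction

open Set Module Filter Topology Metric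

variable {n : ℕ}

/-- The continuous linear map of a matrix. -/
def matCLM (A : Matrix (Fin n) (Fin n) ℝ) : Eucl n →L[ℝ] Eucl n :=
  LinearMap.toContinuousLinearMap (Matrix.toEuclideanLin A)

lemma matCLM_apply (A : Matrix (Fin n) (Fin n) ℝ) (x : Eucl n) :
    matCLM A x = Matrix.toEuclideanLin A x := rfl

lemma continuous_matCLM : Continuous (matCLM (n := n)) := by
  have h : Continuous ((LinearMap.toContinuousLinearMap (𝕜 := ℝ) (E := Eucl n) (F' := Eucl n)
    ).toLinearMap ∘ₗ (Matrix.toEuclideanLin (𝕜 := ℝ) (m := Fin n) (n := Fin n)).toLinearMap) :=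
    LinearMap.continuous_of_finiteDimensional _
  exact h

lemma coe_matBody (A : Matrix (Fin n) (Fin n) ℝ) (K : ConvexBody (Eucl n)) :
    (matBody A K : Set (Eucl n)) = Matrix.toEuclideanLin A '' K := rfl

lemma matBody_mul (A B : Matrix (Fin n) (Fin n) ℝ) (K : ConvexBody (Eucl n)) :
    matBody (A * B) K = matBody A (matBody B K) := by
  refine ConvexBody.ext ?_
  rw [coe_matBody, coe_matBody, coe_matBody, image_image]
  refine image_congr fun x _ => ?_
  simp [Matrix.toLpLin_apply]

lemma matBody_one (K : ConvexBody (Eucl n)) : matBody 1 K = K := by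
  refine ConvexBody.ext ?_
  rw [coe_matBody]
  simp

lemma dist_matBody_le (A B : Matrix (Fin n) (Fin n) ℝ) {K L : ConvexBody (Eucl n)} {R : ℝ}
    (hK : (K : Set (Eucl n)) ⊆ closedBall 0 R) :
    dist (matBody A K) (matBody B L) ≤ ‖matCLM A - matCLM B‖ * R + ‖matCLM B‖ * dist K L := by
  obtain ⟨z, hz⟩ := K.nonempty
  have hR : 0 ≤ R := (norm_nonneg z).trans (by simpa using hK hz)
  have key : ∀ x ∈ K, ∀ y : Eucl n, dist x y ≤ dist K L →
      dist (Matrix.toEuclideanLin A x) (Matrix.toEuclideanLin B y) ≤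
        ‖matCLM A - matCLM B‖ * R + ‖matCLM B‖ * dist K L := by
    intro x hx y hy
    have hxR : ‖x‖ ≤ R := by simpa using hK hx
    rw [dist_eq_norm, ← matCLM_apply, ← matCLM_apply]
    have e : matCLM A x - matCLM B y = (matCLM A - matCLM B) x + matCLM B (x - y) := by
      simp only [sub_apply, map_sub]; abel
    rw [e]
    refine (norm_add_le _ _).trans (add_le_add ?_ ?_)
    · exact ((matCLM A - matCLM B).le_opNorm x).trans (by gcongr)
    · exact ((matCLM B).le_opNorm _).trans (by rw [← dist_eq_norm]; gcongr)
  have near : ∀ K L : ConvexBody (Eucl n), ∀ x ∈ K, ∃ y ∈ L, dist x y ≤ dist K L := by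
    intro K L x hx
    obtain ⟨y, hy, h⟩ := L.isCompact.exists_infDist_eq_dist L.nonempty x
    exact ⟨y, hy, h ▸ infDist_le_hausdorffDist_of_mem hx ConvexBody.hausdorffEDist_ne_top⟩
  refine hausdorffDist_le_of_mem_dist (by positivity) ?_ ?_
  · rintro _ ⟨x, hx, rfl⟩
    obtain ⟨y, hy, h⟩ := near K L x hx
    exact ⟨_, ⟨y, hy, rfl⟩, key x hx y h⟩
  · rintro _ ⟨y, hy, rfl⟩
    obtain ⟨x, hx, h⟩ := near L K y hy
    exact ⟨_, ⟨x, hx, rfl⟩, by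
      rw [dist_comm]; exact key x hx y (by rwa [dist_comm x, dist_comm K])⟩

lemma continuous_matBody :
    Continuous fun p : Matrix (Fin n) (Fin n) ℝ × ConvexBody (Eucl n) => matBody p.1 p.2 := by
  refine continuous_iff_continuousAt.2 fun ⟨A, K⟩ => tendsto_iff_dist_tendsto_zero.2 ?_
  obtain ⟨R, hR⟩ := K.isBounded.subset_closedBall 0
  have hb : ∀ p : Matrix (Fin n) (Fin n) ℝ × ConvexBody (Eucl n),
      dist (matBody p.1 p.2) (matBody A K) ≤
        ‖matCLM A - matCLM p.1‖ * R + ‖matCLM p.1‖ * dist K p.2 := fun p => by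
    rw [dist_comm]
    exact dist_matBody_le A p.1 hR
  refine squeeze_zero (fun _ => dist_nonneg) hb ?_
  have h : Continuous fun p : Matrix (Fin n) (Fin n) ℝ × ConvexBody (Eucl n) =>
      ‖matCLM A - matCLM p.1‖ * R + ‖matCLM p.1‖ * dist K p.2 := by
    have := continuous_matCLM (n := n)
    fun_prop
  simpa using h.tendsto (A, K)

instance : WeaklyLocallyCompactSpace (ConvexBody (Eucl n)) where
  exists_compact_mem_nhds K := by
    obtain ⟨R, hR⟩ := K.isBounded.subset_closedBall 0
    refine ⟨_, isCompact_bodies (isCompact_closedBall (0 : Eucl n) (R + 1)),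
      mem_of_superset (ball_mem_nhds K one_pos) fun L hL x hx => ?_⟩
    obtain ⟨y, hy, hxy⟩ := exists_dist_lt_of_hausdorffDist_lt hx (mem_ball.1 hL)
      ConvexBody.hausdorffEDist_ne_top
    have h1 := mem_closedBall.1 (hR hy)
    exact mem_closedBall.2 ((dist_triangle x y 0).trans (by linarith))

instance : CompactSpace (UnitBodies n) :=
  isCompact_iff_compactSpace.1 (isCompact_bodies (isCompact_closedBall (0 : Eucl n) 1))

lemma isOpen_isUnit_of : IsOpen {A : MatN n | IsUnit (Matrix.of A)} := by
  simp_rw [Matrix.isUnit_iff_isUnit_det, isUnit_iff_ne_zero]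
  exact isOpen_ne_fun (Continuous.matrix_det continuous_id) continuous_const

lemma continuousAt_inv_of {A : MatN n} (hA : IsUnit (Matrix.of A)) :
    ContinuousAt (fun B : MatN n => (Matrix.of B)⁻¹) A := by
  have h := (Matrix.isUnit_iff_isUnit_det _).1 hA
  refine ContinuousAt.comp (g := fun B : Matrix (Fin n) (Fin n) ℝ => B⁻¹)
    (continuousAt_matrix_inv _ ?_) (f := fun B : MatN n => Matrix.of B) continuous_id.continuousAt
  rw [Ring.inverse_eq_inv']
  exact continuousAt_inv₀ h.ne_zero

lemma continuousAt_inv_matBody {μ : ConvexBody (Eucl n) → ℝ} (hμ : Continuous μ) {A : MatN n}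
    (hA : IsUnit (Matrix.of A)) (K : ConvexBody (Eucl n)) :
    ContinuousAt (fun p : MatN n × ConvexBody (Eucl n) => μ (matBody (Matrix.of p.1)⁻¹ p.2))
      (A, K) := by
  have h1 : Tendsto (fun p : MatN n × ConvexBody (Eucl n) => ((Matrix.of p.1)⁻¹, p.2))
      (𝓝 (A, K)) (𝓝 ((Matrix.of A)⁻¹, K)) := by
    rw [nhds_prod_eq, nhds_prod_eq]
    exact (continuousAt_inv_of hA).tendsto.prodMap tendsto_id
  have h2 : Continuous fun p : Matrix (Fin n) (Fin n) ℝ × ConvexBody (Eucl n) =>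
    μ (matBody p.1 p.2) := hμ.comp continuous_matBody
  have h3 := (h2.tendsto ((Matrix.of A)⁻¹, K)).comp h1
  exact h3

lemma continuous_matBody_left (A : Matrix (Fin n) (Fin n) ℝ) :
    Continuous fun K : ConvexBody (Eucl n) => matBody A K := by
  have h : Continuous fun K : ConvexBody (Eucl n) => (A, K) := by fun_prop
  exact Continuous.comp (g := fun p : Matrix (Fin n) (Fin n) ℝ × ConvexBody (Eucl n) =>
    matBody p.1 p.2) continuous_matBody h

/-- The function `K ↦ μ (A⁻¹ K)` on the bodies in the unit ball. -/
def orbitMap {μ : ConvexBody (Eucl n) → ℝ} (hμ : Continuous μ) (A : MatN n) :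
    BoundedContinuousFunction (UnitBodies n) ℝ :=
  BoundedContinuousFunction.mkOfCompact ⟨fun K => μ (matBody (Matrix.of A)⁻¹ K.1),
    (hμ.comp (continuous_matBody_left _)).comp continuous_subtype_val⟩

lemma orbitMap_apply {μ : ConvexBody (Eucl n) → ℝ} (hμ : Continuous μ) (A : MatN n)
    (K : UnitBodies n) : orbitMap hμ A K = μ (matBody (Matrix.of A)⁻¹ K.1) := rfl

lemma continuousOn_orbitMap {μ : ConvexBody (Eucl n) → ℝ} (hμ : Continuous μ) :
    ContinuousOn (orbitMap hμ) {A : MatN n | IsUnit (Matrix.of A)} := by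
  have h : ContinuousOn (fun A : MatN n =>
      (⟨fun K : UnitBodies n => μ (matBody (Matrix.of A)⁻¹ K.1),
        (hμ.comp (continuous_matBody_left _)).comp continuous_subtype_val⟩ :
          C(UnitBodies n, ℝ))) {A : MatN n | IsUnit (Matrix.of A)} := by
    refine ContinuousMap.continuousOn_of_continuousOn_uncurry _ ?_
    rintro ⟨A, K⟩ ⟨hA, -⟩
    refine ContinuousAt.continuousWithinAt ?_
    exact ContinuousAt.comp (g := fun p : MatN n × ConvexBody (Eucl n) =>
      μ (matBody (Matrix.of p.1)⁻¹ p.2)) (f := fun p : MatN n × UnitBodies n => (p.1, p.2.1))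
      (continuousAt_inv_matBody hμ hA K.1) (by fun_prop)
  exact (ContinuousMap.isometryEquivBoundedOfCompact (UnitBodies n) ℝ).continuous.comp_continuousOn h

end MatrixAction

section Mollifiers

open Set Module Filter Topology Metric
open scoped ContDiff

variable {n : ℕ}

/-- The matrix product on `MatN n`. -/
def mulN (A B : MatN n) : MatN n := fun i j => ∑ k, A i k * B k j

/-- The matrix inverse on `MatN n`. -/
def invN (A : MatN n) : MatN n := fun i j => (Matrix.of A)⁻¹ i j

/-- The identity matrix as an element of `MatN n`. -/
def oneN (n : ℕ) : MatN n := fun i j => (1 : Matrix (Fin n) (Fin n) ℝ) i j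

lemma of_mulN (A B : MatN n) : Matrix.of (mulN A B) = Matrix.of A * Matrix.of B := by
  ext i j
  simp [mulN, Matrix.mul_apply]

lemma of_invN (A : MatN n) : Matrix.of (invN A) = (Matrix.of A)⁻¹ := rfl

lemma of_oneN : Matrix.of (oneN n) = 1 := rfl

lemma mulN_assoc (A B C : MatN n) : mulN (mulN A B) C = mulN A (mulN B C) :=
  Matrix.of.injective (by simp only [of_mulN, mul_assoc])

lemma oneN_mulN (A : MatN n) : mulN (oneN n) A = A :=
  Matrix.of.injective (by rw [of_mulN, of_oneN, one_mul])

lemma mulN_oneN (A : MatN n) : mulN A (oneN n) = A :=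
  Matrix.of.injective (by rw [of_mulN, of_oneN, mul_one])

lemma invN_mulN {A : MatN n} (hA : IsUnit (Matrix.of A)) : mulN (invN A) A = oneN n :=
  Matrix.of.injective (by
    rw [of_mulN, of_invN, of_oneN, Matrix.nonsing_inv_mul _ ((Matrix.isUnit_iff_isUnit_det _).1 hA)])

lemma mulN_invN {A : MatN n} (hA : IsUnit (Matrix.of A)) : mulN A (invN A) = oneN n :=
  Matrix.of.injective (by
    rw [of_mulN, of_invN, of_oneN, Matrix.mul_nonsing_inv _ ((Matrix.isUnit_iff_isUnit_det _).1 hA)])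

lemma mulN_add (A B C : MatN n) : mulN A (B + C) = mulN A B + mulN A C := by
  ext i j
  simp [mulN, mul_add, Finset.sum_add_distrib]

lemma add_mulN (A B C : MatN n) : mulN (A + B) C = mulN A C + mulN B C := by
  ext i j
  simp [mulN, add_mul, Finset.sum_add_distrib]

lemma mulN_smul (c : ℝ) (A B : MatN n) : mulN A (c • B) = c • mulN A B := by
  ext i j
  simp [mulN, Finset.mul_sum, mul_left_comm]

lemma smul_mulN (c : ℝ) (A B : MatN n) : mulN (c • A) B = c • mulN A B := by
  ext i j
  simp [mulN, Finset.mul_sum, mul_assoc]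

lemma contDiff_mulN {k : ℕ∞ω} : ContDiff ℝ k fun p : MatN n × MatN n => mulN p.1 p.2 := by
  unfold mulN
  fun_prop

lemma continuous_mulN : Continuous fun p : MatN n × MatN n => mulN p.1 p.2 :=
  contDiff_mulN (k := 0).continuous

lemma contDiff_det {k : ℕ∞ω} {X : Type*} [NormedAddCommGroup X] [NormedSpace ℝ X]
    {M : X → Matrix (Fin n) (Fin n) ℝ} (hM : ∀ i j, ContDiff ℝ k fun x => M x i j) :
    ContDiff ℝ k fun x => (M x).det := by
  simp_rw [Matrix.det_apply]
  exact ContDiff.sum fun σ _ => (contDiff_prod fun i _ => hM _ _).const_smul _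

lemma contDiffOn_invN {k : ℕ∞ω} :
    ContDiffOn ℝ k (invN (n := n)) {A : MatN n | IsUnit (Matrix.of A)} := by
  refine contDiffOn_pi.2 fun i => contDiffOn_pi.2 fun j => ?_
  have hc : ∀ i j, ContDiff ℝ k fun A : MatN n => Matrix.of A i j := fun i j => by
    simp only [Matrix.of_apply]
    fun_prop
  have h1 : ContDiff ℝ k fun A : MatN n => (Matrix.of A).det := contDiff_det hc
  have h2 : ContDiff ℝ k fun A : MatN n => (Matrix.of A).adjugate i j := by
    simp_rw [Matrix.adjugate_apply]
    refine contDiff_det fun a b => ?_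
    by_cases hab : a = j
    · subst hab
      simpa using contDiff_const
    · simpa [Matrix.updateRow_ne hab] using hc a b
  have h3 : ContDiffOn ℝ k (fun A : MatN n => (Matrix.of A).det⁻¹ * (Matrix.of A).adjugate i j)
      {A : MatN n | IsUnit (Matrix.of A)} :=
    (h1.contDiffOn.inv fun A hA => ((Matrix.isUnit_iff_isUnit_det _).1 hA).ne_zero).mul
      h2.contDiffOn
  refine h3.congr fun A hA => ?_
  simp [invN, Ring.inverse_eq_inv', Matrix.inv_def]

/-- Left multiplication by an invertible matrix as a linear equivalence. -/
def mulLeftEquiv {B : MatN n} (hB : IsUnit (Matrix.of B)) : MatN n ≃ₗ[ℝ] MatN n where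
  toFun C := mulN B C
  invFun C := mulN (invN B) C
  map_add' C D := mulN_add B C D
  map_smul' c C := mulN_smul c B C
  left_inv C := by
    beta_reduce
    rw [← mulN_assoc, invN_mulN hB, oneN_mulN]
  right_inv C := by
    beta_reduce
    rw [← mulN_assoc, mulN_invN hB, oneN_mulN]

/-- Conjugation by an invertible matrix as a linear equivalence. -/
def conjEquiv {g : MatN n} (hg : IsUnit (Matrix.of g)) : MatN n ≃ₗ[ℝ] MatN n where
  toFun C := mulN (invN g) (mulN C g)
  invFun C := mulN g (mulN C (invN g))
  map_add' C D := by rw [add_mulN, mulN_add]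
  map_smul' c C := by rw [smul_mulN, mulN_smul]; rfl
  left_inv C := by
    beta_reduce
    rw [← mulN_assoc, ← mulN_assoc, mulN_invN hg, oneN_mulN, mulN_assoc, mulN_invN hg, mulN_oneN]
  right_inv C := by
    beta_reduce
    rw [mulN_assoc g, ← mulN_assoc (invN g), invN_mulN hg, oneN_mulN, mulN_assoc C, invN_mulN hg,
      mulN_oneN]

lemma exists_integral_comp_linearEquiv {X : Type*} [NormedAddCommGroup X] [NormedSpace ℝ X]
    [MeasurableSpace X] [BorelSpace X] [FiniteDimensional ℝ X] (ν : Measure X) [ν.IsAddHaarMeasure]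
    (e : X ≃ₗ[ℝ] X) : ∃ c : ℝ, ∀ F : X → ℝ, ∫ x, F (e x) ∂ν = c * ∫ x, F x ∂ν := by
  refine ⟨(ENNReal.ofReal |(LinearMap.det (e : X →ₗ[ℝ] X))⁻¹|).toReal, fun F => ?_⟩
  have h := e.toContinuousLinearEquiv.toHomeomorph.measurableEmbedding.integral_map (μ := ν) F
  have h2 := Measure.map_linearMap_addHaar_eq_smul_addHaar ν e.isUnit_det'.ne_zero
  have h3 : Measure.map e.toContinuousLinearEquiv.toHomeomorph ν =
      Measure.map (⇑(e : X →ₗ[ℝ] X)) ν := rfl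
  rw [h3, h2, integral_smul_measure] at h
  exact h.symm

/-- A smooth probability density on matrices, supported on invertible matrices and invariant under
conjugation by orthogonal matrices. -/
structure IsMollifier (f : MatN n → ℝ) : Prop where
  smooth : ContDiff ℝ ((⊤ : ℕ∞) : ℕ∞ω) f
  compact : HasCompactSupport f
  unit : tsupport f ⊆ {A : MatN n | IsUnit (Matrix.of A)}
  nonneg : ∀ A, 0 ≤ f A
  integral : ∫ A, f A = 1
  conj : ∀ g : MatN n, Matrix.of g ∈ Matrix.orthogonalGroup (Fin n) ℝ →
    ∀ A, f (mulN (invN g) (mulN A g)) = f A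

/-- The squared Frobenius distance to the identity. -/
def sqDistOne (A : MatN n) : ℝ := ∑ i, ∑ j, (A i j - oneN n i j) ^ 2

lemma sqDistOne_eq_trace (A : MatN n) :
    sqDistOne A = ((Matrix.of A - 1).transpose * (Matrix.of A - 1)).trace := by
  rw [sqDistOne, Finset.sum_comm]
  simp only [Matrix.trace, Matrix.diag_apply, Matrix.mul_apply, Matrix.transpose_apply,
    Matrix.sub_apply, Matrix.of_apply, sq]
  rfl

lemma isUnit_of_mem_orthogonalGroup {g : Matrix (Fin n) (Fin n) ℝ}
    (hg : g ∈ Matrix.orthogonalGroup (Fin n) ℝ) : IsUnit g :=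
  IsUnit.of_mul_eq_one _ ((Matrix.mem_orthogonalGroup_iff _ _).1 hg)

lemma inv_eq_transpose {g : Matrix (Fin n) (Fin n) ℝ}
    (hg : g ∈ Matrix.orthogonalGroup (Fin n) ℝ) : g⁻¹ = g.transpose :=
  Matrix.inv_eq_right_inv ((Matrix.mem_orthogonalGroup_iff _ _).1 hg)

lemma sqDistOne_conj {g : MatN n} (hg : Matrix.of g ∈ Matrix.orthogonalGroup (Fin n) ℝ)
    (A : MatN n) : sqDistOne (mulN (invN g) (mulN A g)) = sqDistOne A := by
  rw [sqDistOne_eq_trace, sqDistOne_eq_trace, of_mulN, of_mulN, of_invN, inv_eq_transpose hg]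
  set M := Matrix.of A
  set h := Matrix.of g
  have h1 : h * h.transpose = 1 := (Matrix.mem_orthogonalGroup_iff _ _).1 hg
  have h2 : h.transpose * h = 1 := mul_eq_one_comm.1 h1
  have e : h.transpose * (M * h) - 1 = h.transpose * (M - 1) * h := by
    rw [mul_sub, sub_mul, mul_one, h2, mul_assoc]
  have e2 : (h.transpose * (M - 1) * h).transpose * (h.transpose * (M - 1) * h) =
      h.transpose * ((M - 1).transpose * (h * h.transpose) * (M - 1)) * h := by
    simp only [Matrix.transpose_mul, Matrix.transpose_transpose, mul_assoc]
  rw [e, e2, h1, mul_one, Matrix.trace_mul_comm, ← mul_assoc, h1, one_mul]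

lemma exists_isMollifier {U : Set (MatN n)} (hU : U ∈ 𝓝 (oneN n)) :
    ∃ f : MatN n → ℝ, IsMollifier f ∧ tsupport f ⊆ U := by
  have hGL : {A : MatN n | IsUnit (Matrix.of A)} ∈ 𝓝 (oneN n) :=
    isOpen_isUnit_of.mem_nhds (by simp [of_oneN])
  obtain ⟨δ, hδ, hball⟩ := nhds_basis_closedBall.mem_iff.1 (inter_mem hU hGL)
  have hq : ContDiff ℝ ((⊤ : ℕ∞) : ℕ∞ω) (sqDistOne (n := n)) := by
    unfold sqDistOne
    fun_prop
  let f₀ : MatN n → ℝ := fun A => Real.smoothTransition (1 - sqDistOne A / δ ^ 2)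
  have hf₀ : ContDiff ℝ ((⊤ : ℕ∞) : ℕ∞ω) f₀ :=
    Real.smoothTransition.contDiff.comp (contDiff_const.sub (hq.div_const _))
  have hsupp : tsupport f₀ ⊆ closedBall (oneN n) δ := by
    refine closure_minimal (fun A hA => ?_) isClosed_closedBall
    have h1 : sqDistOne A < δ ^ 2 := by
      by_contra! h
      refine hA (Real.smoothTransition.zero_of_nonpos ?_)
      have := (one_le_div (by positivity)).2 h
      linarith
    refine mem_closedBall.2 ((dist_pi_le_iff hδ.le).2 fun i => (dist_pi_le_iff hδ.le).2 fun j => ?_)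
    have h2 : (A i j - oneN n i j) ^ 2 ≤ sqDistOne A :=
      (Finset.single_le_sum (f := fun j => (A i j - oneN n i j) ^ 2)
        (fun _ _ => sq_nonneg _) (Finset.mem_univ j)).trans
      (Finset.single_le_sum (f := fun i => ∑ j, (A i j - oneN n i j) ^ 2)
        (fun _ _ => Finset.sum_nonneg fun _ _ => sq_nonneg _) (Finset.mem_univ i))
    rw [Real.dist_eq]
    exact abs_le_of_sq_le_sq (h2.trans h1.le) hδ.le
  have hcomp : HasCompactSupport f₀ :=
    (isCompact_closedBall _ _).of_isClosed_subset (isClosed_tsupport _) hsupp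
  have h0 : ∀ A, 0 ≤ f₀ A := fun A => Real.smoothTransition.nonneg _
  have hpos : 0 < ∫ A, f₀ A := by
    refine hf₀.continuous.integral_pos_of_hasCompactSupport_nonneg_nonzero hcomp h0
      (x := oneN n) ?_
    simp [f₀, sqDistOne]
  have hts : tsupport (fun A => (∫ B, f₀ B)⁻¹ * f₀ A) ⊆ tsupport f₀ :=
    closure_mono fun A hA => right_ne_zero_of_mul hA
  refine ⟨fun A => (∫ B, f₀ B)⁻¹ * f₀ A, ⟨contDiff_const.mul hf₀, ?_, ?_, ?_, ?_, ?_⟩, ?_⟩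
  · exact hcomp.of_isClosed_subset (isClosed_tsupport _) hts
  · exact fun A hA => (hball (hsupp (hts hA))).2
  · exact fun A => mul_nonneg (inv_nonneg.2 hpos.le) (h0 A)
  · rw [integral_const_mul, inv_mul_cancel₀ hpos.ne']
  · intro g hg A
    simp only [f₀, sqDistOne_conj hg]
  · exact fun A hA => (hball (hsupp (hts hA))).1

end Mollifiers

section Smoothing

open Set Module Filter Topology Metric
open scoped ContDiff

variable {n : ℕ}

/-- The average of a valuation over matrices against a density. -/
def smoothing (f : MatN n → ℝ) (μ : ConvexBody (Eucl n) → ℝ) (K : ConvexBody (Eucl n)) : ℝ :=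
  ∫ A : MatN n, f A * μ (matBody (Matrix.of A)⁻¹ K)

lemma isUnit_inv_of {A : MatN n} (hA : IsUnit (Matrix.of A)) : IsUnit (Matrix.of A)⁻¹ := by
  rwa [Matrix.isUnit_nonsing_inv_iff]

lemma injective_toEuclideanLin {A : Matrix (Fin n) (Fin n) ℝ} (hA : IsUnit A) :
    Function.Injective (Matrix.toEuclideanLin A) := by
  have h : ∀ x : Eucl n, Matrix.toEuclideanLin A⁻¹ (Matrix.toEuclideanLin A x) = x := fun x => by
    have := Matrix.nonsing_inv_mul _ ((Matrix.isUnit_iff_isUnit_det _).1 hA)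
    simp [Matrix.toLpLin_apply, this]
  exact Function.LeftInverse.injective h

lemma continuous_smoothing_integrand {f : MatN n → ℝ} (hf : IsMollifier f)
    {μ : ConvexBody (Eucl n) → ℝ} (hμ : Continuous μ) :
    Continuous fun p : ConvexBody (Eucl n) × MatN n =>
      f p.2 * μ (matBody (Matrix.of p.2)⁻¹ p.1) := by
  refine continuous_iff_continuousAt.2 fun ⟨K, A⟩ => ?_
  by_cases hA : A ∈ tsupport f
  · have h1 := continuousAt_inv_matBody hμ (hf.unit hA) K
    have h2 : ContinuousAt (fun p : ConvexBody (Eucl n) × MatN n =>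
        μ (matBody (Matrix.of p.2)⁻¹ p.1)) (K, A) :=
      ContinuousAt.comp (f := Prod.swap) (x := (K, A)) h1 continuous_swap.continuousAt
    exact (hf.smooth.continuous.comp continuous_snd).continuousAt.mul h2
  · have h1 : ∀ᶠ p : ConvexBody (Eucl n) × MatN n in 𝓝 (K, A), f p.2 = 0 := by
      have h2 : ∀ᶠ B in 𝓝 A, f B = 0 := notMem_tsupport_iff_eventuallyEq.1 hA
      exact (continuous_snd.tendsto (K, A)).eventually h2
    refine ContinuousAt.congr (f := fun _ => (0 : ℝ)) continuousAt_const ?_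
    filter_upwards [h1] with p hp
    rw [hp, zero_mul]

lemma continuous_smoothing_integrand_left {f : MatN n → ℝ} (hf : IsMollifier f)
    {μ : ConvexBody (Eucl n) → ℝ} (hμ : Continuous μ) (K : ConvexBody (Eucl n)) :
    Continuous fun A : MatN n => f A * μ (matBody (Matrix.of A)⁻¹ K) := by
  have h : Continuous fun A : MatN n => (K, A) := by fun_prop
  exact (continuous_smoothing_integrand hf hμ).comp h

lemma integrable_smoothing {f : MatN n → ℝ} (hf : IsMollifier f)
    {μ : ConvexBody (Eucl n) → ℝ} (hμ : Continuous μ) (K : ConvexBody (Eucl n)) :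
    Integrable fun A : MatN n => f A * μ (matBody (Matrix.of A)⁻¹ K) :=
  (continuous_smoothing_integrand_left hf hμ K).integrable_of_hasCompactSupport hf.compact.mul_right

lemma continuous_smoothing {f : MatN n → ℝ} (hf : IsMollifier f)
    {μ : ConvexBody (Eucl n) → ℝ} (hμ : Continuous μ) : Continuous (smoothing f μ) := by
  have h := continuous_parametric_integral_of_continuous (μ := (volume : Measure (MatN n)))
    (f := fun (K : ConvexBody (Eucl n)) (A : MatN n) => f A * μ (matBody (Matrix.of A)⁻¹ K))
    (continuous_smoothing_integrand hf hμ) hf.compact.isCompact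
  refine h.congr fun K => ?_
  refine setIntegral_eq_integral_of_forall_compl_eq_zero fun A hA => ?_
  rw [image_eq_zero_of_notMem_tsupport hA, zero_mul]

lemma IsCTV.smoothing {f : MatN n → ℝ} (hf : IsMollifier f)
    {μ : ConvexBody (Eucl n) → ℝ} (hμ : IsCTV μ) : IsCTV (smoothing f μ) := by
  refine ⟨fun K L M I hM hI => ?_, fun K x => ?_, continuous_smoothing hf hμ.cont⟩
  · have hint := integrable_smoothing hf hμ.cont
    simp only [_root_.smoothing]
    rw [← integral_add (hint M) (hint I), ← integral_add (hint K) (hint L)]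
    refine integral_congr_ae (.of_forall fun A => ?_)
    beta_reduce
    by_cases hA : f A = 0
    · simp [hA]
    have hu := isUnit_inv_of (hf.unit (subset_tsupport _ hA))
    rw [← mul_add, ← mul_add, hμ.val (matBody _ K) (matBody _ L) (matBody _ M) (matBody _ I)]
    · rw [coe_matBody, coe_matBody, coe_matBody, hM, image_union]
    · rw [coe_matBody, coe_matBody, coe_matBody, hI, image_inter (injective_toEuclideanLin hu)]
  · simp only [_root_.smoothing]
    refine integral_congr_ae (.of_forall fun A => ?_)
    beta_reduce
    rw [← hμ.trans (matBody _ K) (Matrix.toEuclideanLin (Matrix.of A)⁻¹ x)]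
    congr 2
    refine ConvexBody.ext ?_
    change Matrix.toEuclideanLin _ '' ((K : Set (Eucl n)) + {x}) =
      Matrix.toEuclideanLin _ '' (K : Set (Eucl n)) + {_}
    rw [image_add, image_singleton]

lemma smoothing_matBody {f : MatN n → ℝ} (hf : IsMollifier f) {μ : ConvexBody (Eucl n) → ℝ}
    {g : MatN n} (hg : Matrix.of g ∈ Matrix.orthogonalGroup (Fin n) ℝ)
    (hμ : ∀ K, μ (matBody (Matrix.of g) K) = μ K) (K : ConvexBody (Eucl n)) :
    smoothing f μ (matBody (Matrix.of g) K) = smoothing f μ K := by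
  have hu : IsUnit (Matrix.of g) := isUnit_of_mem_orthogonalGroup hg
  have hdet := (Matrix.isUnit_iff_isUnit_det _).1 hu
  obtain ⟨c, hc⟩ := exists_integral_comp_linearEquiv (volume : Measure (MatN n)) (conjEquiv hu)
  have hconj : ∀ A, f (conjEquiv hu A) = f A := hf.conj g hg
  have hc1 : c = 1 := by
    have := hc f
    simp only [hconj, hf.integral, mul_one] at this
    exact this.symm
  have h := hc fun A => f A * μ (matBody (Matrix.of A)⁻¹ K)
  rw [hc1, one_mul] at h
  rw [smoothing, smoothing, ← h]
  refine integral_congr_ae (.of_forall fun A => ?_)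
  beta_reduce
  rw [hconj, ← hμ (matBody (Matrix.of (conjEquiv hu A))⁻¹ K), ← matBody_mul, ← matBody_mul]
  congr 3
  have e : Matrix.of (conjEquiv hu A) = (Matrix.of g)⁻¹ * (Matrix.of A * Matrix.of g) := by
    change Matrix.of (mulN (invN g) (mulN A g)) = _
    rw [of_mulN, of_mulN, of_invN]
  rw [e, Matrix.mul_inv_rev, Matrix.mul_inv_rev, Matrix.nonsing_inv_nonsing_inv _ hdet, ← mul_assoc,
    ← mul_assoc, Matrix.mul_nonsing_inv _ hdet, one_mul]

lemma contDiffOn_integral_mollifier {F : Type*} [NormedAddCommGroup F] [NormedSpace ℝ F]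
    {f : MatN n → ℝ} (hf : IsMollifier f) {Ψ : MatN n → F}
    (hΨ : ContinuousOn Ψ {A : MatN n | IsUnit (Matrix.of A)}) :
    ContDiffOn ℝ ((⊤ : ℕ∞) : ℕ∞ω) (fun B => ∫ C : MatN n, f (mulN (invN B) C) • Ψ C)
      {A : MatN n | IsUnit (Matrix.of A)} := by
  intro B₀ hB₀
  obtain ⟨k₁, hk₁, hBk, hk₁u⟩ := exists_compact_subset (isOpen_isUnit_of (n := n)) hB₀
  let k : Set (MatN n) := (fun p : MatN n × MatN n => mulN p.1 p.2) '' (k₁ ×ˢ tsupport f)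
  have hk : IsCompact k := (hk₁.prod hf.compact.isCompact).image continuous_mulN
  have hku : k ⊆ {A : MatN n | IsUnit (Matrix.of A)} := by
    rintro _ ⟨⟨A, B⟩, ⟨hA, hB⟩, rfl⟩
    rw [mem_ofPred_eq, of_mulN]
    exact (hk₁u hA).mul (hf.unit hB)
  have hmem : ∀ B ∈ interior k₁, ∀ C, C ∉ k → f (mulN (invN B) C) = 0 := by
    intro B hB C hC
    by_contra h
    refine hC ⟨(B, mulN (invN B) C), ⟨interior_subset hB, subset_tsupport _ h⟩, ?_⟩
    beta_reduce
    rw [← mulN_assoc, mulN_invN (hk₁u (interior_subset hB)), oneN_mulN]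
  have hloc : LocallyIntegrable (k.indicator Ψ) (volume : Measure (MatN n)) :=
    (((hΨ.mono hku).integrableOn_compact hk).integrable_indicator
      hk.isClosed.measurableSet).locallyIntegrable
  have hg : ContDiffOn ℝ ((⊤ : ℕ∞) : ℕ∞ω)
      (↿(fun (B C : MatN n) => f (mulN (invN B) (-C)))) (interior k₁ ×ˢ univ) := by
    refine hf.smooth.comp_contDiffOn ?_
    refine contDiff_mulN.comp_contDiffOn (ContDiffOn.prodMk ?_ ?_)
    · exact contDiffOn_invN.comp contDiff_fst.contDiffOn fun p hp =>
        hk₁u (interior_subset hp.1)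
    · exact contDiff_snd.neg.contDiffOn
  have h := contDiffOn_convolution_right_with_param_comp (μ := (volume : Measure (MatN n)))
    (ContinuousLinearMap.lsmul ℝ ℝ (E := F)).flip (v := fun _ => (0 : MatN n))
    (contDiffOn_const (n := ((⊤ : ℕ∞) : ℕ∞ω)) (s := interior k₁)) isOpen_interior
    (hk.neg) (g := fun B C => f (mulN (invN B) (-C)))
    (fun B C hB hC => hmem B hB _ (by simpa using hC)) hloc hg
  have h2 : ContDiffOn ℝ ((⊤ : ℕ∞) : ℕ∞ω) (fun B => ∫ C : MatN n, f (mulN (invN B) C) • Ψ C)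
      (interior k₁) := by
    refine h.congr fun B hB => integral_congr_ae (.of_forall fun C => ?_)
    beta_reduce
    rw [ContinuousLinearMap.flip_apply, ContinuousLinearMap.lsmul_apply, zero_sub, neg_neg]
    by_cases hC : C ∈ k
    · rw [indicator_of_mem hC]
    · rw [hmem B hB C hC, zero_smul, zero_smul]
  exact (h2.contDiffAt (isOpen_interior.mem_nhds hBk)).contDiffWithinAt

end Smoothing

section SmoothVectors

open Set Module Filter Topology Metric
open scoped ContDiff

variable {n : ℕ}

lemma integrable_mollifier_smul {F : Type*} [NormedAddCommGroup F] [NormedSpace ℝ F]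
    {f : MatN n → ℝ} (hf : IsMollifier f) {Ψ : MatN n → F}
    (hΨ : ContinuousOn Ψ {A : MatN n | IsUnit (Matrix.of A)}) {B : MatN n}
    (hB : IsUnit (Matrix.of B)) : Integrable fun C : MatN n => f (mulN (invN B) C) • Ψ C := by
  have hmul : ∀ A : MatN n, Continuous fun C : MatN n => mulN A C := fun A => by
    have h : Continuous fun C : MatN n => (A, C) := by fun_prop
    exact continuous_mulN.comp h
  have hk : IsCompact ((fun C => mulN B C) '' tsupport f) := hf.compact.isCompact.image (hmul B)
  refine (integrableOn_iff_integrable_of_support_subset (fun C hC => ?_)).1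
    (ContinuousOn.integrableOn_compact hk (((hf.smooth.continuous.comp
      (hmul (invN B))).continuousOn).smul (hΨ.mono ?_)))
  · refine ⟨mulN (invN B) C, subset_tsupport _ (left_ne_zero_of_smul hC), ?_⟩
    beta_reduce
    rw [← mulN_assoc, mulN_invN hB, oneN_mulN]
  · rintro _ ⟨A, hA, rfl⟩
    rw [mem_ofPred_eq, of_mulN]
    exact hB.mul (hf.unit hA)

lemma orbitMap_smoothing {f : MatN n → ℝ} (hf : IsMollifier f) {μ : ConvexBody (Eucl n) → ℝ}
    (hμ : Continuous μ) {B : MatN n} (hB : IsUnit (Matrix.of B)) :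
    orbitMap (continuous_smoothing hf hμ) B =
      (∫ C : MatN n, f (mulN (invN B) C))⁻¹ • ∫ C : MatN n, f (mulN (invN B) C) • orbitMap hμ C := by
  obtain ⟨c, hc⟩ := exists_integral_comp_linearEquiv (volume : Measure (MatN n)) (mulLeftEquiv hB)
  have hinv : ∀ A, mulN (invN B) (mulLeftEquiv hB A) = A := (mulLeftEquiv hB).left_inv
  have hc1 : 1 = c * ∫ C : MatN n, f (mulN (invN B) C) := by
    rw [← hc, ← hf.integral]
    simp only [hinv]
  have hc2 : (∫ C : MatN n, f (mulN (invN B) C))⁻¹ = c := (eq_inv_of_mul_eq_one_left hc1.symm).symm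
  refine BoundedContinuousFunction.ext fun K => ?_
  have h1 : (∫ C : MatN n, f (mulN (invN B) C) • orbitMap hμ C) K =
      ∫ C : MatN n, f (mulN (invN B) C) * μ (matBody (Matrix.of C)⁻¹ K.1) :=
    ((BoundedContinuousFunction.evalCLM ℝ K).integral_comp_comm
      (integrable_mollifier_smul hf (continuousOn_orbitMap hμ) hB)).symm
  rw [BoundedContinuousFunction.smul_apply, h1, hc2, smul_eq_mul, ← hc, orbitMap_apply, smoothing]
  refine integral_congr_ae (.of_forall fun A => ?_)
  beta_reduce
  have e : (Matrix.of (mulLeftEquiv hB A))⁻¹ = (Matrix.of A)⁻¹ * (Matrix.of B)⁻¹ := by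
    rw [← Matrix.mul_inv_rev, ← of_mulN]
    rfl
  rw [hinv, e, matBody_mul]

/-- Smoothness of the orbit map of a valuation. -/
def IsSmoothVal (μ : ConvexBody (Eucl n) → ℝ) : Prop :=
  ∃ h : Continuous μ, ContDiffOn ℝ ((⊤ : ℕ∞) : ℕ∞ω) (orbitMap h) {A : MatN n | IsUnit (Matrix.of A)}

lemma isSmoothVal_smoothing {f : MatN n → ℝ} (hf : IsMollifier f) {μ : ConvexBody (Eucl n) → ℝ}
    (hμ : Continuous μ) : IsSmoothVal (smoothing f μ) := by
  refine ⟨continuous_smoothing hf hμ, ?_⟩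
  have h1 := contDiffOn_integral_mollifier hf (continuousOn_orbitMap hμ)
  have h2 := contDiffOn_integral_mollifier hf (Ψ := fun _ => (1 : ℝ)) continuousOn_const
  simp only [smul_eq_mul, mul_one] at h2
  refine ((h2.inv fun B hB h0 => ?_).smul h1).congr fun B hB => orbitMap_smoothing hf hμ hB
  obtain ⟨c, hc⟩ := exists_integral_comp_linearEquiv (volume : Measure (MatN n)) (mulLeftEquiv hB)
  have hinv : ∀ A, mulN (invN B) (mulLeftEquiv hB A) = A := (mulLeftEquiv hB).left_inv
  have h := hc fun C => f (mulN (invN B) C)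
  simp only [hinv, hf.integral, h0, mul_zero] at h
  exact one_ne_zero h

/-- Restriction of valuations of a finite-dimensional space to the bodies in the unit ball. -/
def unitRestrict (𝒜 : Set (Eucl n ≃ₗᵢ[ℝ] Eucl n)) [Nontrivial (Eucl n)] :
    invVal 𝒜 →ₗ[ℝ] BoundedContinuousFunction (UnitBodies n) ℝ where
  toFun ν := orbitMap (mem_invVal.1 ν.2).1.cont (oneN n)
  map_add' _ _ := rfl
  map_smul' _ _ := rfl

/-- The smooth valuations in a space of invariant valuations. -/
def smoothInvVal (𝒜 : Set (Eucl n ≃ₗᵢ[ℝ] Eucl n)) [Nontrivial (Eucl n)] :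
    Submodule ℝ (invVal 𝒜) where
  carrier := {ν | IsSmoothVal (ν : ConvexBody (Eucl n) → ℝ)}
  zero_mem' := ⟨continuous_const, contDiffOn_const (c := 0)⟩
  add_mem' := by
    rintro a b ⟨ha, ha'⟩ ⟨hb, hb'⟩
    exact ⟨ha.add hb, ha'.add hb'⟩
  smul_mem' := by
    rintro c a ⟨ha, ha'⟩
    exact ⟨ha.const_smul c, ha'.const_smul c⟩

lemma exists_mollifier_norm_sub_le {μ : ConvexBody (Eucl n) → ℝ} (hμ : Continuous μ) {η : ℝ}
    (hη : 0 < η) : ∃ (f : MatN n → ℝ) (hf : IsMollifier f),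
      ‖orbitMap (continuous_smoothing hf hμ) (oneN n) - orbitMap hμ (oneN n)‖ ≤ η := by
  have h1 : IsUnit (Matrix.of (oneN n)) := by simp [of_oneN]
  have hc : ContinuousAt (orbitMap hμ) (oneN n) :=
    (continuousOn_orbitMap hμ).continuousAt (isOpen_isUnit_of.mem_nhds h1)
  obtain ⟨f, hf, hfU⟩ := exists_isMollifier (hc.preimage_mem_nhds (closedBall_mem_nhds _ hη))
  refine ⟨f, hf, (BoundedContinuousFunction.norm_le hη.le).2 fun K => ?_⟩
  have e : (orbitMap (continuous_smoothing hf hμ) (oneN n) - orbitMap hμ (oneN n)) K =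
      ∫ A : MatN n, f A * (orbitMap hμ A K - orbitMap hμ (oneN n) K) := by
    simp only [mul_sub]
    have hi : Integrable fun A : MatN n => f A * orbitMap hμ A K := integrable_smoothing hf hμ K.1
    rw [integral_sub hi
      ((hf.smooth.continuous.integrable_of_hasCompactSupport hf.compact).mul_const _),
      integral_mul_const, hf.integral, one_mul, BoundedContinuousFunction.sub_apply]
    congr 1
    rw [orbitMap_apply, of_oneN, inv_one, matBody_one, smoothing]
    rfl
  rw [e]
  have hint := hf.smooth.continuous.integrable_of_hasCompactSupport (μ := volume) hf.compact
  refine (norm_integral_le_of_norm_le (hint.mul_const η) (.of_forall fun A => ?_)).trans_eq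
    (by rw [integral_mul_const, hf.integral, one_mul])
  rw [norm_mul, Real.norm_of_nonneg (hf.nonneg A)]
  by_cases hA : f A = 0
  · simp [hA]
  refine mul_le_mul_of_nonneg_left ?_ (hf.nonneg A)
  have h2 : ‖orbitMap hμ A - orbitMap hμ (oneN n)‖ ≤ η := by
    rw [← dist_eq_norm]
    exact mem_closedBall.1 (hfU (subset_tsupport _ hA))
  exact ((orbitMap hμ A - orbitMap hμ (oneN n)).norm_coe_le_norm K).trans h2

/-- The linear isometry of an orthogonal matrix. -/
def orthogonalIsometry {g : Matrix (Fin n) (Fin n) ℝ} (hg : g ∈ Matrix.orthogonalGroup (Fin n) ℝ) :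
    Eucl n ≃ₗᵢ[ℝ] Eucl n :=
  LinearIsometry.toLinearIsometryEquiv
    ⟨Matrix.toEuclideanLin g, fun x => by
      have h : g.transpose * g = 1 := mul_eq_one_comm.1 ((Matrix.mem_orthogonalGroup_iff _ _).1 hg)
      have h2 : ‖Matrix.toEuclideanLin g x‖ ^ 2 = ‖x‖ ^ 2 := by
        rw [← real_inner_self_eq_norm_sq, ← real_inner_self_eq_norm_sq,
          EuclideanSpace.inner_eq_star_dotProduct, EuclideanSpace.inner_eq_star_dotProduct]
        simp only [Matrix.toLpLin_apply, star_trivial]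
        rw [Matrix.dotProduct_mulVec, ← Matrix.mulVec_transpose, Matrix.mulVec_mulVec, h,
          Matrix.one_mulVec]
      exact (sq_eq_sq₀ (norm_nonneg _) (norm_nonneg _)).1 h2⟩ rfl

lemma isSmoothVal_of_gInv {G : Set (Matrix (Fin n) (Fin n) ℝ)} [Nontrivial (Eucl n)]
    (hG : ∀ A ∈ G, A ∈ Matrix.orthogonalGroup (Fin n) ℝ) (htrans : ActsTransitively G)
    {μ : ConvexBody (Eucl n) → ℝ} (hμ : IsCTV μ) (hGinv : GInv G μ) : IsSmoothVal μ := by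
  let 𝒜 : Set (Eucl n ≃ₗᵢ[ℝ] Eucl n) := {A | ∃ g ∈ G, ∀ x, A x = Matrix.toEuclideanLin g x}
  have hmem : ∀ ν : ConvexBody (Eucl n) → ℝ, IsCTV ν → GInv G ν → ν ∈ invVal 𝒜 := by
    refine fun ν h1 h2 => mem_invVal.2 ⟨h1, ?_⟩
    rintro A ⟨g, hg, hA⟩ K L hL
    have : L = matBody g K := ConvexBody.ext (by rw [hL, coe_matBody]; exact image_congr' hA)
    rw [this, h2 g hg]
  have hfin : FiniteDimensional ℝ (invVal 𝒜) := by
    refine finiteDimensional_invVal 𝒜 fun u v hu hv => ?_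
    obtain ⟨g, hg, h⟩ := htrans u v hu hv
    exact ⟨orthogonalIsometry (hG g hg), ⟨g, hg, fun _ => rfl⟩, h⟩
  let S : Submodule ℝ (BoundedContinuousFunction (UnitBodies n) ℝ) :=
    (smoothInvVal 𝒜).map (unitRestrict 𝒜)
  have hS : IsClosed (S : Set (BoundedContinuousFunction (UnitBodies n) ℝ)) :=
    S.closed_of_finiteDimensional
  have hμS : orbitMap hμ.cont (oneN n) ∈ S := by
    refine hS.closure_subset (Metric.mem_closure_iff.2 fun ε hε => ?_)
    obtain ⟨f, hf, h⟩ := exists_mollifier_norm_sub_le hμ.cont (half_pos hε)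
    have h1 : GInv G (smoothing f μ) := fun g hg K =>
      smoothing_matBody hf (g := Matrix.of.symm g) (hG g hg) (hGinv g hg) K
    refine ⟨_, ⟨⟨smoothing f μ, hmem _ (hμ.smoothing hf) h1⟩, isSmoothVal_smoothing hf hμ.cont, rfl⟩,
      ?_⟩
    rw [dist_comm, dist_eq_norm]
    exact h.trans_lt (half_lt_self hε)
  obtain ⟨⟨ν, hν⟩, hνs, hνμ⟩ := hμS
  have hνc := (mem_invVal.1 hν).1
  have hd : IsCTV (ν - μ) := (mem_invVal.1 ((invVal 𝒜).sub_mem hν (hmem μ hμ hGinv))).1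
  have hb : UnitBound (ν - μ) 0 := by
    intro K hK
    have := DFunLike.congr_fun hνμ ⟨K, hK⟩
    change ν (matBody _ K) = μ (matBody _ K) at this
    rw [of_oneN, inv_one, matBody_one] at this
    simp [this]
  have hz : ν = μ := by
    funext K
    obtain ⟨R, hR⟩ := K.isBounded.subset_closedBall 0
    have h := abs_le_of_subset_closedBall hd.val hd.trans hb (EuclideanSpace.basisFun (Fin n) ℝ)
      (le_max_right R 0) K (hR.trans (closedBall_subset_closedBall (le_max_left R 0)))
    rw [mul_zero] at h
    exact sub_eq_zero.1 (abs_nonpos_iff.1 h)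
  exact hz ▸ hνs

end SmoothVectors

/-- Every `G`-invariant continuous translation invariant valuation is smooth: for each
invertible matrix `A` the function `K ↦ μ(A⁻¹ K)` is a bounded continuous function on the
space `𝒦₁` of convex bodies contained in the unit ball, and the resulting map from the open
set of invertible `n × n` matrices to the Banach space of bounded continuous functions on
`𝒦₁` is infinitely differentiable. -/
theorem valG_subset_smooth (n : ℕ) (hn : 1 ≤ n)
    (G : Set (Matrix (Fin n) (Fin n) ℝ)) (hG : IsClosedSubgroupO G)
    (htrans : ActsTransitively G)
    (μ : ConvexBody (Eucl n) → ℝ)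
    (hval : IsValuation μ) (hcont : Continuous μ) (htrans' : TransInv μ) (hGinv : GInv G μ) :
    ∃ F : MatN n → BoundedContinuousFunction (UnitBodies n) ℝ,
      (∀ A : MatN n, IsUnit (Matrix.of A) → ∀ K : UnitBodies n,
        F A K = μ (matBody (Matrix.of A)⁻¹ K.1)) ∧
      ContDiffOn ℝ (⊤ : ℕ∞) F {A : MatN n | IsUnit (Matrix.of A)} := by
  have : NeZero n := ⟨by omega⟩
  have : Nontrivial (Eucl n) := inferInstance
  obtain ⟨h, hs⟩ := isSmoothVal_of_gInv hG.1 htrans ⟨hval, htrans', hcont⟩ hGinv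
  exact ⟨orbitMap h, fun _ _ _ => rfl, hs⟩
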